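/- Fix β > −1, T > 0, C₁ > 0. Let u and f be functions of (ρ,θ,t) on {0 < ρ < 1}×ℝ×[0,T], 2π-periodic in θ, with u twice continuously differentiable in (ρ,θ) and once in t, solving pointwise ∂_t u = e^{−2u} △̃u + f, and suppose sup|u| + sup|f| ≤ C₁. Assume max_{t∈[0,T]} ∫₀^{2π}∫₀¹ |∇̃u|² dṼ + ∫₀^T ∫₀^{2π}∫₀¹ |∂_t u|² dṼ dt < ∞. Then for every σ ∈ (0,1) there exist α' > 0 depending only on β and C₁, and C₂ depending only on β, C₁ and σ, such that for all ρ₁, ρ₂ ∈ (0,1−σ], all θ₁, θ₂, and all t, s ∈ [σ,T]: |u(ρ₁,θ₁,t) − u(ρ₂,θ₂,s)| ≤ C₂ ( |P(ρ₁,θ₁) − P(ρ₂,θ₂)| + √|t−s| )^{α'}, where P(ρ,θ) = (ρ cos θ, ρ sin θ) ∈ ℝ². -/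

import Mathlib

open Real MeasureTheory Set

open scoped ENNReal

/-- The cone Laplacian `△̃ = ∂²/∂ρ² + ρ⁻¹ ∂/∂ρ + (β+1)⁻² ρ⁻² ∂²/∂θ²` applied to the
spatial slice of a function `u(ρ,θ,t)`. -/
noncomputable def coneLapT (β : ℝ) (u : ℝ → ℝ → ℝ → ℝ) (ρ θ t : ℝ) : ℝ :=
  deriv (fun r => deriv (fun r' => u r' θ t) r) ρ
    + ρ⁻¹ * deriv (fun r => u r θ t) ρ
    + ((β + 1) ^ 2)⁻¹ * (ρ ^ 2)⁻¹ * deriv (fun s => deriv (fun s' => u ρ s' t) s) θ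

/-- `|∇̃u|² = |∂_ρ u|² + ((β+1)ρ)⁻² |∂_θ u|²` for the cone metric. -/
noncomputable def gradSq (β : ℝ) (u : ℝ → ℝ → ℝ → ℝ) (ρ θ t : ℝ) : ℝ :=
  (deriv (fun r => u r θ t) ρ) ^ 2
    + (((β + 1) * ρ) ^ 2)⁻¹ * (deriv (fun s => u ρ s t) θ) ^ 2

/-- Time derivative on `[0,T]` (one-sided at the endpoints). -/
noncomputable def dtime (T : ℝ) (h : ℝ → ℝ) (t : ℝ) : ℝ :=
  derivWithin h (Set.Icc 0 T) t

theorem posPow_hasDerivAt (n : ℕ) (x : ℝ) :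
    HasDerivAt (fun x : ℝ => (max x 0) ^ (n + 2)) ((n + 2 : ℕ) * (max x 0) ^ (n + 1)) x := by
  rcases lt_trichotomy x 0 with h | h | h
  · have h1 : (fun x : ℝ => (max x 0) ^ (n + 2)) =ᶠ[nhds x] fun _ => 0 := by
      filter_upwards [eventually_lt_nhds h] with y hy
      simp [max_eq_right hy.le]
    rw [max_eq_right h.le]
    simpa using (hasDerivAt_const x (0:ℝ)).congr_of_eventuallyEq h1
  · subst h
    simp only [max_self]
    rw [hasDerivAt_iff_isLittleO]
    simp only [max_self, sub_zero, ne_eq, Nat.add_eq_zero_iff, one_ne_zero, and_false,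
      not_false_eq_true, zero_pow, mul_zero, smul_zero, OfNat.ofNat_ne_zero]
    have : (fun x : ℝ => (max x 0) ^ (n + 2)) =O[nhds 0] fun x : ℝ => x ^ (n + 2) := by
      apply Asymptotics.IsBigO.of_bound 1
      refine Filter.Eventually.of_forall fun y => ?_
      rw [one_mul, norm_pow, norm_pow]
      refine pow_le_pow_left₀ (norm_nonneg _) ?_ _
      rw [Real.norm_eq_abs, Real.norm_eq_abs, abs_of_nonneg (le_max_right _ _)]
      exact max_le (le_abs_self _) (abs_nonneg _)
    refine this.trans_isLittleO ?_
    simpa using (Asymptotics.isLittleO_pow_id (𝕜 := ℝ) (n := n + 2) (by omega))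
  · have h1 : (fun x : ℝ => (max x 0) ^ (n + 2)) =ᶠ[nhds x] fun x => x ^ (n + 2) := by
      filter_upwards [eventually_gt_nhds h] with y hy
      simp [max_eq_left hy.le]
    rw [max_eq_left h.le]
    simpa using (hasDerivAt_pow (n + 2) x).congr_of_eventuallyEq h1

/-- `g` is differentiable near `0` with first derivative `d₁` at `0` and second derivative `d₂`. -/
def D2 (g : ℝ → ℝ) (d₁ d₂ : ℝ) : Prop :=
  ∃ g' : ℝ → ℝ, (∀ᶠ τ in nhds 0, HasDerivAt g (g' τ) τ) ∧ g' 0 = d₁ ∧ HasDerivAt g' d₂ 0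

theorem D2.add {f g : ℝ → ℝ} {a b c d : ℝ} (hf : D2 f a b) (hg : D2 g c d) :
    D2 (fun x => f x + g x) (a + c) (b + d) := by
  obtain ⟨f', h1, h2, h3⟩ := hf
  obtain ⟨g', k1, k2, k3⟩ := hg
  refine ⟨fun x => f' x + g' x, ?_, by simp [h2, k2], h3.add k3⟩
  filter_upwards [h1, k1] with x hx kx using hx.add kx

theorem D2.const_mul {f : ℝ → ℝ} {a b : ℝ} (c : ℝ) (hf : D2 f a b) :
    D2 (fun x => c * f x) (c * a) (c * b) := by
  obtain ⟨f', h1, h2, h3⟩ := hf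
  refine ⟨fun x => c * f' x, ?_, by simp [h2], h3.const_mul c⟩
  filter_upwards [h1] with x hx using hx.const_mul c

theorem D2.sub {f g : ℝ → ℝ} {a b c d : ℝ} (hf : D2 f a b) (hg : D2 g c d) :
    D2 (fun x => f x - g x) (a - c) (b - d) := by
  obtain ⟨f', h1, h2, h3⟩ := hf
  obtain ⟨g', k1, k2, k3⟩ := hg
  refine ⟨fun x => f' x - g' x, ?_, by simp [h2, k2], h3.sub k3⟩
  filter_upwards [h1, k1] with x hx kx using hx.sub kx

theorem D2.mul {f g : ℝ → ℝ} {a b c d : ℝ} (hf : D2 f a b) (hg : D2 g c d) :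
    D2 (fun x => f x * g x) (a * g 0 + f 0 * c) (b * g 0 + 2 * (a * c) + f 0 * d) := by
  obtain ⟨f', h1, h2, h3⟩ := hf
  obtain ⟨g', k1, k2, k3⟩ := hg
  refine ⟨fun x => f' x * g x + f x * g' x, ?_, by simp [h2, k2], ?_⟩
  · filter_upwards [h1, k1] with x hx kx using hx.mul kx
  · have h0 := h1.self_of_nhds
    have k0 := k1.self_of_nhds
    have := (h3.mul k0).add (h0.mul k3)
    rw [h2, k2] at this
    refine this.congr_deriv ?_
    ring

theorem D2.affine (s p : ℝ) : D2 (fun τ => s + τ * p) p 0 := by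
  refine ⟨fun _ => p, Filter.Eventually.of_forall fun τ => ?_, rfl, hasDerivAt_const _ _⟩
  simpa using ((hasDerivAt_id τ).mul_const p).const_add s

theorem D2.comp {F F' : ℝ → ℝ} {F2 : ℝ} {g : ℝ → ℝ} {a b y : ℝ} (hg : D2 g a b) (hy : g 0 = y)
    (hF : ∀ᶠ x in nhds y, HasDerivAt F (F' x) x) (hF' : HasDerivAt F' F2 y) :
    D2 (fun x => F (g x)) (F' y * a) (F2 * a ^ 2 + F' y * b) := by
  obtain ⟨g', k1, k2, k3⟩ := hg
  subst hy
  have k0 := k1.self_of_nhds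
  refine ⟨fun x => F' (g x) * g' x, ?_, by simp [k2], ?_⟩
  · filter_upwards [k1, k0.continuousAt.eventually hF] with x hx hx2 using hx2.comp x hx
  · have := (HasDerivAt.comp (0:ℝ) (h₂ := F') (h := g) hF' k0).mul k3
    rw [k2] at this
    refine this.congr_deriv ?_
    simp only [Function.comp]
    ring

theorem D2.congr {f g : ℝ → ℝ} {a b : ℝ} (hf : D2 f a b) (h : g =ᶠ[nhds 0] f) : D2 g a b := by
  obtain ⟨f', h1, h2, h3⟩ := hf
  refine ⟨f', ?_, h2, h3⟩
  filter_upwards [h1, h.eventuallyEq_nhds] with x hx hx2 using hx.congr_of_eventuallyEq hx2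

theorem D2.exp {g : ℝ → ℝ} {a b : ℝ} (hg : D2 g a b) :
    D2 (fun x => Real.exp (g x)) (Real.exp (g 0) * a) (Real.exp (g 0) * (b + a ^ 2)) := by
  have := hg.comp rfl (F := Real.exp) (F' := Real.exp)
    (Filter.Eventually.of_forall fun x => Real.hasDerivAt_exp x) (Real.hasDerivAt_exp _)
  convert this using 1
  ring

theorem D2.log {g : ℝ → ℝ} {a b : ℝ} (hg : D2 g a b) (h0 : 0 < g 0) :
    D2 (fun x => Real.log (g x)) (a / g 0) (b / g 0 - (a / g 0) ^ 2) := by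
  have := hg.comp rfl (F := Real.log) (F' := fun x => x⁻¹)
    ((eventually_gt_nhds h0).mono fun x hx => Real.hasDerivAt_log hx.ne')
    (hasDerivAt_inv h0.ne')
  convert this using 1
  · field_simp
  · field_simp
    ring

/-- second derivative test at a local maximum -/
theorem D2.nonpos {g : ℝ → ℝ} {a b : ℝ} (hg : D2 g a b) (hmax : IsLocalMax g 0) : b ≤ 0 := by
  obtain ⟨g', k1, k2, k3⟩ := hg
  by_contra! hb
  have ha : g' 0 = 0 := hmax.hasDerivAt_eq_zero k1.self_of_nhds
  -- derivative positive right of zero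
  have hpos : ∀ᶠ x in nhdsWithin 0 (Ioi 0), 0 < g' x := by
    have h := k3.tendsto_slope_zero_right
    have h2 := h.eventually (eventually_gt_nhds hb)
    filter_upwards [h2, self_mem_nhdsWithin] with x hx hx0
    simp only [zero_add, ha, sub_zero, smul_eq_mul] at hx
    exact (pos_iff_pos_of_mul_pos hx).1 (inv_pos.2 hx0)
  have hall : ∀ᶠ x in nhdsWithin (0:ℝ) (Ioi 0), HasDerivAt g (g' x) x ∧ 0 < g' x ∧ g x ≤ g 0 := by
    filter_upwards [hpos, nhdsWithin_le_nhds k1, nhdsWithin_le_nhds hmax] with x h1 h2 h3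
    exact ⟨h2, h1, h3⟩
  rw [eventually_nhdsWithin_iff, Metric.eventually_nhds_iff] at hall
  obtain ⟨ε, hε, hall⟩ := hall
  have hc : ∀ x ∈ Ioc (0:ℝ) (ε/2), HasDerivAt g (g' x) x ∧ 0 < g' x ∧ g x ≤ g 0 := by
    intro x hx
    refine hall ?_ hx.1
    rw [Real.dist_eq, sub_zero, abs_of_pos hx.1]
    linarith [hx.2]
  have hmono : StrictMonoOn g (Icc 0 (ε/2)) := by
    apply strictMonoOn_of_deriv_pos (convex_Icc _ _)
    · intro x hx
      rcases hx.1.eq_or_lt with h | h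
      · rw [← h]; exact k1.self_of_nhds.continuousAt.continuousWithinAt
      · exact (hc x ⟨h, hx.2⟩).1.continuousAt.continuousWithinAt
    · intro x hx
      rw [interior_Icc] at hx
      rw [(hc x ⟨hx.1, hx.2.le⟩).1.deriv]
      exact (hc x ⟨hx.1, hx.2.le⟩).2.1
  have := hmono (left_mem_Icc.2 (by positivity)) (right_mem_Icc.2 (by positivity)) (by positivity)
  have h2 := (hc (ε/2) ⟨by positivity, le_rfl⟩).2.2
  linarith

/-- maximum principle in time for functions that are only right-continuous jointly -/
theorem time_lemma {X : Type*} [MetricSpace X] {K : Set X} (hK : IsCompact K)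
    {t0 t1 : ℝ} (F : X → ℝ → ℝ)
    (hcont : ∀ x ∈ K, ∀ t ∈ Icc t0 t1,
      ContinuousWithinAt (fun p : X × ℝ => F p.1 p.2) (K ×ˢ Icc t t1) (x, t))
    (h0 : ∀ x ∈ K, F x t0 ≤ 0)
    (hmax : ∀ x ∈ K, ∀ t ∈ Ioc t0 t1, 0 < F x t → (∀ y ∈ K, F y t ≤ F x t) →
      ∃ t' ∈ Ico t0 t, F x t < F x t') :
    ∀ x ∈ K, ∀ t ∈ Icc t0 t1, F x t ≤ 0 := by
  intro x0 hx0 t ht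
  by_contra! hpos
  set m := F x0 t with hm
  let S : Set ℝ := {s | s ∈ Icc t0 t ∧ ∃ x ∈ K, m ≤ F x s}
  have hSne : S.Nonempty := ⟨t, ⟨ht.1, le_rfl⟩, x0, hx0, le_rfl⟩
  have hSbd : BddBelow S := ⟨t0, fun s hs => hs.1.1⟩
  set s := sInf S with hs
  have hs0 : t0 ≤ s := le_csInf hSne fun s hs => hs.1.1
  have hst : s ≤ t := csInf_le hSbd ⟨⟨ht.1, le_rfl⟩, x0, hx0, le_rfl⟩
  obtain ⟨v, -, hv, hvS⟩ := exists_seq_tendsto_sInf hSne hSbd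
  choose hvI x hxK hxm using hvS
  obtain ⟨y, hyK, φ, hφ, hlim⟩ := hK.tendsto_subseq hxK
  have hsm : m ≤ F y s := by
    have hc := hcont y hyK s ⟨hs0, hst.trans ht.2⟩
    have hl : Filter.Tendsto (fun n => (x (φ n), v (φ n))) Filter.atTop
        (nhdsWithin (y, s) (K ×ˢ Icc s t1)) := by
      apply tendsto_nhdsWithin_of_tendsto_nhds_of_eventually_within
      · exact hlim.prodMk_nhds (hv.comp hφ.tendsto_atTop)
      · refine Filter.Eventually.of_forall fun n => ⟨hxK _, ?_, (hvI _).2.trans ht.2⟩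
        exact csInf_le hSbd ⟨hvI _, x _, hxK _, hxm _⟩
    exact ge_of_tendsto (hc.tendsto.comp hl) (Filter.Eventually.of_forall fun n => hxm _)
  -- a maximizer at time s
  have hcs : ContinuousOn (fun x => F x s) K := by
    intro z hz
    have hc := hcont z hz s ⟨hs0, hst.trans ht.2⟩
    have : ContinuousWithinAt (fun x : X => ((x, s) : X × ℝ)) K z :=
      (by fun_prop : Continuous fun x : X => ((x, s) : X × ℝ)).continuousWithinAt
    exact ContinuousWithinAt.comp (f := fun x : X => ((x, s) : X × ℝ)) (t := K ×ˢ Icc s t1) hc this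
      (fun w hw => ⟨hw, le_rfl, hst.trans ht.2⟩)
  obtain ⟨z, hzK, hz⟩ := hK.exists_isMaxOn ⟨y, hyK⟩ hcs
  have hzm : m ≤ F z s := hsm.trans (hz hyK)
  have hs0' : t0 < s := by
    rcases hs0.eq_or_lt with h | h
    · exfalso
      have := h0 z hzK
      rw [h] at this
      linarith
    · exact h
  obtain ⟨t', ht', hlt⟩ := hmax z hzK s ⟨hs0', hst.trans ht.2⟩ (hpos.trans_le hzm) (fun w hw => hz hw)
  have : s ≤ t' := csInf_le hSbd ⟨⟨ht'.1, ht'.2.le.trans hst⟩, z, hzK, hzm.trans hlt.le⟩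
  exact absurd ht'.2 (not_lt.2 this)

set_option maxHeartbeats 4000000 in
theorem alg_extreme (k Θ α κ s1 s2 q1 q2 R X T c : ℝ) (hk : 0 < k) (hΘ : 1 ≤ Θ)
    (hα : 0 < α) (hα1 : α ≤ 1) (hκ : 0 < κ) (hκ1 : κ ≤ 1 / 2)
    (hαk : α ≤ κ * k ^ 2 / (512 * Θ)) (hq1 : 0 < q1) (hq2 : 0 < q2)
    (hT : 0 < T) (hTe : T ≤ 1 / (4 * Θ)) (hc1 : T ≤ c) (hc2 : c ≤ 2 * T)
    (hy : exp s1 ^ 2 ≤ T * exp s2 ^ 2) (hq : q2 ^ 2 ≤ Θ * T * q1 ^ 2)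
    (hR : (exp s2 - exp s1) ^ 2 ≤ R)
    (hX : 4 * k ^ 2 * (q1 - q2) ^ 2 ≤ X) :
    R ^ (α / 2) * (-8 * q1 * q2 * exp s1 * exp s2 / R + 4 * α * (q1 * exp s1 + q2 * exp s2) ^ 2 / R
      + (κ * (-c + 2 * c ^ 3) + α * κ ^ 2 * c ^ 2) * X)
      ≤ - (κ * k ^ 2 / (16 * Θ)) * q2 ^ 2 * exp (α * s2) := by
  generalize hR1 : exp s1 = R1 at hy hR ⊢
  generalize hR2 : exp s2 = R2 at hy hR ⊢
  have hR1p : 0 < R1 := hR1 ▸ exp_pos _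
  have hR2p : 0 < R2 := hR2 ▸ exp_pos _
  have hΘT : Θ * T ≤ 1 / 4 := by
    rw [le_div_iff₀ (by positivity)] at hTe
    linarith
  have hT4 : T ≤ 1 / 4 := by nlinarith
  have hR12 : R1 ≤ R2 / 2 := by
    apply le_of_sq_le_sq _ (by positivity)
    nlinarith [sq_nonneg R2]
  have hq12 : q2 ≤ q1 / 2 := by
    apply le_of_sq_le_sq _ (by positivity)
    nlinarith [sq_nonneg q1]
  have hRlow : R2 ^ 2 / 4 ≤ R := by nlinarith
  have hRp : 0 < R := lt_of_lt_of_le (by positivity) hRlow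
  have hXl : k ^ 2 * q1 ^ 2 ≤ X := by
    have : q1 ^ 2 ≤ 4 * (q1 - q2) ^ 2 := by nlinarith
    nlinarith [sq_nonneg k]
  have hXp : 0 < X := lt_of_lt_of_le (by positivity) hXl
  have hc0 : 0 < c := hT.trans_le hc1
  have hch : c ≤ 1 / 2 := by linarith
  -- main quantities
  have e1 : 4 * α * (q1 * R1 + q2 * R2) ^ 2 / R ≤ 64 * α * Θ * q1 ^ 2 * T := by
    rw [div_le_iff₀ hRp]
    have h1 : (q1 * R1 + q2 * R2) ^ 2 ≤ 2 * (q1 ^ 2 * R1 ^ 2 + q2 ^ 2 * R2 ^ 2) := by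
      nlinarith [sq_nonneg (q1 * R1 - q2 * R2)]
    have h2 : q1 ^ 2 * R1 ^ 2 ≤ q1 ^ 2 * (T * R2 ^ 2) := by gcongr
    have h3 : q2 ^ 2 * R2 ^ 2 ≤ Θ * T * q1 ^ 2 * R2 ^ 2 := by gcongr
    have h4 : q1 ^ 2 * (T * R2 ^ 2) ≤ Θ * T * q1 ^ 2 * R2 ^ 2 := by
      have : 0 ≤ q1 ^ 2 * (T * R2 ^ 2) := by positivity
      nlinarith
    have h5 : (q1 * R1 + q2 * R2) ^ 2 ≤ 4 * (Θ * T * q1 ^ 2 * R2 ^ 2) := by linarith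
    have h6 : Θ * T * q1 ^ 2 * R2 ^ 2 ≤ Θ * T * q1 ^ 2 * (4 * R) := by gcongr; linarith
    calc 4 * α * (q1 * R1 + q2 * R2) ^ 2 ≤ 4 * α * (4 * (Θ * T * q1 ^ 2 * (4 * R))) := by
          gcongr; linarith
      _ = _ := by ring
  have e2 : (κ * (-c + 2 * c ^ 3) + α * κ ^ 2 * c ^ 2) * X ≤ - (κ * T / 4) * (k ^ 2 * q1 ^ 2) := by
    have h1 : κ * (-c + 2 * c ^ 3) + α * κ ^ 2 * c ^ 2 ≤ - (κ * T / 4) := by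
      have a1 : 2 * c ^ 3 ≤ c / 2 := by
        have a0 : c ^ 2 ≤ 1 / 4 := by nlinarith
        calc 2 * c ^ 3 = 2 * c * c ^ 2 := by ring
          _ ≤ 2 * c * (1 / 4) := by gcongr
          _ = _ := by ring
      have a2 : α * κ * c ≤ 1 / 4 := by
        have : α * κ ≤ 1 * (1 / 2) := by gcongr
        nlinarith
      have a3 : α * κ ^ 2 * c ^ 2 ≤ κ * c * (1 / 4) := by
        have : α * κ ^ 2 * c ^ 2 = κ * c * (α * κ * c) := by ring
        rw [this]; gcongr
      have a4 : κ * (-c + 2 * c ^ 3) ≤ κ * (- c / 2) := by gcongr; linarith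
      have a5 : κ * T ≤ κ * c := by gcongr
      linarith
    have h2 : 0 ≤ κ * T / 4 := by positivity
    calc _ ≤ - (κ * T / 4) * X := by gcongr
      _ ≤ _ := by nlinarith
  have e3 : 64 * α * Θ * q1 ^ 2 * T ≤ κ * T / 8 * (k ^ 2 * q1 ^ 2) := by
    rw [le_div_iff₀ (by positivity)] at hαk
    have : 0 ≤ q1 ^ 2 * T := by positivity
    nlinarith
  have e4 : -8 * q1 * q2 * R1 * R2 / R ≤ 0 := by
    apply div_nonpos_of_nonpos_of_nonneg _ hRp.le
    have : 0 < q1 * q2 * R1 * R2 := by positivity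
    linarith
  have e5 : -8 * q1 * q2 * R1 * R2 / R + 4 * α * (q1 * R1 + q2 * R2) ^ 2 / R
      + (κ * (-c + 2 * c ^ 3) + α * κ ^ 2 * c ^ 2) * X ≤ - (κ * k ^ 2 / (8 * Θ)) * q2 ^ 2 := by
    have h1 : q2 ^ 2 / Θ ≤ T * q1 ^ 2 := by
      rw [div_le_iff₀ (by positivity)]; linarith
    have h2 : κ * k ^ 2 / (8 * Θ) * q2 ^ 2 = κ * k ^ 2 / 8 * (q2 ^ 2 / Θ) := by
      field_simp
    have h3 : κ * k ^ 2 / 8 * (q2 ^ 2 / Θ) ≤ κ * k ^ 2 / 8 * (T * q1 ^ 2) := by gcongr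
    nlinarith
  have e6 : exp (α * s2) / 2 ≤ R ^ (α / 2) := by
    have h1 : (R2 ^ 2 / 4) ^ (α / 2) ≤ R ^ (α / 2) := by gcongr
    have h2 : (R2 ^ 2 / 4) ^ (α / 2) = exp (α * s2) * (1/2) ^ α := by
      have : R2 ^ 2 / 4 = (R2 * (1/2)) ^ 2 := by ring
      rw [this, ← Real.rpow_natCast, ← Real.rpow_mul (by positivity),
        Real.mul_rpow (by positivity) (by norm_num)]
      have h3 : ((2:ℕ):ℝ) * (α / 2) = α := by push_cast; ring
      rw [h3, ← hR2, ← Real.exp_mul, mul_comm s2 α]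
    have h3 : (1/2 : ℝ) ≤ (1/2) ^ α := by
      calc (1/2 : ℝ) = (1/2) ^ (1:ℝ) := by simp
        _ ≤ _ := Real.rpow_le_rpow_of_exponent_ge (by norm_num) (by norm_num) hα1
    calc exp (α * s2) / 2 = exp (α * s2) * (1/2) := by ring
      _ ≤ exp (α * s2) * (1/2) ^ α := by gcongr
      _ = _ := h2.symm
      _ ≤ _ := h1
  have hpos : 0 ≤ κ * k ^ 2 / (8 * Θ) * q2 ^ 2 := by positivity
  calc _ ≤ R ^ (α / 2) * (- (κ * k ^ 2 / (8 * Θ)) * q2 ^ 2) := by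
        gcongr
    _ = - (R ^ (α / 2) * (κ * k ^ 2 / (8 * Θ) * q2 ^ 2)) := by ring
    _ ≤ - (exp (α * s2) / 2 * (κ * k ^ 2 / (8 * Θ) * q2 ^ 2)) := by
        gcongr
    _ = _ := by
        field_simp
        norm_num

set_option maxHeartbeats 4000000 in
theorem alg_middle (k α κ Q H s1 s2 q1 q2 R X c : ℝ) (hk : 0 < k) (hk1 : k ≤ 1)
    (hα : 0 < α) (hα1 : α ≤ 1) (hκ : 0 < κ) (hQ : 1 ≤ Q) (hH : 1 ≤ H)
    (hαk : α ≤ 1 / (8 * Q * H)) (hκ1 : κ ≤ 1 / (96 * Q * H)) (hq1 : 0 < q1) (hq2 : 0 < q2)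
    (hc0 : 0 < c) (hc1 : c ≤ 1)
    (hs : s1 ≤ s2) (hy : exp s2 ≤ H * exp s1) (hq : q1 ≤ Q * q2) (hq' : q2 ≤ Q * q1)
    (hR0 : 0 < R) (hR : R ≤ (exp s1 + exp s2) ^ 2)
    (hX0 : 0 ≤ X) (hX : X ≤ 4 * k ^ 2 * (q1 + q2) ^ 2) :
    R ^ (α / 2) * (-8 * q1 * q2 * exp s1 * exp s2 / R + 4 * α * (q1 * exp s1 + q2 * exp s2) ^ 2 / R
      + (κ * (-c + 2 * c ^ 3) + α * κ ^ 2 * c ^ 2) * X)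
      ≤ - (1 / (Q * H)) * q2 ^ 2 * exp (α * s2) := by
  have hR12 : exp s1 ≤ exp s2 := exp_le_exp.2 hs
  generalize hR1 : exp s1 = R1 at hy hR hR12 ⊢
  generalize hR2 : exp s2 = R2 at hy hR hR12 ⊢
  have hR1p : 0 < R1 := hR1 ▸ exp_pos _
  have hR2p : 0 < R2 := hR2 ▸ exp_pos _
  have hR4 : R ≤ 4 * R2 ^ 2 := by nlinarith
  have hP : 0 < q1 * q2 * (R1 * R2) := by positivity
  have hQH : 0 < Q * H := by positivity
  have e1 : 4 * α * (q1 * R1 + q2 * R2) ^ 2 / R ≤ 2 * (q1 * q2 * (R1 * R2)) / R := by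
    refine div_le_div_of_nonneg_right ?_ hR0.le
    have h1 : (q1 * R1 + q2 * R2) ^ 2 ≤ 2 * (q1 ^ 2 * R1 ^ 2 + q2 ^ 2 * R2 ^ 2) := by
      nlinarith [sq_nonneg (q1 * R1 - q2 * R2)]
    have h2 : q1 ^ 2 * R1 ^ 2 ≤ (q1 * (Q * q2)) * (R1 * R2) := by
      rw [sq, sq]; gcongr
    have h3 : q2 ^ 2 * R2 ^ 2 ≤ (Q * q1 * q2) * (H * R1 * R2) := by
      rw [sq, sq]; gcongr
    have h4 : (q1 * (Q * q2)) * (R1 * R2) ≤ (Q * q1 * q2) * (H * R1 * R2) := by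
      have : (q1 * (Q * q2)) * (R1 * R2) = (Q * q1 * q2) * (1 * R1 * R2) := by ring
      rw [this]; gcongr
    have h5 : (q1 * R1 + q2 * R2) ^ 2 ≤ 4 * (Q * H) * (q1 * q2 * (R1 * R2)) := by nlinarith
    rw [le_div_iff₀ (by positivity)] at hαk
    calc 4 * α * (q1 * R1 + q2 * R2) ^ 2 ≤ 4 * α * (4 * (Q * H) * (q1 * q2 * (R1 * R2))) := by gcongr
      _ = (α * (8 * Q * H)) * (2 * (q1 * q2 * (R1 * R2))) := by ring
      _ ≤ 1 * (2 * (q1 * q2 * (R1 * R2))) := by gcongr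
      _ = _ := by ring
  have e2 : (κ * (-c + 2 * c ^ 3) + α * κ ^ 2 * c ^ 2) * X ≤ 2 * (q1 * q2 * (R1 * R2)) / R := by
    have hκs : κ ≤ 1 := hκ1.trans (by rw [div_le_one (by positivity)]; nlinarith)
    have h1 : κ * (-c + 2 * c ^ 3) + α * κ ^ 2 * c ^ 2 ≤ 3 * κ := by
      have a1 : c ^ 3 ≤ 1 := pow_le_one₀ hc0.le hc1
      have a2 : c ^ 2 ≤ 1 := pow_le_one₀ hc0.le hc1
      have a3 : α * κ ^ 2 * c ^ 2 ≤ 1 * (κ * 1) * 1 := by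
        rw [sq κ]; gcongr
      nlinarith
    have h2 : X ≤ 16 * Q * (q1 * q2) := by
      have a1 : k ^ 2 ≤ 1 := pow_le_one₀ hk.le hk1
      have a2 : (q1 + q2) ^ 2 ≤ 2 * (q1 * q1 + q2 * q2) := by nlinarith [sq_nonneg (q1 - q2)]
      have a3 : q1 * q1 ≤ q1 * (Q * q2) := by gcongr
      have a4 : q2 * q2 ≤ Q * q1 * q2 := by gcongr
      have a5 : 4 * k ^ 2 * (q1 + q2) ^ 2 ≤ 4 * 1 * (q1 + q2) ^ 2 := by gcongr
      linarith
    have h3 : 48 * κ * Q * H ≤ 1 / 2 := by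
      rw [le_div_iff₀ (by positivity)] at hκ1
      linarith
    rw [le_div_iff₀ hR0]
    have h4 : R ≤ 4 * (R2 * (H * R1)) := by
      have : R2 * R2 ≤ R2 * (H * R1) := by gcongr
      nlinarith
    calc _ ≤ 3 * κ * X * R := by gcongr
      _ ≤ 3 * κ * (16 * Q * (q1 * q2)) * (4 * (R2 * (H * R1))) := by gcongr
      _ = (48 * κ * Q * H) * (4 * (q1 * q2 * (R1 * R2))) := by ring
      _ ≤ 1 / 2 * (4 * (q1 * q2 * (R1 * R2))) := by gcongr
      _ = _ := by ring
  have e3 : -8 * q1 * q2 * R1 * R2 / R + 4 * α * (q1 * R1 + q2 * R2) ^ 2 / R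
      + (κ * (-c + 2 * c ^ 3) + α * κ ^ 2 * c ^ 2) * X ≤ -4 * (q1 * q2 * (R1 * R2)) / R := by
    have : -8 * q1 * q2 * R1 * R2 / R + 2 * (q1 * q2 * (R1 * R2)) / R
      + 2 * (q1 * q2 * (R1 * R2)) / R = -4 * (q1 * q2 * (R1 * R2)) / R := by ring
    linarith
  have e4 : exp (α * s2) / (4 * R2 ^ 2) ≤ R ^ (α / 2) / R := by
    have h1 : (4 * R2 ^ 2) ^ (α / 2 - 1) ≤ R ^ (α / 2 - 1) :=
      Real.rpow_le_rpow_of_nonpos hR0 hR4 (by linarith)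
    rw [Real.rpow_sub_one hR0.ne', Real.rpow_sub_one (by positivity)] at h1
    refine le_trans ?_ h1
    gcongr
    have h2 : (R2 ^ 2) ^ (α / 2) = exp (α * s2) := by
      rw [← Real.rpow_natCast, ← Real.rpow_mul (by positivity)]
      have h3 : ((2:ℕ):ℝ) * (α / 2) = α := by push_cast; ring
      rw [h3, ← hR2, ← Real.exp_mul, mul_comm s2 α]
    rw [← h2]
    gcongr
    nlinarith
  have hpw : 0 ≤ R ^ (α / 2) := by positivity
  calc _ ≤ R ^ (α / 2) * (-4 * (q1 * q2 * (R1 * R2)) / R) := by gcongr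
    _ = - (R ^ (α / 2) / R * (4 * (q1 * q2 * (R1 * R2)))) := by ring
    _ ≤ - (exp (α * s2) / (4 * R2 ^ 2) * (4 * (q1 * q2 * (R1 * R2)))) := by gcongr
    _ ≤ _ := by
      have h1 : 1 / (Q * H) * q2 ^ 2 * exp (α * s2) = exp (α * s2) / (4 * R2 ^ 2) * (4 * (1 / (Q * H) * q2 ^ 2 * R2 ^ 2)) := by
        field_simp
      have h2 : 1 / (Q * H) * q2 ^ 2 * R2 ^ 2 ≤ q1 * q2 * (R1 * R2) := by
        have : q2 ^ 2 * R2 ^ 2 ≤ (Q * q1 * q2) * (H * R1 * R2) := by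
          rw [sq, sq]; gcongr
        have h3 : 1 / (Q * H) * q2 ^ 2 * R2 ^ 2 = (q2 ^ 2 * R2 ^ 2) / (Q * H) := by ring
        rw [h3, div_le_iff₀ hQH]
        linarith
      have : exp (α * s2) / (4 * R2 ^ 2) * (4 * (1 / (Q * H) * q2 ^ 2 * R2 ^ 2)) ≤ exp (α * s2) / (4 * R2 ^ 2) * (4 * (q1 * q2 * (R1 * R2))) := by gcongr
      linarith

set_option maxHeartbeats 4000000 in
theorem key_alg (b Θ : ℝ) (hb : 0 < b) (hΘ : 1 ≤ Θ) :
    ∃ k α κ c1 : ℝ, 0 < k ∧ 0 < α ∧ α ≤ 1 ∧ α ≤ 2 * b ∧ 0 < κ ∧ κ ≤ 1 ∧ 0 < c1 ∧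
    ∀ s1 s2 q1 q2 R X : ℝ, s1 ≤ s2 → 0 < q1 → 0 < q2 →
      q2 ^ 2 ≤ Θ * exp (-(2 * b * (s2 - s1))) * q1 ^ 2 →
      q1 ^ 2 ≤ Θ * exp (2 * b * (s2 - s1)) * q2 ^ 2 →
      0 < R → (exp s2 - exp s1) ^ 2 ≤ R → R ≤ (exp s1 + exp s2) ^ 2 →
      4 * k ^ 2 * (q1 - q2) ^ 2 ≤ X → X ≤ 4 * k ^ 2 * (q1 + q2) ^ 2 →
      ∀ c : ℝ, c = 1 / cosh (2 * k * (s1 - s2)) →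
      R ^ (α / 2) * (-8 * q1 * q2 * exp s1 * exp s2 / R
        + 4 * α * (q1 * exp s1 + q2 * exp s2) ^ 2 / R
        + (κ * (-c + 2 * c ^ 3) + α * κ ^ 2 * c ^ 2) * X)
      ≤ - c1 * q2 ^ 2 * exp (α * s2) := by
  set k := min 1 b with hk
  have hkp : 0 < k := lt_min one_pos hb
  have hk1 : k ≤ 1 := min_le_left _ _
  have hkb : k ≤ b := min_le_right _ _
  set H := (4 * Θ) ^ (1 / (2 * k)) with hH
  have hH1 : 1 ≤ H := Real.one_le_rpow (by linarith) (by positivity)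
  set Q := Θ * H ^ b with hQ
  have hHb : 1 ≤ H ^ b := Real.one_le_rpow hH1 hb.le
  have hQ1 : 1 ≤ Q := by nlinarith
  have hQΘ : Θ ≤ Q := by nlinarith
  have hQH : 1 ≤ Q * H := by nlinarith
  set κ := 1 / (96 * Q * H) with hκ
  have hκp : 0 < κ := by positivity
  have hκ2 : κ ≤ 1 / 2 := by
    rw [hκ]; apply one_div_le_one_div_of_le (by norm_num); nlinarith
  set α := min (min 1 (2 * b)) (min (1 / (8 * Q * H)) (κ * k ^ 2 / (512 * Θ))) with hα
  have hαp : 0 < α := by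
    refine lt_min (lt_min one_pos (by positivity)) (lt_min (by positivity) (by positivity))
  have hα1 : α ≤ 1 := (min_le_left _ _).trans (min_le_left _ _)
  have hα2 : α ≤ 2 * b := (min_le_left _ _).trans (min_le_right _ _)
  have hα3 : α ≤ 1 / (8 * Q * H) := (min_le_right _ _).trans (min_le_left _ _)
  have hα4 : α ≤ κ * k ^ 2 / (512 * Θ) := (min_le_right _ _).trans (min_le_right _ _)
  set c1 := min (κ * k ^ 2 / (16 * Θ)) (1 / (Q * H)) with hc1
  refine ⟨k, α, κ, c1, hkp, hαp, hα1, hα2, hκp, by linarith, lt_min (by positivity) (by positivity), ?_⟩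
  intro s1 s2 q1 q2 R X hs hq1 hq2 hqa hqb hR0 hRl hRu hXl hXu c hc
  set x := 2 * k * (s2 - s1) with hx
  have hx0 : 0 ≤ x := by have : 0 ≤ s2 - s1 := by linarith
                         positivity
  have hcx : c = 1 / cosh x := by
    rw [hc, ← Real.cosh_neg]; congr 2; rw [hx]; ring
  have hcoshl : exp x / 2 ≤ cosh x := by
    rw [Real.cosh_eq]; have := exp_pos (-x); linarith
  have hcoshu : cosh x ≤ exp x := by
    rw [Real.cosh_eq]; have : exp (-x) ≤ exp x := exp_le_exp.2 (by linarith)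
    linarith
  have hcp : 0 < c := by rw [hcx]; exact one_div_pos.2 (Real.cosh_pos _)
  have hcle1 : c ≤ 1 := by rw [hcx, div_le_one (Real.cosh_pos _)]; exact Real.one_le_cosh _
  have hTc : exp (-x) ≤ c := by
    rw [hcx, Real.exp_neg, ← one_div]; exact one_div_le_one_div_of_le (Real.cosh_pos _) hcoshu
  have hcT : c ≤ 2 * exp (-x) := by
    rw [hcx, Real.exp_neg, div_le_iff₀ (Real.cosh_pos _)]
    calc (1:ℝ) = 2 * (exp x)⁻¹ * (exp x / 2) := by field_simp
      _ ≤ _ := by gcongr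
  have hfin : ∀ c' : ℝ, c1 ≤ c' → -c' * q2 ^ 2 * exp (α * s2) ≤ - c1 * q2 ^ 2 * exp (α * s2) := by
    intro c' h
    have := exp_pos (α * s2)
    gcongr
  have hD : 0 ≤ s2 - s1 := by linarith
  rcases le_or_gt (exp (-x)) (1 / (4 * Θ)) with hcase | hcase
  · refine (alg_extreme k Θ α κ s1 s2 q1 q2 R X (exp (-x)) c hkp hΘ hαp hα1 hκp hκ2 hα4 hq1 hq2
      (exp_pos _) hcase hTc hcT ?_ ?_ hRl hXl).trans (hfin _ (min_le_left _ _))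
    · rw [← Real.exp_nat_mul, ← Real.exp_nat_mul, ← Real.exp_add]
      apply exp_le_exp.2
      push_cast
      nlinarith
    · refine hqa.trans ?_
      have : exp (-(2 * b * (s2 - s1))) ≤ exp (-x) := by
        apply exp_le_exp.2
        rw [hx]
        nlinarith
      gcongr
  · have hexp : exp (s2 - s1) ≤ H := by
      have h1 : exp x ≤ 4 * Θ := by
        rw [Real.exp_neg, one_div] at hcase
        exact ((inv_lt_inv₀ (by positivity) (exp_pos _)).1 hcase).le
      calc exp (s2 - s1) = (exp x) ^ (1 / (2 * k)) := by
            rw [← Real.exp_mul, hx]; congr 1; field_simp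
        _ ≤ _ := by rw [hH]; gcongr
    have hexpb : exp (b * (s2 - s1)) ≤ H ^ b := by
      calc exp (b * (s2 - s1)) = (exp (s2 - s1)) ^ b := by rw [← Real.exp_mul, mul_comm]
        _ ≤ _ := by gcongr
    have hXnn : 0 ≤ X := le_trans (by positivity) hXl
    refine (alg_middle k α κ Q H s1 s2 q1 q2 R X c hkp hk1 hαp hα1 hκp hQ1 hH1 hα3 le_rfl hq1 hq2
      hcp hcle1 hs ?_ ?_ ?_ hR0 hRu hXnn hXu).trans (hfin _ (min_le_right _ _))
    · calc exp s2 = exp (s2 - s1) * exp s1 := by rw [← Real.exp_add]; congr 1; ring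
        _ ≤ _ := by gcongr
    · apply le_of_sq_le_sq _ (by positivity)
      refine hqb.trans ?_
      have h2 : exp (2 * b * (s2 - s1)) = exp (b * (s2 - s1)) ^ 2 := by
        rw [← Real.exp_nat_mul]; congr 1; push_cast; ring
      rw [h2, mul_pow, hQ, mul_pow]
      have : Θ ≤ Θ ^ 2 := by nlinarith
      gcongr
    · apply le_of_sq_le_sq _ (by positivity)
      refine hqa.trans ?_
      have h2 : exp (-(2 * b * (s2 - s1))) ≤ 1 := by
        apply Real.exp_le_one_iff.2
        have : 0 ≤ 2 * b * (s2 - s1) := by positivity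
        linarith
      rw [mul_pow]
      have : Θ ≤ Q ^ 2 := by nlinarith
      calc Θ * exp (-(2 * b * (s2 - s1))) * q1 ^ 2 ≤ Θ * 1 * q1 ^ 2 := by gcongr
        _ ≤ _ := by rw [mul_one]; gcongr

/-- squared distance of the two points `exp (s₁ + i θ₁)`, `exp (s₂ + i θ₂)`. -/
noncomputable def Rf (s1 θ1 s2 θ2 : ℝ) : ℝ :=
  (exp s1 * cos θ1 - exp s2 * cos θ2) ^ 2 + (exp s1 * sin θ1 - exp s2 * sin θ2) ^ 2

/-- the comparison function of the doubling argument -/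
noncomputable def Phi (k α κ s1 θ1 s2 θ2 : ℝ) : ℝ :=
  (Rf s1 θ1 s2 θ2) ^ (α / 2) * exp (-(α * κ / 2) / cosh (2 * k * (s1 - s2)))

theorem Rf_nonneg (s1 θ1 s2 θ2 : ℝ) : 0 ≤ Rf s1 θ1 s2 θ2 := by
  unfold Rf; positivity

theorem Rf_symm (s1 θ1 s2 θ2 : ℝ) : Rf s1 θ1 s2 θ2 = Rf s2 θ2 s1 θ1 := by
  unfold Rf; ring

theorem Rf_eq (s1 θ1 s2 θ2 : ℝ) :
    Rf s1 θ1 s2 θ2 = (exp s1 - exp s2) ^ 2 + 2 * exp s1 * exp s2 * (1 - cos (θ1 - θ2)) := by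
  unfold Rf
  rw [cos_sub]
  have h1 := sin_sq_add_cos_sq θ1
  have h2 := sin_sq_add_cos_sq θ2
  linear_combination (exp s1) ^ 2 * h1 + (exp s2) ^ 2 * h2

theorem Phi_symm (k α κ s1 θ1 s2 θ2 : ℝ) :
    Phi k α κ s1 θ1 s2 θ2 = Phi k α κ s2 θ2 s1 θ1 := by
  unfold Phi
  rw [Rf_symm, ← cosh_neg]
  congr 4
  ring

theorem D2.cos {g : ℝ → ℝ} {a b : ℝ} (hg : D2 g a b) :
    D2 (fun x => Real.cos (g x)) (-Real.sin (g 0) * a)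
      (-Real.cos (g 0) * a ^ 2 + -Real.sin (g 0) * b) :=
  hg.comp rfl (F := Real.cos) (F' := fun x => -Real.sin x)
    (Filter.Eventually.of_forall fun x => Real.hasDerivAt_cos x) (Real.hasDerivAt_sin _).neg

theorem D2.sin {g : ℝ → ℝ} {a b : ℝ} (hg : D2 g a b) :
    D2 (fun x => Real.sin (g x)) (Real.cos (g 0) * a)
      (-Real.sin (g 0) * a ^ 2 + Real.cos (g 0) * b) :=
  hg.comp rfl (F := Real.sin) (F' := fun x => Real.cos x)
    (Filter.Eventually.of_forall fun x => Real.hasDerivAt_sin x) (Real.hasDerivAt_cos _)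

theorem D2.of_eq {g : ℝ → ℝ} {a b a' b' : ℝ} (hg : D2 g a b) (h1 : a = a') (h2 : b = b') :
    D2 g a' b' := by subst h1; subst h2; exact hg

theorem D2.sech {g : ℝ → ℝ} {a : ℝ} (hg : D2 g a 0) (c sh : ℝ) (hc : c = 1 / cosh (g 0))
    (hsh : sh = sinh (g 0)) :
    D2 (fun x => -(1 / cosh (g x))) (sh * c ^ 2 * a) ((-c + 2 * c ^ 3) * a ^ 2) := by
  have h1 : ∀ x, HasDerivAt (fun x => -(1 / cosh x)) (sinh x / cosh x ^ 2) x := by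
    intro x
    have h := ((Real.hasDerivAt_cosh x).inv (Real.cosh_pos x).ne').neg
    have h2 : (fun x => -(1 / cosh x)) = -Real.cosh⁻¹ := by
      ext y; simp [one_div]
    rw [h2]
    refine h.congr_deriv ?_
    ring
  have h2 : HasDerivAt (fun x => sinh x / cosh x ^ 2) (-c + 2 * c ^ 3) (g 0) := by
    have h := (Real.hasDerivAt_sinh (g 0)).div ((Real.hasDerivAt_cosh (g 0)).pow 2)
      (pow_ne_zero 2 (Real.cosh_pos _).ne')
    refine h.congr_deriv ?_
    rw [hc]
    have hp := (Real.cosh_pos (g 0)).ne'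
    have := Real.cosh_sq (g 0)
    have h3 : sinh (g 0) ^ 2 = cosh (g 0) ^ 2 - 1 := by linarith
    simp only [Nat.cast_ofNat]
    norm_num
    field_simp
    ring_nf
    rw [h3]
    ring
  refine (hg.comp rfl (Filter.Eventually.of_forall h1) h2).of_eq ?_ ?_
  · rw [hc, hsh]; ring
  · ring

theorem Phi_dir (k α κ s1 θ1 s2 θ2 p1 n1 p2 n2 x1 y1 x2 y2 R R' R'' c sh : ℝ)
    (hx1 : x1 = exp s1 * cos θ1) (hy1 : y1 = exp s1 * sin θ1)
    (hx2 : x2 = exp s2 * cos θ2) (hy2 : y2 = exp s2 * sin θ2)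
    (hR : R = Rf s1 θ1 s2 θ2) (hR0 : 0 < R)
    (hR' : R' = 2 * ((x1 - x2) * (p1 * x1 - n1 * y1 - (p2 * x2 - n2 * y2))
      + (y1 - y2) * (p1 * y1 + n1 * x1 - (p2 * y2 + n2 * x2))))
    (hR'' : R'' = 2 * ((p1 * x1 - n1 * y1 - (p2 * x2 - n2 * y2)) ^ 2
      + (p1 * y1 + n1 * x1 - (p2 * y2 + n2 * x2)) ^ 2
      + (x1 - x2) * (((p1 ^ 2 - n1 ^ 2) * x1 - 2 * p1 * n1 * y1) -
        ((p2 ^ 2 - n2 ^ 2) * x2 - 2 * p2 * n2 * y2))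
      + (y1 - y2) * (((p1 ^ 2 - n1 ^ 2) * y1 + 2 * p1 * n1 * x1) -
        ((p2 ^ 2 - n2 ^ 2) * y2 + 2 * p2 * n2 * x2))))
    (hc : c = 1 / cosh (2 * k * (s1 - s2))) (hsh : sh = sinh (2 * k * (s1 - s2))) :
    ∃ a, D2 (fun τ => Phi k α κ (s1 + τ * p1) (θ1 + τ * n1) (s2 + τ * p2) (θ2 + τ * n2)) a
      (Phi k α κ s1 θ1 s2 θ2 * (α / 2) *
        ((R'' / R - (R' / R) ^ 2 + κ * ((-c + 2 * c ^ 3) * (2 * k * (p1 - p2)) ^ 2))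
        + (α / 2) * (R' / R + κ * (sh * c ^ 2 * (2 * k * (p1 - p2)))) ^ 2)) := by
  have X : ∀ s θ p n : ℝ, D2 (fun τ => exp (s + τ * p) * cos (θ + τ * n))
      (p * (exp s * cos θ) - n * (exp s * sin θ))
      ((p ^ 2 - n ^ 2) * (exp s * cos θ) - 2 * p * n * (exp s * sin θ)) := by
    intro s θ p n
    refine ((D2.affine s p).exp.mul (D2.affine θ n).cos).of_eq ?_ ?_
    · simp only [zero_mul, add_zero]; ring
    · simp only [zero_mul, add_zero]; ring
  have Y : ∀ s θ p n : ℝ, D2 (fun τ => exp (s + τ * p) * sin (θ + τ * n))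
      (p * (exp s * sin θ) + n * (exp s * cos θ))
      ((p ^ 2 - n ^ 2) * (exp s * sin θ) + 2 * p * n * (exp s * cos θ)) := by
    intro s θ p n
    refine ((D2.affine s p).exp.mul (D2.affine θ n).sin).of_eq ?_ ?_
    · simp only [zero_mul, add_zero]; ring
    · simp only [zero_mul, add_zero]; ring
  have DX := (X s1 θ1 p1 n1).sub (X s2 θ2 p2 n2)
  have DY := (Y s1 θ1 p1 n1).sub (Y s2 θ2 p2 n2)
  rw [← hx1, ← hy1, ← hx2, ← hy2] at DX DY
  have DR : D2 (fun τ => Rf (s1 + τ * p1) (θ1 + τ * n1) (s2 + τ * p2) (θ2 + τ * n2)) R' R'' := by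
    have := (DX.mul DX).add (DY.mul DY)
    have e : (fun τ => Rf (s1 + τ * p1) (θ1 + τ * n1) (s2 + τ * p2) (θ2 + τ * n2)) =
      fun x => (rexp (s1 + x * p1) * Real.cos (θ1 + x * n1) - rexp (s2 + x * p2) * Real.cos (θ2 + x * n2)) *
            (rexp (s1 + x * p1) * Real.cos (θ1 + x * n1) - rexp (s2 + x * p2) * Real.cos (θ2 + x * n2)) +
          (rexp (s1 + x * p1) * Real.sin (θ1 + x * n1) - rexp (s2 + x * p2) * Real.sin (θ2 + x * n2)) *
            (rexp (s1 + x * p1) * Real.sin (θ1 + x * n1) - rexp (s2 + x * p2) * Real.sin (θ2 + x * n2)) := by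
      ext τ; unfold Rf; ring
    rw [e]
    refine this.of_eq ?_ ?_
    · simp only [zero_mul, add_zero]; rw [← hx1, ← hy1, ← hx2, ← hy2, hR']; ring
    · simp only [zero_mul, add_zero]; rw [← hx1, ← hy1, ← hx2, ← hy2, hR'']; ring
  have hR00 : Rf (s1 + 0 * p1) (θ1 + 0 * n1) (s2 + 0 * p2) (θ2 + 0 * n2) = R := by
    simp only [zero_mul, add_zero]; exact hR.symm
  have DL := DR.log (by rw [hR00]; exact hR0)
  rw [hR00] at DL
  have Dξ : D2 (fun τ => 2 * k * ((s1 + τ * p1) - (s2 + τ * p2))) (2 * k * (p1 - p2)) 0 :=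
    (((D2.affine s1 p1).sub (D2.affine s2 p2)).const_mul (2 * k)).of_eq rfl (by ring)
  have Dg := Dξ.sech c sh (by simp only [zero_mul, add_zero]; exact hc)
    (by simp only [zero_mul, add_zero]; exact hsh)
  have Dℓ := ((DL.add (Dg.const_mul κ)).const_mul (α / 2)).exp
  have hcongr : (fun τ => Phi k α κ (s1 + τ * p1) (θ1 + τ * n1) (s2 + τ * p2) (θ2 + τ * n2))
      =ᶠ[nhds 0] fun x => Real.exp (α / 2 * (Real.log (Rf (s1 + x * p1) (θ1 + x * n1) (s2 + x * p2) (θ2 + x * n2)) +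
        κ * -(1 / cosh (2 * k * (s1 + x * p1 - (s2 + x * p2)))))) := by
    obtain ⟨g', k1, -, -⟩ := DR
    have hcont := k1.self_of_nhds.continuousAt
    have hpos : ∀ᶠ x in nhds (0:ℝ), 0 < Rf (s1 + x * p1) (θ1 + x * n1) (s2 + x * p2) (θ2 + x * n2) := by
      apply hcont.eventually
      beta_reduce
      rw [hR00]
      exact eventually_gt_nhds hR0
    filter_upwards [hpos] with x hx
    unfold Phi
    rw [Real.rpow_def_of_pos hx, ← Real.exp_add]
    congr 1
    ring
  refine ⟨_, (Dℓ.congr hcongr).of_eq rfl ?_⟩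
  have h0 := hcongr.self_of_nhds
  simp only [zero_mul, add_zero] at h0 ⊢
  rw [← h0]
  ring

set_option maxHeartbeats 2000000 in
theorem dir_alg (k α κ p1 n1 p2 n2 x1 y1 x2 y2 q1 q2 R1 R2 R r cw sw c sh
    R'a R''a R'b R''b : ℝ) (hα : 0 < α)
    (hr0 : 0 < r) (hr : r ^ 2 = R) (hcs : cw ^ 2 + sw ^ 2 = 1)
    (hDx : x1 - x2 = r * cw) (hDy : y1 - y2 = r * sw)
    (hR1 : 0 < R1) (hR2 : 0 < R2) (h1 : x1 ^ 2 + y1 ^ 2 = R1 ^ 2) (h2 : x2 ^ 2 + y2 ^ 2 = R2 ^ 2)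
    (hc : 0 < c) (hsh : sh ^ 2 * c ^ 2 ≤ 1)
    (hp1 : p1 = q1 * (cw * x1 + sw * y1) / R1) (hn1 : n1 = q1 * (sw * x1 - cw * y1) / R1)
    (hp2 : p2 = -q2 * (cw * x2 + sw * y2) / R2) (hn2 : n2 = -q2 * (sw * x2 - cw * y2) / R2)
    (hR'a : R'a = 2 * ((x1 - x2) * (p1 * x1 - n1 * y1 - (p2 * x2 - n2 * y2))
      + (y1 - y2) * (p1 * y1 + n1 * x1 - (p2 * y2 + n2 * x2))))
    (hR''a : R''a = 2 * ((p1 * x1 - n1 * y1 - (p2 * x2 - n2 * y2)) ^ 2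
      + (p1 * y1 + n1 * x1 - (p2 * y2 + n2 * x2)) ^ 2
      + (x1 - x2) * (((p1 ^ 2 - n1 ^ 2) * x1 - 2 * p1 * n1 * y1) -
        ((p2 ^ 2 - n2 ^ 2) * x2 - 2 * p2 * n2 * y2))
      + (y1 - y2) * (((p1 ^ 2 - n1 ^ 2) * y1 + 2 * p1 * n1 * x1) -
        ((p2 ^ 2 - n2 ^ 2) * y2 + 2 * p2 * n2 * x2))))
    (hR'b : R'b = 2 * ((x1 - x2) * (-n1 * x1 - p1 * y1 - (n2 * x2 - -p2 * y2))
      + (y1 - y2) * (-n1 * y1 + p1 * x1 - (n2 * y2 + -p2 * x2))))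
    (hR''b : R''b = 2 * ((-n1 * x1 - p1 * y1 - (n2 * x2 - -p2 * y2)) ^ 2
      + (-n1 * y1 + p1 * x1 - (n2 * y2 + -p2 * x2)) ^ 2
      + (x1 - x2) * ((((-n1) ^ 2 - p1 ^ 2) * x1 - 2 * -n1 * p1 * y1) -
        ((n2 ^ 2 - (-p2) ^ 2) * x2 - 2 * n2 * -p2 * y2))
      + (y1 - y2) * ((((-n1) ^ 2 - p1 ^ 2) * y1 + 2 * -n1 * p1 * x1) -
        ((n2 ^ 2 - (-p2) ^ 2) * y2 + 2 * n2 * -p2 * x2)))) :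
    p1 ^ 2 + n1 ^ 2 = q1 ^ 2 ∧ p2 ^ 2 + n2 ^ 2 = q2 ^ 2 ∧
    ((R''a / R - (R'a / R) ^ 2 + κ * ((-c + 2 * c ^ 3) * (2 * k * (p1 - p2)) ^ 2))
        + (α / 2) * (R'a / R + κ * (sh * c ^ 2 * (2 * k * (p1 - p2)))) ^ 2)
    + ((R''b / R - (R'b / R) ^ 2 + κ * ((-c + 2 * c ^ 3) * (2 * k * (-n1 - n2)) ^ 2))
        + (α / 2) * (R'b / R + κ * (sh * c ^ 2 * (2 * k * (-n1 - n2)))) ^ 2)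
    ≤ -8 * q1 * q2 * R1 * R2 / R
        + 4 * α * (q1 * R1 + q2 * R2) ^ 2 / R
        + (κ * (-c + 2 * c ^ 3) + α * κ ^ 2 * c ^ 2) * (4 * k ^ 2 * ((p1 - p2) ^ 2 + (n1 + n2) ^ 2)) := by
  have hR : 0 < R := hr ▸ by positivity
  have ha : p1 * x1 - n1 * y1 = q1 * R1 * cw := by
    rw [hp1, hn1]; field_simp; linear_combination q1 * cw * h1
  have hb : p1 * y1 + n1 * x1 = q1 * R1 * sw := by
    rw [hp1, hn1]; field_simp; linear_combination q1 * sw * h1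
  have hc2 : p2 * x2 - n2 * y2 = - q2 * R2 * cw := by
    rw [hp2, hn2]; field_simp; linear_combination (-q2 * cw) * h2
  have hd : p2 * y2 + n2 * x2 = - q2 * R2 * sw := by
    rw [hp2, hn2]; field_simp; linear_combination (-q2 * sw) * h2
  have hq1 : p1 ^ 2 + n1 ^ 2 = q1 ^ 2 := by
    rw [hp1, hn1]; field_simp
    linear_combination (q1 ^ 2 * (cw ^ 2 + sw ^ 2)) * h1 + q1 ^ 2 * R1 ^ 2 * hcs
  have hq2 : p2 ^ 2 + n2 ^ 2 = q2 ^ 2 := by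
    rw [hp2, hn2]; field_simp
    linear_combination (q2 ^ 2 * (cw ^ 2 + sw ^ 2)) * h2 + q2 ^ 2 * R2 ^ 2 * hcs
  refine ⟨hq1, hq2, ?_⟩
  have eRa : R'a = 2 * r * (q1 * R1 + q2 * R2) := by
    rw [hR'a, ha, hb, hc2, hd, hDx, hDy]
    linear_combination 2 * r * (q1 * R1 + q2 * R2) * hcs
  have ha' : -n1 * x1 - p1 * y1 = - (q1 * R1 * sw) := by linarith
  have hb' : -n1 * y1 + p1 * x1 = q1 * R1 * cw := by linarith
  have hc' : n2 * x2 - -p2 * y2 = - q2 * R2 * sw := by linarith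
  have hd' : n2 * y2 + -p2 * x2 = q2 * R2 * cw := by linarith
  have eRb : R'b = 0 := by
    rw [hR'b, ha', hb', hc', hd', hDx, hDy]; ring
  have eRR : R''a + R''b = 4 * q1 ^ 2 * R1 ^ 2 + 4 * q2 ^ 2 * R2 ^ 2 := by
    rw [hR''a, hR''b, ha, hb, hc2, hd, ha', hb', hc', hd']
    linear_combination (4 * q1 ^ 2 * R1 ^ 2 + 4 * q2 ^ 2 * R2 ^ 2) * hcs
  set X := 4 * k ^ 2 * ((p1 - p2) ^ 2 + (n1 + n2) ^ 2) with hX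
  have hX0 : 0 ≤ X := by positivity
  have s1 : (R'a / R) ^ 2 = 4 * (q1 * R1 + q2 * R2) ^ 2 / R := by
    rw [eRa, ← hr]; field_simp; ring
  have s2 : R''a / R + R''b / R = 4 * (q1 * R1 + q2 * R2) ^ 2 / R - 8 * q1 * q2 * R1 * R2 / R := by
    rw [← add_div, eRR, ← sub_div]; congr 1; ring
  rw [eRb, zero_div]
  have s3 : (R'a / R + κ * (sh * c ^ 2 * (2 * k * (p1 - p2)))) ^ 2 ≤
      2 * (R'a / R) ^ 2 + 2 * κ ^ 2 * c ^ 2 * (2 * k * (p1 - p2)) ^ 2 := by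
    have h3 : (κ * (sh * c ^ 2 * (2 * k * (p1 - p2)))) ^ 2 ≤ κ ^ 2 * c ^ 2 * (2 * k * (p1 - p2)) ^ 2 := by
      have : (κ * (sh * c ^ 2 * (2 * k * (p1 - p2)))) ^ 2 = sh ^ 2 * c ^ 2 * (κ ^ 2 * c ^ 2 * (2 * k * (p1 - p2)) ^ 2) := by ring
      rw [this]
      exact mul_le_of_le_one_left (by positivity) hsh
    refine (add_sq_le).trans ?_
    linarith
  have s4 : (0 + κ * (sh * c ^ 2 * (2 * k * (-n1 - n2)))) ^ 2 ≤
      2 * κ ^ 2 * c ^ 2 * (2 * k * (-n1 - n2)) ^ 2 := by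
    have : (0 + κ * (sh * c ^ 2 * (2 * k * (-n1 - n2)))) ^ 2 = sh ^ 2 * c ^ 2 * (κ ^ 2 * c ^ 2 * (2 * k * (-n1 - n2)) ^ 2) := by ring
    rw [this]
    refine (mul_le_of_le_one_left (by positivity) hsh).trans ?_
    have : 0 ≤ κ ^ 2 * c ^ 2 * (2 * k * (-n1 - n2)) ^ 2 := by positivity
    linarith
  have s5 : (2 * k * (p1 - p2)) ^ 2 + (2 * k * (-n1 - n2)) ^ 2 = X := by rw [hX]; ring
  rw [s1] at s3 ⊢
  have s3' := mul_le_mul_of_nonneg_left s3 (by positivity : 0 ≤ α / 2)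
  have s4' := mul_le_mul_of_nonneg_left s4 (by positivity : 0 ≤ α / 2)
  have t1 : -8 * q1 * q2 * R1 * R2 / R = -(8 * q1 * q2 * R1 * R2 / R) := by ring
  rw [t1, ← s5]
  have t2 : 4 * α * (q1 * R1 + q2 * R2) ^ 2 / R = α * (4 * (q1 * R1 + q2 * R2) ^ 2 / R) := by ring
  rw [t2]
  generalize 4 * (q1 * R1 + q2 * R2) ^ 2 / R = Z at *
  linarith [s3', s4', s2]

set_option maxHeartbeats 2000000 in
theorem Phi_key_aux (b C : ℝ) (hb : 0 < b) (hC : 0 ≤ C) :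
    ∃ k α κ c0 : ℝ, 0 < k ∧ 0 < α ∧ α ≤ 1 ∧ 0 < κ ∧ κ ≤ 1 ∧ 0 < c0 ∧
    ∀ s1 θ1 s2 θ2 u1 u2 : ℝ, s1 ≤ s2 → s2 ≤ 0 → |u1| ≤ C → |u2| ≤ C → 0 < Rf s1 θ1 s2 θ2 →
    ∃ p1 n1 p2 n2 a A a' A' : ℝ,
      p1 ^ 2 + n1 ^ 2 = (exp (-u1 - b * s1) / b) ^ 2 ∧
      p2 ^ 2 + n2 ^ 2 = (exp (-u2 - b * s2) / b) ^ 2 ∧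
      D2 (fun τ => Phi k α κ (s1 + τ * p1) (θ1 + τ * n1) (s2 + τ * p2) (θ2 + τ * n2)) a A ∧
      D2 (fun τ => Phi k α κ (s1 + τ * (-n1)) (θ1 + τ * p1) (s2 + τ * n2) (θ2 + τ * (-p2))) a' A' ∧
      A + A' ≤ -c0 := by
  obtain ⟨k, α, κ, c1, hk, hα, hα1, hα2, hκ, hκ1, hc1, H⟩ := key_alg b (exp (4 * C)) hb
    (Real.one_le_exp (by positivity))
  refine ⟨k, α, κ, α / 2 * exp (-1) * c1 * (exp (-(2 * C)) / b ^ 2), hk, hα, hα1, hκ, hκ1,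
    by positivity, ?_⟩
  intro s1 θ1 s2 θ2 u1 u2 hs hs2 hu1 hu2 hR0
  rw [abs_le] at hu1 hu2
  set q1 := exp (-u1 - b * s1) / b with hq1
  set q2 := exp (-u2 - b * s2) / b with hq2
  have hq1p : 0 < q1 := by positivity
  have hq2p : 0 < q2 := by positivity
  have sq1 : q1 ^ 2 = exp (-2 * u1 - 2 * b * s1) / b ^ 2 := by
    rw [hq1, div_pow, ← Real.exp_nat_mul]; congr 2; push_cast; ring
  have sq2 : q2 ^ 2 = exp (-2 * u2 - 2 * b * s2) / b ^ 2 := by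
    rw [hq2, div_pow, ← Real.exp_nat_mul]; congr 2; push_cast; ring
  set R := Rf s1 θ1 s2 θ2 with hR
  set r := √R with hr
  have hr0 : 0 < r := Real.sqrt_pos.2 hR0
  have hr2 : r ^ 2 = R := Real.sq_sqrt hR0.le
  set x1 := exp s1 * cos θ1 with hx1
  set y1 := exp s1 * sin θ1 with hy1
  set x2 := exp s2 * cos θ2 with hx2
  set y2 := exp s2 * sin θ2 with hy2
  have hRxy : R = (x1 - x2) ^ 2 + (y1 - y2) ^ 2 := rfl
  set cw := (x1 - x2) / r with hcw
  set sw := (y1 - y2) / r with hsw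
  set c := 1 / cosh (2 * k * (s1 - s2)) with hc
  set sh := sinh (2 * k * (s1 - s2)) with hsh
  set p1 := q1 * (cw * x1 + sw * y1) / exp s1 with hp1
  set n1 := q1 * (sw * x1 - cw * y1) / exp s1 with hn1
  set p2 := -q2 * (cw * x2 + sw * y2) / exp s2 with hp2
  set n2 := -q2 * (sw * x2 - cw * y2) / exp s2 with hn2
  obtain ⟨a, hA⟩ := Phi_dir k α κ s1 θ1 s2 θ2 p1 n1 p2 n2 x1 y1 x2 y2 R _ _ c sh hx1 hy1 hx2 hy2 hR
    hR0 rfl rfl hc hsh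
  obtain ⟨a', hA'⟩ := Phi_dir k α κ s1 θ1 s2 θ2 (-n1) p1 n2 (-p2) x1 y1 x2 y2 R _ _ c sh hx1 hy1
    hx2 hy2 hR hR0 rfl rfl hc hsh
  have hch := Real.cosh_pos (2 * k * (s1 - s2))
  obtain ⟨e1, e2, e3⟩ := dir_alg k α κ p1 n1 p2 n2 x1 y1 x2 y2 q1 q2 (exp s1) (exp s2) R r cw sw c sh
    _ _ _ _ hα hr0 hr2 (by rw [hcw, hsw, div_pow, div_pow, ← add_div, ← hRxy, hr2, div_self hR0.ne'])
    (by rw [hcw]; field_simp) (by rw [hsw]; field_simp) (exp_pos _) (exp_pos _)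
    (by rw [hx1, hy1]; linear_combination (exp s1) ^ 2 * sin_sq_add_cos_sq θ1)
    (by rw [hx2, hy2]; linear_combination (exp s2) ^ 2 * sin_sq_add_cos_sq θ2)
    (by positivity) (by
      rw [hsh, hc, div_pow, one_pow, mul_one_div, div_le_one (by positivity)]
      have := Real.cosh_sq (2 * k * (s1 - s2)); linarith) hp1 hn1 hp2 hn2 rfl rfl rfl rfl
  refine ⟨p1, n1, p2, n2, a, _, a', _, e1, e2, hA, hA', ?_⟩
  clear hA hA'
  have hX1 : 4 * k ^ 2 * (q1 - q2) ^ 2 ≤ 4 * k ^ 2 * ((p1 - p2) ^ 2 + (n1 + n2) ^ 2) ∧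
      4 * k ^ 2 * ((p1 - p2) ^ 2 + (n1 + n2) ^ 2) ≤ 4 * k ^ 2 * (q1 + q2) ^ 2 := by
    have : |p1 * p2 - n1 * n2| ≤ q1 * q2 := by
      apply abs_le_of_sq_le_sq _ (by positivity)
      rw [mul_pow, ← e1, ← e2]
      have := sq_nonneg (p1 * n2 + n1 * p2)
      linarith
    rw [abs_le] at this
    constructor
    · gcongr; linarith
    · gcongr; linarith
  have hRu := Rf_eq s1 θ1 s2 θ2
  rw [← hR] at hRu
  have hco := Real.cos_le_one (θ1 - θ2)
  have hco2 := Real.neg_one_le_cos (θ1 - θ2)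
  have hee : 0 < exp s1 * exp s2 := by positivity
  have hee1 : 0 ≤ exp s1 * exp s2 * (1 - cos (θ1 - θ2)) := mul_nonneg hee.le (by linarith)
  have hee2 : 0 ≤ exp s1 * exp s2 * (1 + cos (θ1 - θ2)) := mul_nonneg hee.le (by linarith)
  have key := H s1 s2 q1 q2 R (4 * k ^ 2 * ((p1 - p2) ^ 2 + (n1 + n2) ^ 2)) hs hq1p hq2p
    (by
      rw [sq1, sq2, mul_div_assoc', ← Real.exp_add, ← Real.exp_add]
      gcongr
      linarith)
    (by
      rw [sq1, sq2, mul_div_assoc', ← Real.exp_add, ← Real.exp_add]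
      gcongr
      linarith) hR0 (by linarith) (by linarith) hX1.1 hX1.2 c hc
  have hPhi : Phi k α κ s1 θ1 s2 θ2 = R ^ (α / 2) * exp (-(α * κ / 2) / cosh (2 * k * (s1 - s2))) := rfl
  rw [hPhi]
  set E := exp (-(α * κ / 2) / cosh (2 * k * (s1 - s2))) with hE
  have hEl : exp (-1) ≤ E := by
    apply exp_le_exp.2
    rw [neg_div]
    apply neg_le_neg
    rw [div_le_one hch]
    have h1 := Real.one_le_cosh (2 * k * (s1 - s2))
    have : α * κ ≤ 1 * 1 := by gcongr
    linarith
  have hlow : exp (-(2 * C)) / b ^ 2 ≤ q2 ^ 2 * exp (α * s2) := by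
    rw [sq2, div_mul_eq_mul_div, ← Real.exp_add]
    gcongr
    have hh := mul_nonneg (sub_nonneg.2 hα2) (neg_nonneg.2 hs2)
    linarith
  rw [← mul_add]
  have hRp : 0 < R ^ (α / 2) := Real.rpow_pos_of_pos hR0 _
  calc _ ≤ R ^ (α / 2) * E * (α / 2) * (-8 * q1 * q2 * exp s1 * exp s2 / R
        + 4 * α * (q1 * exp s1 + q2 * exp s2) ^ 2 / R
        + (κ * (-c + 2 * c ^ 3) + α * κ ^ 2 * c ^ 2) * (4 * k ^ 2 * ((p1 - p2) ^ 2 + (n1 + n2) ^ 2))) := by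
        gcongr
    _ = (α / 2) * E * (R ^ (α / 2) * (-8 * q1 * q2 * exp s1 * exp s2 / R
        + 4 * α * (q1 * exp s1 + q2 * exp s2) ^ 2 / R
        + (κ * (-c + 2 * c ^ 3) + α * κ ^ 2 * c ^ 2) * (4 * k ^ 2 * ((p1 - p2) ^ 2 + (n1 + n2) ^ 2)))) := by ring
    _ ≤ (α / 2) * E * (- c1 * q2 ^ 2 * exp (α * s2)) := by gcongr
    _ = -((α / 2) * E * c1 * (q2 ^ 2 * exp (α * s2))) := by ring
    _ ≤ -((α / 2) * exp (-1) * c1 * (exp (-(2 * C)) / b ^ 2)) := by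
        gcongr

theorem Phi_key (b C : ℝ) (hb : 0 < b) (hC : 0 ≤ C) :
    ∃ k α κ c0 : ℝ, 0 < k ∧ 0 < α ∧ α ≤ 1 ∧ 0 < κ ∧ κ ≤ 1 ∧ 0 < c0 ∧
    ∀ s1 θ1 s2 θ2 u1 u2 : ℝ, s1 ≤ 0 → s2 ≤ 0 → |u1| ≤ C → |u2| ≤ C → 0 < Rf s1 θ1 s2 θ2 →
    ∃ p1 n1 p2 n2 p1' n1' p2' n2' a A a' A' : ℝ,
      p1 ^ 2 + p1' ^ 2 = (exp (-u1 - b * s1) / b) ^ 2 ∧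
      n1 ^ 2 + n1' ^ 2 = (exp (-u1 - b * s1) / b) ^ 2 ∧ p1 * n1 + p1' * n1' = 0 ∧
      p2 ^ 2 + p2' ^ 2 = (exp (-u2 - b * s2) / b) ^ 2 ∧
      n2 ^ 2 + n2' ^ 2 = (exp (-u2 - b * s2) / b) ^ 2 ∧ p2 * n2 + p2' * n2' = 0 ∧
      D2 (fun τ => Phi k α κ (s1 + τ * p1) (θ1 + τ * n1) (s2 + τ * p2) (θ2 + τ * n2)) a A ∧
      D2 (fun τ => Phi k α κ (s1 + τ * p1') (θ1 + τ * n1') (s2 + τ * p2') (θ2 + τ * n2')) a' A' ∧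
      A + A' ≤ -c0 := by
  obtain ⟨k, α, κ, c0, hk, hα, hα1, hκ, hκ1, hc0, H⟩ := Phi_key_aux b C hb hC
  refine ⟨k, α, κ, c0, hk, hα, hα1, hκ, hκ1, hc0, ?_⟩
  intro s1 θ1 s2 θ2 u1 u2 hs1 hs2 hu1 hu2 hR
  rcases le_total s1 s2 with h | h
  · obtain ⟨p1, n1, p2, n2, a, A, a', A', e1, e2, h1, h2, h3⟩ := H s1 θ1 s2 θ2 u1 u2 h hs2 hu1 hu2 hR
    refine ⟨p1, n1, p2, n2, -n1, p1, n2, -p2, a, A, a', A', ?_, ?_, ?_, ?_, ?_, ?_, h1, h2, h3⟩ <;>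
      first | linarith | (ring1)
  · rw [Rf_symm] at hR
    obtain ⟨p1, n1, p2, n2, a, A, a', A', e1, e2, h1, h2, h3⟩ := H s2 θ2 s1 θ1 u2 u1 h hs1 hu2 hu1 hR
    refine ⟨p2, n2, p1, n1, n2, -p2, -n1, p1, a, A, a', A', ?_, ?_, ?_, ?_, ?_, ?_, ?_, ?_, h3⟩
    any_goals (first | linarith | (ring1))
    · simpa only [Phi_symm k α κ (s2 + _)] using h1
    · simpa only [Phi_symm k α κ (s2 + _)] using h2

structure Sol (β c C T : ℝ) (u f : ℝ → ℝ → ℝ → ℝ) : Prop where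
  hb : 0 < β + 1
  hT : 0 < T
  hC : 0 ≤ C
  per : ∀ ρ θ t : ℝ, u ρ (θ + 2 * π) t = u ρ θ t
  ub : ∀ ρ θ t : ℝ, 0 < ρ → ρ < 1 → t ∈ Icc 0 T → |u ρ θ t| ≤ C
  fb : ∀ ρ θ t : ℝ, 0 < ρ → ρ < 1 → t ∈ Icc 0 T → |f ρ θ t| ≤ C
  cx : ∀ t ∈ Icc (0:ℝ) T, ContDiffOn ℝ 2 (fun p : ℝ × ℝ => u p.1 p.2 t)
                {p : ℝ × ℝ | 0 < p.1 ∧ p.1 < 1}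
  ct : ∀ ρ θ : ℝ, 0 < ρ → ρ < 1 → ContDiffOn ℝ 1 (fun t => u ρ θ t) (Icc 0 T)
  pde : ∀ ρ θ t : ℝ, 0 < ρ → ρ < 1 → t ∈ Icc 0 T →
                dtime T (fun s => u ρ θ s) t
                  = Real.exp (-c * u ρ θ t) * coneLapT β u ρ θ t + f ρ θ t
  en : (∫⁻ t in Icc (0:ℝ) T, ∫⁻ θ in Icc (0:ℝ) (2 * π), ∫⁻ ρ in Ioo (0:ℝ) 1,
                  ENNReal.ofReal ((dtime T (fun s => u ρ θ s) t) ^ 2 * ((β + 1) * ρ))) ≠ ⊤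

theorem Sol.neg {β c C T : ℝ} {u f : ℝ → ℝ → ℝ → ℝ} (S : Sol β c C T u f) :
    Sol β (-c) C T (fun ρ θ t => - u ρ θ t) (fun ρ θ t => - f ρ θ t) := by
  have hd : ∀ ρ θ t, dtime T (fun s => - u ρ θ s) t = - dtime T (fun s => u ρ θ s) t := by
    intro ρ θ t
    unfold dtime
    exact derivWithin.fun_neg
  have hl : ∀ ρ θ t, coneLapT β (fun ρ θ t => - u ρ θ t) ρ θ t = - coneLapT β u ρ θ t := by
    intro ρ θ t
    unfold coneLapT
    simp only [deriv.fun_neg]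
    ring
  refine ⟨S.hb, S.hT, S.hC, fun ρ θ t => by simp [S.per], ?_, ?_, ?_, ?_, ?_, ?_⟩
  · intro ρ θ t h1 h2 h3; rw [abs_neg]; exact S.ub ρ θ t h1 h2 h3
  · intro ρ θ t h1 h2 h3; rw [abs_neg]; exact S.fb ρ θ t h1 h2 h3
  · intro t ht; exact (S.cx t ht).neg
  · intro ρ θ h1 h2; exact (S.ct ρ θ h1 h2).neg
  · intro ρ θ t h1 h2 h3
    rw [hd, hl, S.pde ρ θ t h1 h2 h3]
    rw [neg_mul_neg]
    simp only [neg_mul]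
    ring
  · simp only [hd, neg_sq]
    exact S.en

theorem c2_line {F : ℝ → ℝ} {x : ℝ} (h : ContDiffAt ℝ 2 F x) :
    (∀ᶠ y in nhds x, HasDerivAt F (deriv F y) y) ∧ HasDerivAt (deriv F) (deriv (deriv F) x) x := by
  constructor
  · filter_upwards [h.eventually (by simp)] with y hy
    exact (hy.differentiableAt (by norm_num)).hasDerivAt
  · have : ContDiffAt ℝ 1 (deriv F) x := by
      have h1 : ContDiffAt ℝ 1 (fderiv ℝ F) x := h.fderiv_right (by norm_num)
      exact h1.clm_apply (contDiffAt_const (c := (1:ℝ)))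
    exact (this.differentiableAt (by norm_num)).hasDerivAt

theorem D2.uniq {g : ℝ → ℝ} {a b a' b' : ℝ} (h : D2 g a b) (h' : D2 g a' b') : b = b' := by
  obtain ⟨f, h1, h2, h3⟩ := h
  obtain ⟨f', h1', h2', h3'⟩ := h'
  have : f =ᶠ[nhds 0] f' := by
    filter_upwards [h1, h1'] with x hx hx' using hx.unique hx'
  exact (h3.congr_of_eventuallyEq this.symm).unique h3'

theorem D2_of_c2 {W : ℝ × ℝ → ℝ} {s θ : ℝ} (h : ContDiffAt ℝ 2 W (s, θ)) :
    ∃ H11 H12 H22 : ℝ, ∀ p n : ℝ, ∃ a, D2 (fun τ => W (s + τ * p, θ + τ * n)) a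
      (H11 * p ^ 2 + H12 * (p * n) + H22 * n ^ 2) := by
  have hf : ContDiffAt ℝ 1 (fderiv ℝ W) (s, θ) := h.fderiv_right (by norm_num)
  have hf' := (hf.differentiableAt (by norm_num)).hasFDerivAt
  set B := fderiv ℝ (fderiv ℝ W) (s, θ) with hB
  refine ⟨B (1, 0) (1, 0), B (1, 0) (0, 1) + B (0, 1) (1, 0), B (0, 1) (0, 1), ?_⟩
  intro p n
  have hline : ∀ τ : ℝ, HasDerivAt (fun τ : ℝ => (s + τ * p, θ + τ * n)) (p, n) τ := by
    intro τ
    have h1 : HasDerivAt (fun τ : ℝ => s + τ * p) p τ := by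
      simpa using ((hasDerivAt_id τ).mul_const p).const_add s
    have h2 : HasDerivAt (fun τ : ℝ => θ + τ * n) n τ := by
      simpa using ((hasDerivAt_id τ).mul_const n).const_add θ
    exact h1.prodMk h2
  refine ⟨fderiv ℝ W (s, θ) (p, n), fun τ => fderiv ℝ W (s + τ * p, θ + τ * n) (p, n), ?_, by simp, ?_⟩
  · have hc : ContinuousAt (fun τ : ℝ => (s + τ * p, θ + τ * n)) 0 := (hline 0).continuousAt
    have he := h.eventually (by simp)
    have h0 : (s + 0 * p, θ + 0 * n) = (s, θ) := by simp
    rw [ContinuousAt, h0] at hc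
    filter_upwards [hc.eventually he] with τ hτ
    exact ((hτ.differentiableAt (by norm_num)).hasFDerivAt).comp_hasDerivAt τ (hline τ)
  · have h0 : (s, θ) = (s + 0 * p, θ + 0 * n) := by simp
    rw [h0] at hf'
    have h1 := hf'.comp_hasDerivAt (0:ℝ) (hline 0)
    have h2 := h1.clm_apply (hasDerivAt_const (0:ℝ) ((p, n) : ℝ × ℝ))
    refine h2.congr_deriv ?_
    have hpn : ((p, n) : ℝ × ℝ) = p • (1, 0) + n • (0, 1) := by simp
    rw [hpn]
    simp only [map_add, map_smul, add_apply, smul_apply,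
      smul_eq_mul, map_zero, add_zero]
    ring

theorem lap_lines {β c C T : ℝ} {u f : ℝ → ℝ → ℝ → ℝ} (S : Sol β c C T u f) {s θ t : ℝ}
    (hs : s < 0) (ht : t ∈ Icc 0 T) :
    ∃ H11 H12 H22 : ℝ, (∀ p n : ℝ, ∃ a,
      D2 (fun τ => u (exp ((β + 1) * (s + τ * p))) (θ + τ * n) t) a
      (H11 * p ^ 2 + H12 * (p * n) + H22 * n ^ 2)) ∧
      H11 + H22 = (β + 1) ^ 2 * exp ((β + 1) * s) ^ 2 *
        coneLapT β u (exp ((β + 1) * s)) θ t := by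
  set b := β + 1 with hbdef
  have hb : 0 < b := S.hb
  set ρ := exp (b * s) with hρ
  have hρ0 : 0 < ρ := exp_pos _
  have hρ1 : ρ < 1 := by
    rw [hρ, Real.exp_lt_one_iff]; nlinarith
  have hopen : IsOpen {p : ℝ × ℝ | 0 < p.1 ∧ p.1 < 1} :=
    (isOpen_lt continuous_const continuous_fst).inter (isOpen_lt continuous_fst continuous_const)
  have hU : ContDiffAt ℝ 2 (fun p : ℝ × ℝ => u p.1 p.2 t) (ρ, θ) :=
    (S.cx t ht).contDiffAt (hopen.mem_nhds ⟨hρ0, hρ1⟩)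
  have hW : ContDiffAt ℝ 2 (fun p : ℝ × ℝ => u (exp (b * p.1)) p.2 t) (s, θ) := by
    have hin : ContDiffAt ℝ 2 (fun p : ℝ × ℝ => (exp (b * p.1), p.2)) (s, θ) := by fun_prop
    exact ContDiffAt.comp (s, θ) (g := fun p : ℝ × ℝ => u p.1 p.2 t) hU hin
  obtain ⟨H11, H12, H22, H⟩ := D2_of_c2 hW
  refine ⟨H11, H12, H22, H, ?_⟩
  -- radial
  have hF : ContDiffAt ℝ 2 (fun r => u r θ t) ρ := by
    have hin : ContDiffAt ℝ 2 (fun r : ℝ => (r, θ)) ρ := by fun_prop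
    exact ContDiffAt.comp ρ (g := fun p : ℝ × ℝ => u p.1 p.2 t) hU hin
  have hG : ContDiffAt ℝ 2 (fun r => u ρ r t) θ := by
    have hin : ContDiffAt ℝ 2 (fun r : ℝ => (ρ, r)) θ := by fun_prop
    exact ContDiffAt.comp θ (g := fun p : ℝ × ℝ => u p.1 p.2 t) hU hin
  obtain ⟨F1, F2⟩ := c2_line hF
  obtain ⟨G1, G2⟩ := c2_line hG
  have hr : D2 (fun τ => exp (b * (s + τ * 1))) (ρ * b) (ρ * b ^ 2) := by
    refine ((D2.affine s 1).const_mul b).exp.of_eq ?_ ?_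
    · simp [hρ]
    · simp [hρ]
  have d1 := hr.comp (y := ρ) (by simp [hρ]) F1 F2
  have hθ : D2 (fun τ => θ + τ * 1) 1 0 := D2.affine θ 1
  have d2 := hθ.comp (y := θ) (by simp) G1 G2
  obtain ⟨a, ha⟩ := H 1 0
  obtain ⟨a', ha'⟩ := H 0 1
  simp only [mul_zero, add_zero, mul_one, one_pow, ne_eq, OfNat.ofNat_ne_zero, not_false_eq_true,
    zero_pow, zero_add] at ha ha' d1 d2
  have e1 := ha.uniq d1
  have e2 := ha'.uniq d2
  rw [e1, e2]
  unfold coneLapT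
  rw [← hbdef]
  field_simp

theorem strip_open : IsOpen {p : ℝ × ℝ | 0 < p.1 ∧ p.1 < 1} :=
  (isOpen_lt continuous_const continuous_fst).inter (isOpen_lt continuous_fst continuous_const)

theorem c2_partials {W : ℝ × ℝ → ℝ} (h : ContDiffOn ℝ 2 W {p : ℝ × ℝ | 0 < p.1 ∧ p.1 < 1}) :
    ∃ Wr Wt Wrr Wtt : ℝ × ℝ → ℝ,
      ContinuousOn Wr {p : ℝ × ℝ | 0 < p.1 ∧ p.1 < 1} ∧
      ContinuousOn Wt {p : ℝ × ℝ | 0 < p.1 ∧ p.1 < 1} ∧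
      ContinuousOn Wrr {p : ℝ × ℝ | 0 < p.1 ∧ p.1 < 1} ∧
      ContinuousOn Wtt {p : ℝ × ℝ | 0 < p.1 ∧ p.1 < 1} ∧
      ∀ r θ : ℝ, 0 < r → r < 1 →
        HasDerivAt (fun x => W (x, θ)) (Wr (r, θ)) r ∧
        HasDerivAt (fun x => Wr (x, θ)) (Wrr (r, θ)) r ∧
        HasDerivAt (fun x => W (r, x)) (Wt (r, θ)) θ ∧
        HasDerivAt (fun x => Wt (r, x)) (Wtt (r, θ)) θ := by
  have aux : ∀ (v : ℝ × ℝ) {n : WithTop ℕ∞} {V : ℝ × ℝ → ℝ},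
      ContDiffOn ℝ (n + 1) V {p : ℝ × ℝ | 0 < p.1 ∧ p.1 < 1} →
      ContDiffOn ℝ n (fun p => fderiv ℝ V p v) {p : ℝ × ℝ | 0 < p.1 ∧ p.1 < 1} := by
    intro v n V hV
    exact (hV.fderiv_of_isOpen strip_open le_rfl).clm_apply contDiffOn_const
  have lr : ∀ {V : ℝ × ℝ → ℝ}, ContDiffOn ℝ 1 V {p : ℝ × ℝ | 0 < p.1 ∧ p.1 < 1} →
      ∀ r θ : ℝ, 0 < r → r < 1 →
      HasDerivAt (fun x => V (x, θ)) (fderiv ℝ V (r, θ) (1, 0)) r := by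
    intro V hV r θ h0 h1
    have hd : HasFDerivAt V (fderiv ℝ V (r, θ)) (r, θ) :=
      ((hV.contDiffAt (strip_open.mem_nhds ⟨h0, h1⟩)).differentiableAt (by norm_num)).hasFDerivAt
    exact hd.comp_hasDerivAt r ((hasDerivAt_id r).prodMk (hasDerivAt_const r θ))
  have lt : ∀ {V : ℝ × ℝ → ℝ}, ContDiffOn ℝ 1 V {p : ℝ × ℝ | 0 < p.1 ∧ p.1 < 1} →
      ∀ r θ : ℝ, 0 < r → r < 1 →
      HasDerivAt (fun x => V (r, x)) (fderiv ℝ V (r, θ) (0, 1)) θ := by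
    intro V hV r θ h0 h1
    have hd : HasFDerivAt V (fderiv ℝ V (r, θ)) (r, θ) :=
      ((hV.contDiffAt (strip_open.mem_nhds ⟨h0, h1⟩)).differentiableAt (by norm_num)).hasFDerivAt
    exact hd.comp_hasDerivAt θ ((hasDerivAt_const θ r).prodMk (hasDerivAt_id θ))
  have h1 : ContDiffOn ℝ 1 W {p : ℝ × ℝ | 0 < p.1 ∧ p.1 < 1} := h.of_le (by norm_num)
  have hr : ContDiffOn ℝ 1 (fun p => fderiv ℝ W p (1, 0)) {p : ℝ × ℝ | 0 < p.1 ∧ p.1 < 1} :=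
    aux (1, 0) (by norm_num; exact h)
  have ht : ContDiffOn ℝ 1 (fun p => fderiv ℝ W p (0, 1)) {p : ℝ × ℝ | 0 < p.1 ∧ p.1 < 1} :=
    aux (0, 1) (by norm_num; exact h)
  have hrr := aux (n := 0) (1, 0) (by simpa using hr)
  have htt := aux (n := 0) (0, 1) (by simpa using ht)
  exact ⟨_, _, _, _, hr.continuousOn, ht.continuousOn, hrr.continuousOn, htt.continuousOn,
    fun r θ h0 h2 => ⟨lr h1 r θ h0 h2, lr hr r θ h0 h2, lt h1 r θ h0 h2, lt ht r θ h0 h2⟩⟩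

theorem ibp1 {F F' q q' : ℝ → ℝ} {a d : ℝ} (had : a ≤ d)
    (hF : ∀ x ∈ Icc a d, HasDerivAt F (F' x) x) (hq : ∀ x ∈ Icc a d, HasDerivAt q (q' x) x)
    (cF : ContinuousOn F' (Icc a d)) (cq : ContinuousOn q' (Icc a d))
    (hpos : ∀ x ∈ Icc a d, 0 ≤ F' x * q x) (hbd : F d * q d - F a * q a = 0) :
    ∫ x in Icc a d, F x * q' x ≤ 0 := by
  rw [integral_Icc_eq_integral_Ioc, ← intervalIntegral.integral_of_le had]
  rw [intervalIntegral.integral_mul_deriv_eq_deriv_mul (u' := F') (v := q)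
    (by rw [uIcc_of_le had]; exact hF) (by rw [uIcc_of_le had]; exact hq)
    (cF.intervalIntegrable_of_Icc had) (cq.intervalIntegrable_of_Icc had), hbd]
  have := intervalIntegral.integral_nonneg (μ := volume) had hpos
  linarith

theorem coneLap_eq {β : ℝ} {W : ℝ → ℝ → ℝ} {Wr Wt Wrr Wtt : ℝ × ℝ → ℝ}
    (H : ∀ r θ : ℝ, 0 < r → r < 1 →
        HasDerivAt (fun x => W x θ) (Wr (r, θ)) r ∧
        HasDerivAt (fun x => Wr (x, θ)) (Wrr (r, θ)) r ∧
        HasDerivAt (fun x => W r x) (Wt (r, θ)) θ ∧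
        HasDerivAt (fun x => Wt (r, x)) (Wtt (r, θ)) θ) {r θ : ℝ} (h0 : 0 < r) (h1 : r < 1)
    (t : ℝ) :
    coneLapT β (fun ρ θ _ => W ρ θ) r θ t = Wrr (r, θ) + r⁻¹ * Wr (r, θ)
      + ((β + 1) ^ 2)⁻¹ * (r ^ 2)⁻¹ * Wtt (r, θ) := by
  unfold coneLapT
  have e1 : (fun r => deriv (fun r' => W r' θ) r) =ᶠ[nhds r] fun x => Wr (x, θ) := by
    filter_upwards [Ioo_mem_nhds h0 h1] with x hx
    exact (H x θ hx.1 hx.2).1.deriv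
  have e2 : (fun s => deriv (fun s' => W r s') s) = fun x => Wt (r, x) := by
    funext x
    exact (H r x h0 h1).2.2.1.deriv
  rw [e1.deriv_eq, e2, (H r θ h0 h1).2.1.deriv, (H r θ h0 h1).1.deriv, (H r θ h0 h1).2.2.2.deriv]

theorem ibp_box {β a d : ℝ} (ha : 0 < a) (had : a < d) (hd : d < 1)
    {w : ℝ → ℝ → ℝ}
    (hw : ContDiffOn ℝ 2 (fun p : ℝ × ℝ => w p.1 p.2) {p : ℝ × ℝ | 0 < p.1 ∧ p.1 < 1})
    (per : ∀ ρ θ, w ρ (θ + 2 * π) = w ρ θ) (ba : ∀ θ, w a θ ≤ 0) (bd : ∀ θ, w d θ ≤ 0) (t : ℝ) :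
    IntegrableOn (fun p : ℝ × ℝ => p.2 * ((max (w p.2 p.1) 0) ^ 2
      * coneLapT β (fun ρ θ _ => w ρ θ) p.2 p.1 t)) (Icc 0 (2 * π) ×ˢ Icc a d) ∧
    ∫ p in Icc 0 (2 * π) ×ˢ Icc a d, p.2 * ((max (w p.2 p.1) 0) ^ 2
      * coneLapT β (fun ρ θ _ => w ρ θ) p.2 p.1 t) ≤ 0 := by
  obtain ⟨Wr, Wt, Wrr, Wtt, cr, ct, crr, ctt, H⟩ := c2_partials hw
  have hcl : ∀ p ∈ Icc 0 (2 * π) ×ˢ Icc a d, p.2 * ((max (w p.2 p.1) 0) ^ 2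
      * coneLapT β (fun ρ θ _ => w ρ θ) p.2 p.1 t) =
      (max (w p.2 p.1) 0) ^ 2 * (1 * Wr (p.2, p.1) + p.2 * Wrr (p.2, p.1))
      + (max (w p.2 p.1) 0) ^ 2 * (((β + 1) ^ 2)⁻¹ * p.2⁻¹ * Wtt (p.2, p.1)) := by
    rintro ⟨θ, r⟩ ⟨-, hr1, hr2⟩
    simp only at hr1 hr2 ⊢
    have h0 : 0 < r := by linarith
    rw [coneLap_eq H h0 (by linarith)]
    field_simp
    ring
  have hmap : MapsTo (fun p : ℝ × ℝ => (p.2, p.1)) (Icc 0 (2 * π) ×ˢ Icc a d)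
      {p : ℝ × ℝ | 0 < p.1 ∧ p.1 < 1} := by
    rintro ⟨θ, r⟩ ⟨-, hr1, hr2⟩
    exact ⟨lt_of_lt_of_le ha hr1, lt_of_le_of_lt hr2 hd⟩
  have csw : ContinuousOn (fun p : ℝ × ℝ => (p.2, p.1)) (Icc 0 (2 * π) ×ˢ Icc a d) := by fun_prop
  have kr := cr.comp csw hmap
  have krr := crr.comp csw hmap
  have ktt := ctt.comp csw hmap
  have kw := hw.continuousOn.comp csw hmap
  simp only [Function.comp_def] at kr krr ktt kw
  have kh : ContinuousOn (fun p : ℝ × ℝ => (max (w p.2 p.1) 0) ^ 2) (Icc 0 (2 * π) ×ˢ Icc a d) :=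
    (kw.sup continuousOn_const).pow 2
  have hinv : ContinuousOn (fun p : ℝ × ℝ => p.2⁻¹) (Icc 0 (2 * π) ×ˢ Icc a d) := by
    refine ContinuousOn.inv₀ (by fun_prop) ?_
    rintro ⟨θ, r⟩ ⟨-, hr1, hr2⟩
    exact (lt_of_lt_of_le ha hr1).ne'
  have c1 : ContinuousOn (fun p : ℝ × ℝ => (max (w p.2 p.1) 0) ^ 2 *
      (1 * Wr (p.2, p.1) + p.2 * Wrr (p.2, p.1))) (Icc 0 (2 * π) ×ˢ Icc a d) :=
    kh.mul ((continuousOn_const.mul kr).add (continuousOn_snd.mul krr))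
  have c2 : ContinuousOn (fun p : ℝ × ℝ => (max (w p.2 p.1) 0) ^ 2 *
      (((β + 1) ^ 2)⁻¹ * p.2⁻¹ * Wtt (p.2, p.1))) (Icc 0 (2 * π) ×ˢ Icc a d) :=
    kh.mul ((continuousOn_const.mul hinv).mul ktt)
  have hK : IsCompact (Icc 0 (2 * π) ×ˢ Icc a d) := isCompact_Icc.prod isCompact_Icc
  have i1 := c1.integrableOn_compact (μ := volume) hK
  have i2 := c2.integrableOn_compact (μ := volume) hK
  have hms : MeasurableSet (Icc 0 (2 * π) ×ˢ Icc a d) := hK.measurableSet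
  refine ⟨(i1.add i2).congr_fun (fun p hp => (hcl p hp).symm) hms, ?_⟩
  rw [setIntegral_congr_fun hms hcl, integral_add i1 i2]
  have hh : ∀ r θ, 0 < r → r < 1 → HasDerivAt (fun x => (max (w x θ) 0) ^ 2)
      (2 * (max (w r θ) 0) * Wr (r, θ)) r := by
    intro r θ h0 h1
    have := (posPow_hasDerivAt 0 (w r θ)).comp r (H r θ h0 h1).1
    simpa [Function.comp_def] using this
  have hht : ∀ r θ, 0 < r → r < 1 → HasDerivAt (fun x => (max (w r x) 0) ^ 2)
      (2 * (max (w r θ) 0) * Wt (r, θ)) θ := by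
    intro r θ h0 h1
    have := (posPow_hasDerivAt 0 (w r θ)).comp θ (H r θ h0 h1).2.2.1
    simpa [Function.comp_def] using this
  have lr : ∀ θ, MapsTo (fun r : ℝ => (r, θ)) (Icc a d) {p : ℝ × ℝ | 0 < p.1 ∧ p.1 < 1} :=
    fun θ r hr => ⟨lt_of_lt_of_le ha hr.1, lt_of_le_of_lt hr.2 hd⟩
  have lt' : ∀ r ∈ Icc a d, MapsTo (fun θ : ℝ => (r, θ)) (Icc 0 (2 * π))
      {p : ℝ × ℝ | 0 < p.1 ∧ p.1 < 1} :=
    fun r hr θ _ => ⟨lt_of_lt_of_le ha hr.1, lt_of_le_of_lt hr.2 hd⟩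
  have A1 : ∫ p in Icc 0 (2 * π) ×ˢ Icc a d, (max (w p.2 p.1) 0) ^ 2 *
      (1 * Wr (p.2, p.1) + p.2 * Wrr (p.2, p.1)) ≤ 0 := by
    rw [Measure.volume_eq_prod, setIntegral_prod _ i1]
    refine setIntegral_nonpos measurableSet_Icc (fun θ _ => ?_)
    simp only
    have cθ : ContinuousOn (fun r : ℝ => (r, θ)) (Icc a d) := by fun_prop
    have jr := cr.comp cθ (lr θ)
    have jrr := crr.comp cθ (lr θ)
    have jw := hw.continuousOn.comp cθ (lr θ)
    simp only [Function.comp_def] at jr jrr jw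
    refine ibp1 (F' := fun r => 2 * (max (w r θ) 0) * Wr (r, θ)) (q := fun r => r * Wr (r, θ))
      had.le ?_ ?_ ?_ ?_ ?_ ?_
    · intro r hr
      exact hh r θ (lt_of_lt_of_le ha hr.1) (lt_of_le_of_lt hr.2 hd)
    · intro r hr
      exact (hasDerivAt_id r).mul (H r θ (lt_of_lt_of_le ha hr.1) (lt_of_le_of_lt hr.2 hd)).2.1
    · exact (continuousOn_const.mul (jw.sup continuousOn_const)).mul jr
    · exact (continuousOn_const.mul jr).add (continuousOn_id.mul jrr)
    · intro r hr
      have h0 := lt_of_lt_of_le ha hr.1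
      have : 2 * (max (w r θ) 0) * Wr (r, θ) * (r * Wr (r, θ)) =
        2 * r * (max (w r θ) 0) * (Wr (r, θ)) ^ 2 := by ring
      rw [this]
      positivity
    · simp [max_eq_right (ba θ), max_eq_right (bd θ)]
  have A2 : ∫ p in Icc 0 (2 * π) ×ˢ Icc a d, (max (w p.2 p.1) 0) ^ 2 *
      (((β + 1) ^ 2)⁻¹ * p.2⁻¹ * Wtt (p.2, p.1)) ≤ 0 := by
    rw [Measure.volume_eq_prod, ← Measure.prod_restrict]
    rw [IntegrableOn, Measure.volume_eq_prod, ← Measure.prod_restrict] at i2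
    rw [integral_prod_symm _ i2]
    refine setIntegral_nonpos measurableSet_Icc (fun r hr => ?_)
    have h0 := lt_of_lt_of_le ha hr.1
    have h1 := lt_of_le_of_lt hr.2 hd
    simp only
    have cθ : ContinuousOn (fun θ : ℝ => (r, θ)) (Icc 0 (2 * π)) := by fun_prop
    have jt := ct.comp cθ (lt' r hr)
    have jtt := ctt.comp cθ (lt' r hr)
    have jw := hw.continuousOn.comp cθ (lt' r hr)
    simp only [Function.comp_def] at jt jtt jw
    have hk : 0 ≤ ((β + 1) ^ 2)⁻¹ * r⁻¹ := by positivity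
    refine ibp1 (F' := fun θ => 2 * (max (w r θ) 0) * Wt (r, θ))
      (q := fun θ => ((β + 1) ^ 2)⁻¹ * r⁻¹ * Wt (r, θ))
      (by positivity) ?_ ?_ ?_ ?_ ?_ ?_
    · intro θ _
      exact hht r θ h0 h1
    · intro θ _
      exact (H r θ h0 h1).2.2.2.const_mul _
    · exact (continuousOn_const.mul (jw.sup continuousOn_const)).mul jt
    · exact continuousOn_const.mul jtt
    · intro θ _
      have : 2 * (max (w r θ) 0) * Wt (r, θ) * (((β + 1) ^ 2)⁻¹ * r⁻¹ * Wt (r, θ)) =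
        2 * (((β + 1) ^ 2)⁻¹ * r⁻¹) * (max (w r θ) 0) * (Wt (r, θ)) ^ 2 := by ring
      rw [this]
      positivity
    · have e1 : w r (2 * π) = w r 0 := by have := per r 0; rwa [zero_add] at this
      have e2 : Wt (r, 2 * π) = Wt (r, 0) := by
        have h2 := (H r (0 + 2 * π) h0 h1).2.2.1.comp_add_const 0 (2 * π)
        have h3 : (fun x => w r (x + 2 * π)) = fun x => w r x := funext (per r)
        simp only [] at h2
        rw [h3, zero_add] at h2
        exact h2.unique (H r 0 h0 h1).2.2.1
      rw [e1, e2]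
      ring
  linarith

theorem Sol.dW {β c C T : ℝ} {u f : ℝ → ℝ → ℝ → ℝ} (S : Sol β c C T u f) {ρ θ t : ℝ}
    (h0 : 0 < ρ) (h1 : ρ < 1) (ht : t ∈ Icc 0 T) :
    HasDerivWithinAt (fun s => u ρ θ s) (dtime T (fun s => u ρ θ s) t) (Icc 0 T) t :=
  (((S.ct ρ θ h0 h1).differentiableOn (by norm_num)) t ht).hasDerivWithinAt

theorem Sol.dA {β c C T : ℝ} {u f : ℝ → ℝ → ℝ → ℝ} (S : Sol β c C T u f) {ρ θ t : ℝ}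
    (h0 : 0 < ρ) (h1 : ρ < 1) (ht : t ∈ Ioo 0 T) :
    HasDerivAt (fun s => u ρ θ s) (dtime T (fun s => u ρ θ s) t) t :=
  (S.dW h0 h1 ⟨ht.1.le, ht.2.le⟩).hasDerivAt (Icc_mem_nhds ht.1 ht.2)

theorem Sol.vcont {β c C T : ℝ} {u f : ℝ → ℝ → ℝ → ℝ} (S : Sol β c C T u f) {ρ θ : ℝ}
    (h0 : 0 < ρ) (h1 : ρ < 1) :
    ContinuousOn (fun t => dtime T (fun s => u ρ θ s) t) (Icc 0 T) :=
  (S.ct ρ θ h0 h1).continuousOn_derivWithin (uniqueDiffOn_Icc S.hT) le_rfl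

theorem ae_box {t0 t1 : ℝ} {B : Set (ℝ × ℝ)} (hB : MeasurableSet B) :
    ∀ᵐ p ∂((volume.restrict (Ioo t0 t1)).prod ((volume : Measure (ℝ × ℝ)).restrict B)),
      p.1 ∈ Ioo t0 t1 ∧ p.2 ∈ B := by
  rw [Measure.prod_restrict]
  filter_upwards [ae_restrict_mem (measurableSet_Ioo.prod hB)] with p hp using hp

theorem Sol.meas {β c C T : ℝ} {u f : ℝ → ℝ → ℝ → ℝ} (S : Sol β c C T u f) {a d t0 t1 : ℝ}
    (ha : 0 < a) (had : a < d) (hd : d < 1) (h0 : 0 ≤ t0) (h01 : t0 < t1) (h1 : t1 ≤ T) :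
    AEMeasurable (fun p : ℝ × ℝ × ℝ => u p.2.2 p.2.1 p.1)
      ((volume.restrict (Ioo t0 t1)).prod
        ((volume : Measure (ℝ × ℝ)).restrict (Icc 0 (2 * π) ×ˢ Icc a d))) ∧
    AEMeasurable (fun p : ℝ × ℝ × ℝ => dtime T (fun s => u p.2.2 p.2.1 s) p.1)
      ((volume.restrict (Ioo t0 t1)).prod
        ((volume : Measure (ℝ × ℝ)).restrict (Icc 0 (2 * π) ×ˢ Icc a d))) := by
  have hms : MeasurableSet (Icc 0 (2 * π) ×ˢ Icc a d) := measurableSet_Icc.prod measurableSet_Icc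
  have hae := ae_box (t0 := t0) (t1 := t1) hms
  let U : ℝ × ℝ → ℝ → ℝ := fun x t => u (max a (min d x.2)) x.1 (max t0 (min t1 t))
  have hρ : ∀ y : ℝ, 0 < max a (min d y) ∧ max a (min d y) < 1 := fun y =>
    ⟨lt_of_lt_of_le ha (le_max_left _ _),
      max_lt (by linarith) (lt_of_le_of_lt (min_le_left _ _) hd)⟩
  have htt : ∀ t : ℝ, max t0 (min t1 t) ∈ Icc 0 T := fun t =>
    ⟨le_trans h0 (le_max_left _ _), max_le (by linarith) (le_trans (min_le_left _ _) h1)⟩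
  have Um : Measurable (Function.uncurry U) := by
    apply measurable_uncurry_of_continuous_of_measurable
    · intro t
      have hc := (S.cx _ (htt t)).continuousOn
      have hg : Continuous (fun x : ℝ × ℝ => (max a (min d x.2), x.1)) := by fun_prop
      exact hc.comp_continuous hg (fun x => hρ x.2)
    · intro x
      have hc := (S.ct (max a (min d x.2)) x.1 (hρ x.2).1 (hρ x.2).2).continuousOn
      have hg : Continuous (fun t : ℝ => max t0 (min t1 t)) := by fun_prop
      exact (hc.comp_continuous hg htt).measurable
  have Uv : ∀ ε : ℝ, Measurable (fun p : ℝ × ℝ × ℝ => U p.2 (p.1 + ε)) := fun ε =>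
    Um.comp (by fun_prop : Measurable (fun p : ℝ × ℝ × ℝ => (p.2, p.1 + ε)))
  have Ueq : ∀ x ∈ Icc 0 (2 * π) ×ˢ Icc a d, ∀ t ∈ Ioo t0 t1, U x t = u x.2 x.1 t := by
    intro x hx t ht
    simp only [U]
    rw [min_eq_right hx.2.2, max_eq_right hx.2.1, min_eq_right ht.2.le, max_eq_right ht.1.le]
  constructor
  · refine (Uv 0).aemeasurable.congr ?_
    filter_upwards [hae] with p hp
    rw [add_zero, Ueq p.2 hp.2 p.1 hp.1]
  · refine aemeasurable_of_tendsto_metrizable_ae (ι := ℕ) Filter.atTop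
      (f := fun n p => (1 / ((n:ℝ) + 1))⁻¹ * (U p.2 (p.1 + 1 / ((n:ℝ) + 1)) - U p.2 (p.1 + 0)))
      (fun n => (((Uv _).sub (Uv 0)).const_mul _).aemeasurable) ?_
    filter_upwards [hae] with p hp
    have q0 : 0 < p.2.2 := lt_of_lt_of_le ha hp.2.2.1
    have q1 : p.2.2 < 1 := lt_of_le_of_lt hp.2.2.2 hd
    have hder := S.dA (θ := p.2.1) q0 q1 (t := p.1) ⟨by linarith [hp.1.1], by linarith [hp.1.2]⟩
    have hev : (fun s => U p.2 s) =ᶠ[nhds p.1] fun s => u p.2.2 p.2.1 s := by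
      filter_upwards [Ioo_mem_nhds hp.1.1 hp.1.2] with s hs using Ueq p.2 hp.2 s hs
    have h2 := (hder.congr_of_eventuallyEq hev).tendsto_slope_zero_right
    have h3 : Filter.Tendsto (fun n : ℕ => 1 / ((n:ℝ) + 1)) Filter.atTop (nhdsWithin 0 (Ioi 0)) := by
      refine tendsto_nhdsWithin_iff.2 ⟨tendsto_one_div_add_atTop_nhds_zero_nat, ?_⟩
      filter_upwards with n
      exact (Nat.one_div_pos_of_nat : (0:ℝ) < 1 / ((n:ℝ) + 1))
    have h4 := h2.comp h3
    simpa [Function.comp_def] using h4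

theorem Sol.v2 {β c C T : ℝ} {u f : ℝ → ℝ → ℝ → ℝ} (S : Sol β c C T u f) {a d t0 t1 : ℝ}
    (ha : 0 < a) (had : a < d) (hd : d < 1) (h0 : 0 ≤ t0) (h01 : t0 < t1) (h1 : t1 ≤ T) :
    Integrable (fun p : ℝ × ℝ × ℝ => (dtime T (fun s => u p.2.2 p.2.1 s) p.1) ^ 2
      * ((β + 1) * p.2.2))
      ((volume.restrict (Ioo t0 t1)).prod
        ((volume : Measure (ℝ × ℝ)).restrict (Icc 0 (2 * π) ×ˢ Icc a d))) := by
  have hms : MeasurableSet (Icc 0 (2 * π) ×ˢ Icc a d) := measurableSet_Icc.prod measurableSet_Icc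
  have hae := ae_box (t0 := t0) (t1 := t1) hms
  have hv := (S.meas ha had hd h0 h01 h1).2
  have hm : AEMeasurable (fun p : ℝ × ℝ × ℝ => (dtime T (fun s => u p.2.2 p.2.1 s) p.1) ^ 2
      * ((β + 1) * p.2.2)) ((volume.restrict (Ioo t0 t1)).prod
        ((volume : Measure (ℝ × ℝ)).restrict (Icc 0 (2 * π) ×ˢ Icc a d))) := by
    refine (hv.pow_const 2).mul ?_
    exact (by fun_prop : Measurable (fun p : ℝ × ℝ × ℝ => (β + 1) * p.2.2)).aemeasurable
  refine (lintegral_ofReal_ne_top_iff_integrable hm.aestronglyMeasurable ?_).1 ?_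
  · filter_upwards [hae] with p hp
    have q0 : 0 < p.2.2 := lt_of_lt_of_le ha hp.2.2.1
    have := S.hb
    simp only [Pi.zero_apply]
    positivity
  · refine ne_top_of_le_ne_top S.en ?_
    refine (lintegral_prod_le _).trans ?_
    refine (lintegral_mono_set (Ioo_subset_Icc_self.trans (Icc_subset_Icc h0 h1))).trans ?_
    refine lintegral_mono (fun t => ?_)
    rw [Measure.volume_eq_prod, ← Measure.prod_restrict]
    refine (lintegral_prod_le _).trans ?_
    refine lintegral_mono (fun θ => ?_)
    exact lintegral_mono_set (fun r hr => ⟨lt_of_lt_of_le ha hr.1, lt_of_le_of_lt hr.2 hd⟩)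

theorem Gam_exists (c : ℝ) : ∃ Γ : ℝ → ℝ, (∀ y, HasDerivAt Γ (exp (c * y) * (max y 0) ^ 2) y) ∧
    (∀ y, 0 ≤ Γ y) ∧ (∀ y, y ≤ 0 → Γ y = 0) ∧ (∀ y, 0 < y → 0 < Γ y) := by
  have hc : Continuous (fun s : ℝ => exp (c * s) * (max s 0) ^ 2) := by fun_prop
  have hpos : ∀ y, 0 < y → 0 < ∫ s in (0:ℝ)..y, exp (c * s) * (max s 0) ^ 2 := by
    intro y hy
    refine intervalIntegral.intervalIntegral_pos_of_pos_on (hc.intervalIntegrable _ _) ?_ hy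
    intro s hs
    have : 0 < max s 0 := lt_of_lt_of_le hs.1 (le_max_left _ _)
    positivity
  have hzero : ∀ y, y ≤ 0 → ∫ s in (0:ℝ)..y, exp (c * s) * (max s 0) ^ 2 = 0 := by
    intro y hy
    apply intervalIntegral.integral_zero_ae
    filter_upwards with s hs
    rw [uIoc_of_ge hy] at hs
    rw [max_eq_right hs.2]
    simp
  refine ⟨fun y => ∫ s in (0:ℝ)..y, exp (c * s) * (max s 0) ^ 2, ?_, ?_, hzero, hpos⟩
  · intro y
    exact intervalIntegral.integral_hasDerivAt_right (hc.intervalIntegrable _ _)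
      hc.aestronglyMeasurable.stronglyMeasurableAtFilter hc.continuousAt
  · intro y
    rcases le_or_gt y 0 with h | h
    · exact (hzero y h).ge
    · exact (hpos y h).le

theorem coneLap_sub {β : ℝ} {U V : ℝ → ℝ → ℝ} (k : ℝ)
    (hU : ContDiffOn ℝ 2 (fun p : ℝ × ℝ => U p.1 p.2) {p : ℝ × ℝ | 0 < p.1 ∧ p.1 < 1})
    (hV : ContDiffOn ℝ 2 (fun p : ℝ × ℝ => V p.1 p.2) {p : ℝ × ℝ | 0 < p.1 ∧ p.1 < 1})
    {r θ : ℝ} (h0 : 0 < r) (h1 : r < 1) (t : ℝ) :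
    coneLapT β (fun ρ θ _ => U ρ θ - V ρ θ - k) r θ t =
      coneLapT β (fun ρ θ _ => U ρ θ) r θ t - coneLapT β (fun ρ θ _ => V ρ θ) r θ t := by
  obtain ⟨Ur, Ut, Urr, Utt, -, -, -, -, HU⟩ := c2_partials hU
  obtain ⟨Vr, Vt, Vrr, Vtt, -, -, -, -, HV⟩ := c2_partials hV
  rw [coneLap_eq HU h0 h1, coneLap_eq HV h0 h1,
    coneLap_eq (W := fun ρ θ => U ρ θ - V ρ θ - k) (Wr := fun p => Ur p - Vr p)
      (Wt := fun p => Ut p - Vt p) (Wrr := fun p => Urr p - Vrr p) (Wtt := fun p => Utt p - Vtt p)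
      ?_ h0 h1]
  · ring
  · intro r θ h0 h1
    obtain ⟨a1, a2, a3, a4⟩ := HU r θ h0 h1
    obtain ⟨b1, b2, b3, b4⟩ := HV r θ h0 h1
    exact ⟨(a1.sub b1).sub_const k, a2.sub b2, (a3.sub b3).sub_const k, a4.sub b4⟩

theorem weakmax {β c C T : ℝ} {u f : ℝ → ℝ → ℝ → ℝ} (S : Sol β c C T u f) {a d t0 t1 M : ℝ}
    (ha : 0 < a) (had : a < d) (hd : d < 1) (h0 : 0 ≤ t0) (h01 : t0 < t1) (h1 : t1 ≤ T)
    (hM : 0 ≤ M) {φ : ℝ → ℝ → ℝ}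
    (φc : ContDiffOn ℝ 2 (fun p : ℝ × ℝ => φ p.1 p.2) {p : ℝ × ℝ | 0 < p.1 ∧ p.1 < 1})
    (φper : ∀ ρ θ, φ ρ (θ + 2 * π) = φ ρ θ) (φa : ∀ θ, C ≤ φ a θ) (φd : ∀ θ, C ≤ φ d θ)
    (φL : ∀ ρ ∈ Icc a d, ∀ θ t, coneLapT β (fun ρ θ _ => φ ρ θ) ρ θ t ≤ M)
    (init : ∀ ρ ∈ Icc a d, ∀ θ, u ρ θ t0 ≤ φ ρ θ) :
    ∀ ρ ∈ Icc a d, ∀ θ, u ρ θ t1 ≤ φ ρ θ + (C + exp (|c| * C) * M) * (t1 - t0) := by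
  obtain ⟨K, hK⟩ : ∃ K, K = C + exp (|c| * C) * M := ⟨_, rfl⟩
  rw [← hK]
  have hK0 : 0 ≤ K := by rw [hK]; have := S.hC; positivity
  obtain ⟨Γ, Γd, Γ0, Γz, Γp⟩ := Gam_exists c
  have Γc : Continuous Γ := continuous_iff_continuousAt.2 (fun y => (Γd y).continuousAt)
  have hcpt : IsCompact (Icc 0 (2 * π) ×ˢ Icc a d) := isCompact_Icc.prod isCompact_Icc
  have hms : MeasurableSet (Icc 0 (2 * π) ×ˢ Icc a d) := hcpt.measurableSet
  have hae := ae_box (t0 := t0) (t1 := t1) hms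
  have hmap : MapsTo (fun p : ℝ × ℝ => (p.2, p.1)) (Icc 0 (2 * π) ×ˢ Icc a d)
      {p : ℝ × ℝ | 0 < p.1 ∧ p.1 < 1} := by
    rintro ⟨θ, r⟩ ⟨-, hr1, hr2⟩
    exact ⟨lt_of_lt_of_le ha hr1, lt_of_le_of_lt hr2 hd⟩
  have csw : ContinuousOn (fun p : ℝ × ℝ => (p.2, p.1)) (Icc 0 (2 * π) ×ˢ Icc a d) := by fun_prop
  have hφc : ContinuousOn (fun p : ℝ × ℝ => φ p.2 p.1) (Icc 0 (2 * π) ×ˢ Icc a d) :=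
    φc.continuousOn.comp csw hmap
  have mT : ∀ t, t ∈ Icc t0 t1 → t ∈ Icc 0 T := fun t ht => ⟨h0.trans ht.1, ht.2.trans h1⟩
  -- the integrand
  let G : ℝ → ℝ × ℝ → ℝ := fun t x => x.2 * (exp (c * (u x.2 x.1 t - K * (t - t0))) *
    (max (u x.2 x.1 t - φ x.2 x.1 - K * (t - t0)) 0) ^ 2
      * (dtime T (fun s => u x.2 x.1 s) t - K))
  let E : ℝ → ℝ × ℝ → ℝ := fun t x => exp (c * φ x.2 x.1) * Γ (u x.2 x.1 t - φ x.2 x.1 - K * (t - t0))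
  -- step A
  have stepA : ∀ t ∈ Ioo t0 t1, ∫ x in Icc 0 (2 * π) ×ˢ Icc a d, G t x ≤ 0 := by
    intro t ht
    have htT := mT t ⟨ht.1.le, ht.2.le⟩
    by_cases hitg : IntegrableOn (G t) (Icc 0 (2 * π) ×ˢ Icc a d) volume
    swap
    · rw [integral_undef hitg]
    have hkt : 0 ≤ K * (t - t0) := mul_nonneg hK0 (by linarith [ht.1])
    have hwb : ∀ ρ θ, 0 < ρ → ρ < 1 → u ρ θ t ≤ C := fun ρ θ q0 q1 =>
      (abs_le.1 (S.ub ρ θ t q0 q1 htT)).2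
    obtain ⟨J1, J2⟩ := ibp_box (β := β) ha had hd (w := fun ρ θ => u ρ θ t - φ ρ θ - K * (t - t0))
      (((S.cx t htT).sub φc).sub contDiffOn_const)
      (fun ρ θ => by simp only [S.per, φper])
      (fun θ => by
        have := hwb a θ ha (by linarith)
        have := φa θ
        linarith)
      (fun θ => by
        have := hwb d θ (by linarith) hd
        have := φd θ
        linarith) t
    have hle : ∫ x in Icc 0 (2 * π) ×ˢ Icc a d, G t x ≤ ∫ p in Icc 0 (2 * π) ×ˢ Icc a d,
        exp (-c * K * (t - t0)) * (p.2 * ((max (u p.2 p.1 t - φ p.2 p.1 - K * (t - t0)) 0) ^ 2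
      * coneLapT β (fun ρ θ _ => u ρ θ t - φ ρ θ - K * (t - t0)) p.2 p.1 t)) := by
      refine setIntegral_mono_on hitg (J1.const_mul _) hms ?_
      rintro ⟨θ, ρ⟩ ⟨-, hr⟩
      simp only at hr
      have q0 : 0 < ρ := lt_of_lt_of_le ha hr.1
      have q1 : ρ < 1 := lt_of_le_of_lt hr.2 hd
      simp only [G]
      rw [coneLap_sub (K * (t - t0)) (S.cx t htT) φc q0 q1 t]
      have hL := φL ρ hr θ t
      have hp := S.pde ρ θ t q0 q1 htT
      have hu := S.ub ρ θ t q0 q1 htT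
      have hf := (abs_le.1 (S.fb ρ θ t q0 q1 htT)).2
      change dtime T (fun s => u ρ θ s) t = exp (-c * u ρ θ t) *
        coneLapT β (fun ρ θ _ => u ρ θ t) ρ θ t + f ρ θ t at hp
      generalize coneLapT β (fun ρ θ _ => u ρ θ t) ρ θ t = LU at hp ⊢
      generalize coneLapT β (fun ρ θ _ => φ ρ θ) ρ θ t = LP at hL ⊢
      generalize dtime T (fun s => u ρ θ s) t = v at hp ⊢
      have hh0 : 0 ≤ (max (u ρ θ t - φ ρ θ - K * (t - t0)) 0) ^ 2 := by positivity
      generalize (max (u ρ θ t - φ ρ θ - K * (t - t0)) 0) ^ 2 = h at hh0 ⊢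
      have e1 : exp (c * (u ρ θ t - K * (t - t0))) =
          exp (c * u ρ θ t) * exp (-c * K * (t - t0)) := by
        rw [← exp_add]; congr 1; ring
      have e2 : exp (c * u ρ θ t) * exp (-c * u ρ θ t) = 1 := by
        rw [← exp_add]; simp
      have e3 : exp (-c * u ρ θ t) ≤ exp (|c| * C) := by
        apply exp_le_exp.2
        calc -c * u ρ θ t ≤ |-c * u ρ θ t| := le_abs_self _
          _ = |c| * |u ρ θ t| := by rw [abs_mul, abs_neg]
          _ ≤ |c| * C := mul_le_mul_of_nonneg_left hu (abs_nonneg c)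
      have e4 : exp (-c * u ρ θ t) * LP ≤ exp (|c| * C) * M :=
        (mul_le_mul_of_nonneg_left hL (exp_pos _).le).trans (mul_le_mul_of_nonneg_right e3 hM)
      have e5 : v - K ≤ exp (-c * u ρ θ t) * (LU - LP) := by
        rw [hp, hK, mul_sub]; linarith
      have e6 := mul_le_mul_of_nonneg_left e5 (exp_pos (c * u ρ θ t)).le
      rw [← mul_assoc, e2, one_mul] at e6
      have e7 : 0 ≤ ρ * h * exp (-c * K * (t - t0)) := by positivity
      have e8 := mul_le_mul_of_nonneg_left e6 e7
      rw [e1]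
      linarith
    refine hle.trans ?_
    rw [integral_const_mul]
    exact mul_nonpos_of_nonneg_of_nonpos (exp_pos _).le J2
  -- step B
  have intG : Integrable (Function.uncurry G) ((volume.restrict (Ioo t0 t1)).prod
      ((volume : Measure (ℝ × ℝ)).restrict (Icc 0 (2 * π) ×ˢ Icc a d))) := by
    have : IsFiniteMeasure ((volume : Measure (ℝ × ℝ)).restrict (Icc 0 (2 * π) ×ˢ Icc a d)) :=
      isFiniteMeasure_restrict.2 hcpt.measure_lt_top.ne
    have : IsFiniteMeasure ((volume : Measure ℝ).restrict (Ioo t0 t1)) :=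
      isFiniteMeasure_restrict.2 (by simp)
    obtain ⟨mu, mv⟩ := S.meas ha had hd h0 h01 h1
    have mφ : AEMeasurable (fun p : ℝ × ℝ × ℝ => φ p.2.2 p.2.1) ((volume.restrict (Ioo t0 t1)).prod
      ((volume : Measure (ℝ × ℝ)).restrict (Icc 0 (2 * π) ×ˢ Icc a d))) :=
      ((hφc.aestronglyMeasurable (μ := volume) hms).comp_snd).aemeasurable
    obtain ⟨Bφ, hBφ⟩ := hcpt.exists_bound_of_continuousOn hφc
    have i2 := S.v2 ha had hd h0 h01 h1
    have ig : Integrable (fun p : ℝ × ℝ × ℝ => exp (|c| * (C + K * (t1 - t0))) * (C + Bφ) ^ 2 *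
      ((1 + K) + ((β + 1) * a)⁻¹ * ((dtime T (fun s => u p.2.2 p.2.1 s) p.1) ^ 2
      * ((β + 1) * p.2.2)))) ((volume.restrict (Ioo t0 t1)).prod
      ((volume : Measure (ℝ × ℝ)).restrict (Icc 0 (2 * π) ×ˢ Icc a d))) :=
      ((integrable_const (1 + K)).add (i2.const_mul _)).const_mul _
    refine ig.mono' ?_ ?_
    · have mt : AEMeasurable (fun p : ℝ × ℝ × ℝ => K * (p.1 - t0)) ((volume.restrict (Ioo t0 t1)).prod
        ((volume : Measure (ℝ × ℝ)).restrict (Icc 0 (2 * π) ×ˢ Icc a d))) :=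
        (by fun_prop : Measurable (fun p : ℝ × ℝ × ℝ => K * (p.1 - t0))).aemeasurable
      have mr : AEMeasurable (fun p : ℝ × ℝ × ℝ => p.2.2) ((volume.restrict (Ioo t0 t1)).prod
        ((volume : Measure (ℝ × ℝ)).restrict (Icc 0 (2 * π) ×ˢ Icc a d))) :=
        (by fun_prop : Measurable (fun p : ℝ × ℝ × ℝ => p.2.2)).aemeasurable
      have m1 := measurable_exp.comp_aemeasurable ((mu.sub mt).const_mul c)
      have m2 := (((mu.sub mφ).sub mt).max (aemeasurable_const (b := (0:ℝ)))).pow_const 2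
      exact (mr.mul ((m1.mul m2).mul (mv.sub_const K))).aestronglyMeasurable
    · filter_upwards [hae] with p hp
      obtain ⟨t, θ, ρ⟩ := p
      obtain ⟨ht, hx⟩ := hp
      have hr : ρ ∈ Icc a d := hx.2
      have q0 : 0 < ρ := lt_of_lt_of_le ha hr.1
      have q1 : ρ < 1 := lt_of_le_of_lt hr.2 hd
      simp only [] at ht
      have hu := S.ub ρ θ t q0 q1 (mT t ⟨ht.1.le, ht.2.le⟩)
      have hφ : |φ ρ θ| ≤ Bφ := hBφ (θ, ρ) hx
      simp only [Function.uncurry, G]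
      have hk0 : 0 ≤ K * (t - t0) := mul_nonneg hK0 (by linarith [ht.1])
      have hk1 : K * (t - t0) ≤ K * (t1 - t0) := mul_le_mul_of_nonneg_left (by linarith [ht.2]) hK0
      have b1 : exp (c * (u ρ θ t - K * (t - t0))) ≤ exp (|c| * (C + K * (t1 - t0))) := by
        apply exp_le_exp.2
        refine (le_abs_self _).trans ?_
        rw [abs_mul]
        refine mul_le_mul_of_nonneg_left ?_ (abs_nonneg c)
        refine (abs_sub _ _).trans ?_
        rw [abs_of_nonneg hk0]
        linarith
      have b2 : (max (u ρ θ t - φ ρ θ - K * (t - t0)) 0) ^ 2 ≤ (C + Bφ) ^ 2 := by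
        refine pow_le_pow_left₀ (le_max_right _ _) (max_le ?_ ?_) 2
        · have := (abs_le.1 hu).2
          have := (abs_le.1 hφ).1
          linarith
        · have := abs_nonneg (u ρ θ t)
          have := abs_nonneg (φ ρ θ)
          linarith
      have hb := S.hb
      generalize dtime T (fun s => u ρ θ s) t = v
      have b3 : |v - K| ≤ (1 + K) + ((β + 1) * a)⁻¹ * (v ^ 2 * ((β + 1) * ρ)) := by
        have z1 : v ^ 2 ≤ ((β + 1) * a)⁻¹ * (v ^ 2 * ((β + 1) * ρ)) := by
          have : ((β + 1) * a)⁻¹ * (v ^ 2 * ((β + 1) * ρ)) = v ^ 2 * (ρ / a) := by field_simp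
          rw [this]
          exact le_mul_of_one_le_right (sq_nonneg v) ((one_le_div ha).2 hr.1)
        have z2 : |v| ≤ 1 + v ^ 2 := by
          rw [← sq_abs v]
          nlinarith [sq_nonneg (|v| - 1), abs_nonneg v]
        refine (abs_sub _ _).trans ?_
        rw [abs_of_nonneg hK0]
        linarith
      rw [norm_eq_abs, abs_mul, abs_mul, abs_mul, abs_of_pos q0, abs_of_pos (exp_pos _),
        abs_of_nonneg (sq_nonneg (max _ _))]
      have b4 : exp (c * (u ρ θ t - K * (t - t0))) * (max (u ρ θ t - φ ρ θ - K * (t - t0)) 0) ^ 2 ≤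
        exp (|c| * (C + K * (t1 - t0))) * (C + Bφ) ^ 2 :=
        mul_le_mul b1 b2 (sq_nonneg _) (exp_pos _).le
      have b5 := mul_le_mul b4 b3 (abs_nonneg _) (by positivity)
      refine le_trans ?_ b5
      exact mul_le_of_le_one_left (by positivity) q1.le
  have swap := integral_integral_swap intG
  have inner : ∀ x ∈ Icc 0 (2 * π) ×ˢ Icc a d, ∫ t in Ioo t0 t1, G t x = x.2 * E t1 x := by
    rintro ⟨θ, ρ⟩ hx
    have hr : ρ ∈ Icc a d := hx.2
    have q0 : 0 < ρ := lt_of_lt_of_le ha hr.1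
    have q1 : ρ < 1 := lt_of_le_of_lt hr.2 hd
    rw [← integral_Ioc_eq_integral_Ioo, ← intervalIntegral.integral_of_le h01.le]
    have cu : ContinuousOn (fun t => u ρ θ t) (Icc t0 t1) :=
      (S.ct ρ θ q0 q1).continuousOn.mono mT
    have cv := (S.vcont (θ := θ) q0 q1).mono mT
    have ck : ContinuousOn (fun t : ℝ => K * (t - t0)) (Icc t0 t1) := by fun_prop
    have cG : ContinuousOn (fun t => G t (θ, ρ)) (Icc t0 t1) := by
      simp only [G]
      refine continuousOn_const.mul (((ContinuousOn.rexp ?_).mul ?_).mul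
        (cv.sub continuousOn_const))
      · exact continuousOn_const.mul (cu.sub ck)
      · exact (((cu.sub continuousOn_const).sub ck).sup continuousOn_const).pow 2
    rw [intervalIntegral.integral_eq_sub_of_hasDerivAt_of_le (f := fun t => ρ * E t (θ, ρ)) h01.le
      ?_ ?_ (cG.intervalIntegrable_of_Icc h01.le)]
    · simp only [E]
      rw [Γz (u ρ θ t0 - φ ρ θ - K * (t0 - t0)) (by
        have := init ρ hr θ
        simp only [sub_self, mul_zero, sub_zero]
        linarith)]
      simp
    · simp only [E]
      exact continuousOn_const.mul (continuousOn_const.mul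
        (Γc.comp_continuousOn ((cu.sub continuousOn_const).sub ck)))
    · intro t ht
      have hv := S.dA (θ := θ) q0 q1 (t := t) ⟨lt_of_le_of_lt h0 ht.1, lt_of_lt_of_le ht.2 h1⟩
      have hk : HasDerivAt (fun t : ℝ => K * (t - t0)) (K * 1) t :=
        ((hasDerivAt_id t).sub_const t0).const_mul K
      have h2 := (((Γd (u ρ θ t - φ ρ θ - K * (t - t0))).comp t
        ((hv.sub_const (φ ρ θ)).sub hk)).const_mul (exp (c * φ ρ θ))).const_mul ρ
      refine h2.congr_deriv ?_
      simp only [G]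
      have e1 : exp (c * (u ρ θ t - K * (t - t0))) =
        exp (c * φ ρ θ) * exp (c * (u ρ θ t - φ ρ θ - K * (t - t0))) := by
        rw [← exp_add]; congr 1; ring
      rw [e1]
      ring
  have hsum : ∫ x in Icc 0 (2 * π) ×ˢ Icc a d, x.2 * E t1 x ≤ 0 := by
    rw [← setIntegral_congr_fun hms inner, ← swap]
    exact setIntegral_nonpos measurableSet_Ioo stepA
  have cE : ContinuousOn (fun x : ℝ × ℝ => x.2 * E t1 x) (Icc 0 (2 * π) ×ˢ Icc a d) := by
    have cu : ContinuousOn (fun x : ℝ × ℝ => u x.2 x.1 t1) (Icc 0 (2 * π) ×ˢ Icc a d) :=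
      (S.cx t1 (mT t1 ⟨h01.le, le_rfl⟩)).continuousOn.comp csw hmap
    exact continuousOn_snd.mul ((continuousOn_const.mul hφc).rexp.mul
      (Γc.comp_continuousOn ((cu.sub hφc).sub continuousOn_const)))
  have hnn : ∀ x ∈ Icc 0 (2 * π) ×ˢ Icc a d, 0 ≤ x.2 * E t1 x := by
    intro x hx
    exact mul_nonneg (ha.le.trans hx.2.1) (mul_nonneg (exp_pos _).le (Γ0 _))
  have hz : ∫ x in Icc 0 (2 * π) ×ˢ Icc a d, x.2 * E t1 x = 0 :=
    le_antisymm hsum (setIntegral_nonneg hms hnn)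
  have hz2 := (setIntegral_eq_zero_iff_of_nonneg_ae ((ae_restrict_iff' hms).2
    (Filter.Eventually.of_forall hnn)) (cE.integrableOn_compact hcpt)).1 hz
  have hz3 := Measure.eqOn_of_ae_eq hz2 cE continuousOn_const (by
    rw [interior_prod_eq, closure_prod_eq, interior_Icc, interior_Icc,
      closure_Ioo (by positivity), closure_Ioo had.ne])
  have fin : ∀ ρ ∈ Icc a d, ∀ θ ∈ Icc 0 (2 * π), u ρ θ t1 ≤ φ ρ θ + K * (t1 - t0) := by
    intro ρ hr θ hθ
    by_contra hcon
    push Not at hcon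
    have h3 := hz3 (show (θ, ρ) ∈ Icc 0 (2 * π) ×ˢ Icc a d from ⟨hθ, hr⟩)
    have hp := Γp (u ρ θ t1 - φ ρ θ - K * (t1 - t0)) (by linarith)
    have q0 : 0 < ρ := lt_of_lt_of_le ha hr.1
    have : 0 < ρ * (exp (c * φ ρ θ) * Γ (u ρ θ t1 - φ ρ θ - K * (t1 - t0))) := by positivity
    simp only [E, Pi.zero_apply] at h3
    linarith
  intro ρ hr θ
  have P : Function.Periodic (fun θ => u ρ θ t1 - φ ρ θ) (2 * π) := fun θ => by
    simp only [S.per, φper]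
  obtain ⟨y, hy, hy2⟩ := P.exists_mem_Ico₀ (by positivity) θ
  have := fin ρ hr y ⟨hy.1, hy.2.le⟩
  linarith

theorem barrier {β c C T : ℝ} {u f : ℝ → ℝ → ℝ → ℝ} (S : Sol β c C T u f)
    {ρ0 θ0 δ m K1 K2 t0 t1 : ℝ} (hδ : 0 < δ) (hl : 0 < ρ0 - δ) (hr : ρ0 + δ < 1)
    (hK1 : 0 ≤ K1) (hK2 : 0 ≤ K2) (hm : C ≤ m + K1 * δ ^ 2) (h0 : 0 ≤ t0) (h01 : t0 ≤ t1)
    (h1 : t1 ≤ T)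
    (init : ∀ ρ ∈ Icc (ρ0 - δ) (ρ0 + δ), ∀ θ,
      u ρ θ t0 ≤ m + K1 * (ρ - ρ0) ^ 2 + K2 * (1 - cos (θ - θ0))) :
    ∀ ρ ∈ Icc (ρ0 - δ) (ρ0 + δ), ∀ θ,
      u ρ θ t1 ≤ m + K1 * (ρ - ρ0) ^ 2 + K2 * (1 - cos (θ - θ0)) +
        (C + exp (|c| * C) * (4 * K1 + K2 * (((β + 1) ^ 2)⁻¹ * ((ρ0 - δ) ^ 2)⁻¹))) * (t1 - t0) := by
  rcases h01.eq_or_lt with h | h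
  · subst h
    simpa using init
  have hb := S.hb
  have hcos : ∀ x : ℝ, 0 ≤ K2 * (1 - cos x) := fun x =>
    mul_nonneg hK2 (by linarith [cos_le_one x])
  have hc : ContDiff ℝ 2 (fun p : ℝ × ℝ => m + K1 * (p.1 - ρ0) ^ 2 + K2 * (1 - cos (p.2 - θ0))) := by
    fun_prop
  have H : ∀ r θ : ℝ, 0 < r → r < 1 →
        HasDerivAt (fun x => m + K1 * (x - ρ0) ^ 2 + K2 * (1 - cos (θ - θ0)))
          ((fun p : ℝ × ℝ => 2 * K1 * (p.1 - ρ0)) (r, θ)) r ∧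
        HasDerivAt (fun x => (fun p : ℝ × ℝ => 2 * K1 * (p.1 - ρ0)) (x, θ))
          ((fun _ : ℝ × ℝ => 2 * K1) (r, θ)) r ∧
        HasDerivAt (fun x => m + K1 * (r - ρ0) ^ 2 + K2 * (1 - cos (x - θ0)))
          ((fun p : ℝ × ℝ => K2 * sin (p.2 - θ0)) (r, θ)) θ ∧
        HasDerivAt (fun x => (fun p : ℝ × ℝ => K2 * sin (p.2 - θ0)) (r, x))
          ((fun p : ℝ × ℝ => K2 * cos (p.2 - θ0)) (r, θ)) θ := by
    intro r θ _ _
    have d1 : HasDerivAt (fun x : ℝ => x - ρ0) 1 r := (hasDerivAt_id r).sub_const ρ0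
    have d2 : HasDerivAt (fun x : ℝ => x - θ0) 1 θ := (hasDerivAt_id θ).sub_const θ0
    refine ⟨?_, ?_, ?_, ?_⟩
    · refine ((((d1.pow 2).const_mul K1).const_add m).add_const _).congr_deriv ?_
      simp; ring
    · refine (d1.const_mul (2 * K1)).congr_deriv ?_
      simp
    · refine (((d2.cos.const_sub 1).const_mul K2).const_add _).congr_deriv ?_
      simp
    · refine (d2.sin.const_mul K2).congr_deriv ?_
      simp
  refine weakmax S hl (by linarith) hr h0 h h1 (by positivity)
    (φ := fun ρ θ => m + K1 * (ρ - ρ0) ^ 2 + K2 * (1 - cos (θ - θ0))) hc.contDiffOn ?_ ?_ ?_ ?_ init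
  · intro ρ θ
    have : θ + 2 * π - θ0 = (θ - θ0) + 2 * π := by ring
    simp only [this, cos_add_two_pi]
  · intro θ
    have := hcos (θ - θ0)
    have e : (ρ0 - δ - ρ0) ^ 2 = δ ^ 2 := by ring
    simp only [e]
    linarith
  · intro θ
    have := hcos (θ - θ0)
    have e : (ρ0 + δ - ρ0) ^ 2 = δ ^ 2 := by ring
    simp only [e]
    linarith
  · intro ρ hρ θ t
    have q0 : 0 < ρ := lt_of_lt_of_le hl hρ.1
    have q1 : ρ < 1 := lt_of_le_of_lt hρ.2 hr
    rw [coneLap_eq (W := fun ρ θ => m + K1 * (ρ - ρ0) ^ 2 + K2 * (1 - cos (θ - θ0)))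
      (Wr := fun p : ℝ × ℝ => 2 * K1 * (p.1 - ρ0)) (Wrr := fun _ : ℝ × ℝ => 2 * K1)
      (Wt := fun p : ℝ × ℝ => K2 * sin (p.2 - θ0)) (Wtt := fun p : ℝ × ℝ => K2 * cos (p.2 - θ0))
      H q0 q1]
    have a1 : ρ⁻¹ * (2 * K1 * (ρ - ρ0)) ≤ 2 * K1 := by
      have : ρ⁻¹ * (ρ - ρ0) ≤ 1 := by
        rw [inv_mul_le_iff₀ q0]; linarith
      calc ρ⁻¹ * (2 * K1 * (ρ - ρ0)) = 2 * K1 * (ρ⁻¹ * (ρ - ρ0)) := by ring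
        _ ≤ 2 * K1 * 1 := mul_le_mul_of_nonneg_left this (by linarith)
        _ = 2 * K1 := by ring
    have a2 : (ρ ^ 2)⁻¹ ≤ ((ρ0 - δ) ^ 2)⁻¹ := by
      apply inv_anti₀ (by positivity)
      exact pow_le_pow_left₀ hl.le hρ.1 2
    have a3 : K2 * cos (θ - θ0) ≤ K2 := mul_le_of_le_one_right hK2 (cos_le_one _)
    have a4 : ((β + 1) ^ 2)⁻¹ * (ρ ^ 2)⁻¹ * (K2 * cos (θ - θ0)) ≤
      ((β + 1) ^ 2)⁻¹ * ((ρ0 - δ) ^ 2)⁻¹ * K2 := by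
      refine (mul_le_mul_of_nonneg_left a3 (by positivity)).trans ?_
      refine mul_le_mul_of_nonneg_right ?_ hK2
      exact mul_le_mul_of_nonneg_left a2 (by positivity)
    linarith

theorem Sol.usc {β c C T : ℝ} {u f : ℝ → ℝ → ℝ → ℝ} (S : Sol β c C T u f)
    {ρ0 θ0 t0 : ℝ} (hl : 0 < ρ0) (hr : ρ0 < 1) (h0 : t0 ∈ Icc 0 T) {ε : ℝ} (hε : 0 < ε) :
    ∀ᶠ q : ℝ × ℝ × ℝ in nhds (ρ0, θ0, t0), q.2.2 ∈ Icc t0 T →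
      u q.1 q.2.1 q.2.2 ≤ u ρ0 θ0 t0 + ε := by
  have hC := S.hC
  have hcx : ContinuousAt (fun p : ℝ × ℝ => u p.1 p.2 t0) (ρ0, θ0) :=
    (S.cx t0 h0).continuousOn.continuousAt (strip_open.mem_nhds ⟨hl, hr⟩)
  obtain ⟨δ1, hδ1, hδ2⟩ := Metric.eventually_nhds_iff.1
    (hcx.eventually (gt_mem_nhds (show u ρ0 θ0 t0 < u ρ0 θ0 t0 + ε / 2 by linarith)))
  obtain ⟨δ, hδ0, d1, d2, d3, d4⟩ : ∃ δ, 0 < δ ∧ δ < δ1 ∧ δ < ρ0 ∧ δ < 1 - ρ0 ∧ δ < 1 := by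
    refine ⟨min (min δ1 ρ0) (min (1 - ρ0) 1) / 2, ?_, ?_⟩
    · have : 0 < min (min δ1 ρ0) (min (1 - ρ0) 1) :=
        lt_min (lt_min hδ1 hl) (lt_min (by linarith) one_pos)
      linarith
    · have p1 : 0 < min (min δ1 ρ0) (min (1 - ρ0) 1) :=
        lt_min (lt_min hδ1 hl) (lt_min (by linarith) one_pos)
      have p2 := min_le_left (min δ1 ρ0) (min (1 - ρ0) 1)
      have p3 := min_le_right (min δ1 ρ0) (min (1 - ρ0) 1)
      have p4 := min_le_left δ1 ρ0
      have p5 := min_le_right δ1 ρ0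
      have p6 := min_le_left (1 - ρ0) 1
      have p7 := min_le_right (1 - ρ0) 1
      refine ⟨?_, ?_, ?_, ?_⟩ <;> linarith
  have hπ := pi_gt_three
  have hcd : cos δ < 1 := by
    have := cos_lt_cos_of_nonneg_of_le_pi le_rfl (by linarith : δ ≤ π) hδ0
    rwa [cos_zero] at this
  have hu0 := abs_le.1 (S.ub ρ0 θ0 t0 hl hr h0)
  have hK1 : 0 ≤ 2 * C / δ ^ 2 := by positivity
  have hK2 : 0 ≤ 2 * C / (1 - cos δ) := div_nonneg (by linarith) (by linarith)
  have e1 : 2 * C / δ ^ 2 * δ ^ 2 = 2 * C := by field_simp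
  have init : ∀ ρ ∈ Icc (ρ0 - δ) (ρ0 + δ), ∀ θ,
      u ρ θ t0 ≤ (u ρ0 θ0 t0 + ε / 2) + 2 * C / δ ^ 2 * (ρ - ρ0) ^ 2
        + 2 * C / (1 - cos δ) * (1 - cos (θ - θ0)) := by
    intro ρ hρ θ
    have q0 : 0 < ρ := by linarith [hρ.1]
    have q1 : ρ < 1 := by linarith [hρ.2]
    have P : Function.Periodic (fun θ => u ρ θ t0 - 2 * C / (1 - cos δ) * (1 - cos (θ - θ0)))
        (2 * π) := fun θ => by
      have : θ + 2 * π - θ0 = (θ - θ0) + 2 * π := by ring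
      simp only [S.per, this, cos_add_two_pi]
    obtain ⟨y, hy, hy2⟩ := P.exists_mem_Ico (by positivity) θ (θ0 - π)
    have key : u ρ y t0 ≤ (u ρ0 θ0 t0 + ε / 2) + 2 * C / δ ^ 2 * (ρ - ρ0) ^ 2
        + 2 * C / (1 - cos δ) * (1 - cos (y - θ0)) := by
      have n1 : 0 ≤ 2 * C / δ ^ 2 * (ρ - ρ0) ^ 2 := by positivity
      have n2 : 0 ≤ 2 * C / (1 - cos δ) * (1 - cos (y - θ0)) :=
        mul_nonneg hK2 (by linarith [cos_le_one (y - θ0)])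
      rcases le_or_gt |y - θ0| δ with hle | hgt
      · have := hδ2 (y := (ρ, y)) (by
          rw [Prod.dist_eq]
          refine max_lt ?_ ?_
          · rw [Real.dist_eq]
            exact lt_of_le_of_lt (abs_le.2 ⟨by linarith [hρ.1], by linarith [hρ.2]⟩) d1
          · rw [Real.dist_eq]
            exact lt_of_le_of_lt hle d1)
        simp only at this
        linarith
      · have hle : cos (y - θ0) ≤ cos δ := by
          rw [← cos_abs (y - θ0)]
          exact cos_le_cos_of_nonneg_of_le_pi hδ0.le
            (abs_le.2 ⟨by linarith [hy.1], by linarith [hy.2]⟩) hgt.le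
        have n3 : 2 * C ≤ 2 * C / (1 - cos δ) * (1 - cos (y - θ0)) := by
          rw [div_mul_eq_mul_div, le_div_iff₀ (by linarith)]
          exact mul_le_mul_of_nonneg_left (by linarith) (by linarith)
        have := (abs_le.1 (S.ub ρ y t0 q0 q1 h0)).2
        linarith
    linarith
  have B := fun t1 (h01 : t0 ≤ t1) (h1 : t1 ≤ T) =>
    barrier S hδ0 (by linarith) (by linarith) hK1 hK2 (by linarith) h0.1 h01 h1 init
  generalize (C + exp (|c| * C) * (4 * (2 * C / δ ^ 2) +
    2 * C / (1 - cos δ) * (((β + 1) ^ 2)⁻¹ * ((ρ0 - δ) ^ 2)⁻¹))) = K at B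
  generalize 2 * C / δ ^ 2 = K1 at B
  generalize 2 * C / (1 - cos δ) = K2 at B
  have hcont : Continuous (fun q : ℝ × ℝ × ℝ => u ρ0 θ0 t0 + ε / 2 + K1 * (q.1 - ρ0) ^ 2 +
    K2 * (1 - cos (q.2.1 - θ0)) + K * (q.2.2 - t0)) := by fun_prop
  have hev : ∀ᶠ q : ℝ × ℝ × ℝ in nhds (ρ0, θ0, t0), u ρ0 θ0 t0 + ε / 2 + K1 * (q.1 - ρ0) ^ 2 +
      K2 * (1 - cos (q.2.1 - θ0)) + K * (q.2.2 - t0) < u ρ0 θ0 t0 + ε := by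
    have hca : ContinuousAt (fun q : ℝ × ℝ × ℝ => u ρ0 θ0 t0 + ε / 2 + K1 * (q.1 - ρ0) ^ 2 +
      K2 * (1 - cos (q.2.1 - θ0)) + K * (q.2.2 - t0)) (ρ0, θ0, t0) := hcont.continuousAt
    refine hca.eventually_lt_const ?_
    simp only [sub_self, cos_zero, mul_zero, add_zero]
    norm_num
    linarith
  have hev2 : ∀ᶠ q : ℝ × ℝ × ℝ in nhds (ρ0, θ0, t0), q.1 ∈ Icc (ρ0 - δ) (ρ0 + δ) := by
    have hca : ContinuousAt (fun q : ℝ × ℝ × ℝ => q.1) (ρ0, θ0, t0) := continuous_fst.continuousAt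
    exact hca.preimage_mem_nhds (Icc_mem_nhds (by simp only; linarith) (by simp only; linarith))
  filter_upwards [hev, hev2] with q hq1 hq2 hq3
  exact (B q.2.2 hq3.1 hq3.2 q.1 hq2 q.2.1).trans hq1.le

theorem Sol.rc {β c C T : ℝ} {u f : ℝ → ℝ → ℝ → ℝ} (S : Sol β c C T u f)
    {ρ0 θ0 t0 : ℝ} (hl : 0 < ρ0) (hr : ρ0 < 1) (h0 : t0 ∈ Icc 0 T) :
    ContinuousWithinAt (fun q : ℝ × ℝ × ℝ => u q.1 q.2.1 q.2.2) {q | q.2.2 ∈ Icc t0 T}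
      (ρ0, θ0, t0) := by
  rw [ContinuousWithinAt, Metric.tendsto_nhds]
  intro ε hε
  filter_upwards [nhdsWithin_le_nhds (S.usc (θ0 := θ0) hl hr h0 (half_pos hε)),
    nhdsWithin_le_nhds (S.neg.usc (θ0 := θ0) hl hr h0 (half_pos hε)), self_mem_nhdsWithin]
    with q h1 h2 h3
  have a1 := h1 h3
  have a2 := h2 h3
  rw [Real.dist_eq]
  refine lt_of_le_of_lt (abs_le.2 ⟨?_, ?_⟩) (half_lt_self hε) <;> linarith

/-- The conclusion of `Phi_key` for given constants. -/
def PhiKey (b C k α κ c0 : ℝ) : Prop :=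
    ∀ s1 θ1 s2 θ2 u1 u2 : ℝ, s1 ≤ 0 → s2 ≤ 0 → |u1| ≤ C → |u2| ≤ C → 0 < Rf s1 θ1 s2 θ2 →
    ∃ p1 n1 p2 n2 p1' n1' p2' n2' a A a' A' : ℝ,
      p1 ^ 2 + p1' ^ 2 = (exp (-u1 - b * s1) / b) ^ 2 ∧
      n1 ^ 2 + n1' ^ 2 = (exp (-u1 - b * s1) / b) ^ 2 ∧ p1 * n1 + p1' * n1' = 0 ∧
      p2 ^ 2 + p2' ^ 2 = (exp (-u2 - b * s2) / b) ^ 2 ∧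
      n2 ^ 2 + n2' ^ 2 = (exp (-u2 - b * s2) / b) ^ 2 ∧ p2 * n2 + p2' * n2' = 0 ∧
      D2 (fun τ => Phi k α κ (s1 + τ * p1) (θ1 + τ * n1) (s2 + τ * p2) (θ2 + τ * n2)) a A ∧
      D2 (fun τ => Phi k α κ (s1 + τ * p1') (θ1 + τ * n1') (s2 + τ * p2') (θ2 + τ * n2')) a' A' ∧
      A + A' ≤ -c0

/-- cut-off function -/
noncomputable def psi (sa ℓ s : ℝ) : ℝ := (max ((s - sa) / ℓ) 0) ^ 3

theorem psi_D2 (sa ℓ s p : ℝ) : ∃ a, D2 (fun τ => psi sa ℓ (s + τ * p)) a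
    ((6 * max ((s - sa) / ℓ) 0 / ℓ ^ 2) * p ^ 2) := by
  have h1 : D2 (fun τ => (s - sa) / ℓ + τ * (p / ℓ)) (p / ℓ) 0 := D2.affine _ _
  have h2 := h1.comp (y := (s - sa) / ℓ) (by simp) (F := fun x : ℝ => (max x 0) ^ 3)
    (F' := fun x : ℝ => 3 * (max x 0) ^ 2) (F2 := 6 * max ((s - sa) / ℓ) 0)
    (Filter.Eventually.of_forall fun x => by
      have := posPow_hasDerivAt 1 x
      norm_num at this
      exact this)
    (by
      have := (posPow_hasDerivAt 0 ((s - sa) / ℓ)).const_mul 3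
      norm_num at this
      refine this.congr_deriv ?_
      ring)
  refine ⟨_, (h2.congr ?_).of_eq rfl ?_⟩
  · filter_upwards with τ
    unfold psi
    congr 2
    ring
  · rw [div_pow]; ring

/-- the doubled function -/
noncomputable def FF (u : ℝ → ℝ → ℝ → ℝ) (b k α κ L N sa ℓ r ε tm s1 θ1 s2 θ2 t : ℝ) : ℝ :=
  u (exp (b * s1)) θ1 t - u (exp (b * s2)) θ2 t - L * Phi k α κ s1 θ1 s2 θ2
    - N * (psi sa ℓ s1 + psi sa ℓ s2) - N / r * (tm - t) + ε * (s1 + s2)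

theorem max_ineq {β C T : ℝ} {u f : ℝ → ℝ → ℝ → ℝ} (S : Sol β 2 C T u f)
    {k α κ c0 : ℝ} (HK : PhiKey (β + 1) C k α κ c0)
    {L N sa ℓ r ε tm s1 θ1 s2 θ2 t Cψ : ℝ} (hL : 0 ≤ L) (hN : 0 ≤ N)
    (hs1 : s1 < 0) (hs2 : s2 < 0) (ht : t ∈ Icc 0 T) (hR : 0 < Rf s1 θ1 s2 θ2)
    (hψ1 : (6 * max ((s1 - sa) / ℓ) 0 / ℓ ^ 2)
      * (exp (-u (exp ((β + 1) * s1)) θ1 t - (β + 1) * s1) / (β + 1)) ^ 2 ≤ Cψ)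
    (hψ2 : (6 * max ((s2 - sa) / ℓ) 0 / ℓ ^ 2)
      * (exp (-u (exp ((β + 1) * s2)) θ2 t - (β + 1) * s2) / (β + 1)) ^ 2 ≤ Cψ)
    (hmax : ∀ p1 n1 p2 n2 : ℝ, IsLocalMax (fun τ => FF u (β + 1) k α κ L N sa ℓ r ε tm
      (s1 + τ * p1) (θ1 + τ * n1) (s2 + τ * p2) (θ2 + τ * n2) t) 0) :
    dtime T (fun s => u (exp ((β + 1) * s1)) θ1 s) t
      - dtime T (fun s => u (exp ((β + 1) * s2)) θ2 s) t ≤ - L * c0 + 2 * N * Cψ + 2 * C := by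
  have hb := S.hb
  have hr : ∀ s, s < 0 → 0 < exp ((β + 1) * s) ∧ exp ((β + 1) * s) < 1 := fun s hs =>
    ⟨exp_pos _, by rw [exp_lt_one_iff]; exact mul_neg_of_pos_of_neg hb hs⟩
  have hr1 := hr s1 hs1
  have hr2 := hr s2 hs2
  obtain ⟨p1, n1, p2, n2, p1', n1', p2', n2', a, A, a', A', e1, e2, e3, e4, e5, e6, dA, dA', hA⟩ :=
    HK s1 θ1 s2 θ2 (u (exp ((β + 1) * s1)) θ1 t) (u (exp ((β + 1) * s2)) θ2 t) hs1.le hs2.le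
      (S.ub _ _ _ hr1.1 hr1.2 ht) (S.ub _ _ _ hr2.1 hr2.2 ht) hR
  obtain ⟨H11, H12, H22, HH, Htr⟩ := lap_lines S (s := s1) (θ := θ1) hs1 ht
  obtain ⟨G11, G12, G22, GG, Gtr⟩ := lap_lines S (s := s2) (θ := θ2) hs2 ht
  have dir : ∀ p1 n1 p2 n2 a A : ℝ,
      D2 (fun τ => Phi k α κ (s1 + τ * p1) (θ1 + τ * n1) (s2 + τ * p2) (θ2 + τ * n2)) a A →
      (H11 * p1 ^ 2 + H12 * (p1 * n1) + H22 * n1 ^ 2) - (G11 * p2 ^ 2 + G12 * (p2 * n2) + G22 * n2 ^ 2)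
      - L * A - N * ((6 * max ((s1 - sa) / ℓ) 0 / ℓ ^ 2) * p1 ^ 2 +
        (6 * max ((s2 - sa) / ℓ) 0 / ℓ ^ 2) * p2 ^ 2) ≤ 0 := by
    intro p1 n1 p2 n2 a A hD
    obtain ⟨a1, h1⟩ := HH p1 n1
    obtain ⟨a2, h2⟩ := GG p2 n2
    obtain ⟨a3, h3⟩ := psi_D2 sa ℓ s1 p1
    obtain ⟨a4, h4⟩ := psi_D2 sa ℓ s2 p2
    have h5 : D2 (fun τ => N / r * (tm - t) + τ * 0) 0 0 := D2.affine _ _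
    have h6 := ((D2.affine s1 p1).add (D2.affine s2 p2)).const_mul ε
    have h7 := (((((h1.sub h2).sub (hD.const_mul L)).sub ((h3.add h4).const_mul N)).sub h5).add h6)
    have h8 := (h7.congr (g := fun τ => FF u (β + 1) k α κ L N sa ℓ r ε tm
      (s1 + τ * p1) (θ1 + τ * n1) (s2 + τ * p2) (θ2 + τ * n2) t)
      (Filter.Eventually.of_forall fun τ => by simp [FF])).nonpos (hmax p1 n1 p2 n2)
    linarith
  have i1 := dir p1 n1 p2 n2 a A dA
  have i2 := dir p1' n1' p2' n2' a' A' dA'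
  have hsq : ∀ s v : ℝ, (exp (-v - (β + 1) * s) / (β + 1)) ^ 2 *
      ((β + 1) ^ 2 * exp ((β + 1) * s) ^ 2) = exp (-2 * v) := by
    intro s v
    have : exp (-2 * v) = (exp (-v - (β + 1) * s) * exp ((β + 1) * s)) ^ 2 := by
      rw [← exp_add, ← exp_nat_mul]; congr 1; push_cast; ring
    rw [this]
    field_simp
  have pde1 := S.pde _ θ1 t hr1.1 hr1.2 ht
  have pde2 := S.pde _ θ2 t hr2.1 hr2.2 ht
  have f1 := abs_le.1 (S.fb _ θ1 t hr1.1 hr1.2 ht)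
  have f2 := abs_le.1 (S.fb _ θ2 t hr2.1 hr2.2 ht)
  rw [← hsq s1, mul_assoc, ← Htr] at pde1
  rw [← hsq s2, mul_assoc, ← Gtr] at pde2
  rw [pde1, pde2]
  generalize (exp (-u (exp ((β + 1) * s1)) θ1 t - (β + 1) * s1) / (β + 1)) ^ 2 = q1 at *
  generalize (exp (-u (exp ((β + 1) * s2)) θ2 t - (β + 1) * s2) / (β + 1)) ^ 2 = q2 at *
  generalize 6 * max ((s1 - sa) / ℓ) 0 / ℓ ^ 2 = w1 at *
  generalize 6 * max ((s2 - sa) / ℓ) 0 / ℓ ^ 2 = w2 at *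
  have j1 : (H11 * p1 ^ 2 + H12 * (p1 * n1) + H22 * n1 ^ 2)
      + (H11 * p1' ^ 2 + H12 * (p1' * n1') + H22 * n1' ^ 2) = q1 * (H11 + H22) := by
    linear_combination H11 * e1 + H12 * e3 + H22 * e2
  have j2 : (G11 * p2 ^ 2 + G12 * (p2 * n2) + G22 * n2 ^ 2)
      + (G11 * p2' ^ 2 + G12 * (p2' * n2') + G22 * n2' ^ 2) = q2 * (G11 + G22) := by
    linear_combination G11 * e4 + G12 * e6 + G22 * e5
  have j3 : N * (w1 * p1 ^ 2 + w2 * p2 ^ 2) + N * (w1 * p1' ^ 2 + w2 * p2' ^ 2) =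
      N * (w1 * q1 + w2 * q2) := by
    linear_combination N * w1 * e1 + N * w2 * e4
  have j4 : N * (w1 * q1 + w2 * q2) ≤ N * (2 * Cψ) := mul_le_mul_of_nonneg_left (by linarith) hN
  have j5 : L * (A + A') ≤ L * (-c0) := mul_le_mul_of_nonneg_left hA hL
  linarith

theorem back_step {g : ℝ → ℝ} {D T t0 t : ℝ} (h : HasDerivWithinAt g D (Icc 0 T) t) (hD : D < 0)
    (h0 : 0 ≤ t0) (h1 : t0 < t) (h2 : t ≤ T) : ∃ t' ∈ Ico t0 t, g t < g t' := by
  have h3 : HasDerivWithinAt g D (Iio t) t := by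
    refine h.mono_of_mem_nhdsWithin ?_
    filter_upwards [Ioo_mem_nhdsLT h1] with x hx
    exact ⟨by linarith [hx.1], by linarith [hx.2]⟩
  have h4 := (hasDerivWithinAt_iff_tendsto_slope' (by simp)).1 h3
  have h5 := h4.eventually (gt_mem_nhds hD)
  obtain ⟨x, hx1, hx2⟩ := (h5.and (Ioo_mem_nhdsLT h1)).exists
  refine ⟨x, ⟨hx2.1.le, hx2.2⟩, ?_⟩
  rw [slope_def_field] at hx1
  have h6 : x - t < 0 := by linarith [hx2.2]
  by_contra hcon
  push Not at hcon
  have : 0 ≤ (g x - g t) / (x - t) := div_nonneg_of_nonpos (by linarith) h6.le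
  linarith

theorem Rf_per1 (s1 θ1 s2 θ2 : ℝ) : Rf s1 (θ1 + 2 * π) s2 θ2 = Rf s1 θ1 s2 θ2 := by
  unfold Rf; rw [cos_add_two_pi, sin_add_two_pi]

theorem Rf_per2 (s1 θ1 s2 θ2 : ℝ) : Rf s1 θ1 s2 (θ2 + 2 * π) = Rf s1 θ1 s2 θ2 := by
  unfold Rf; rw [cos_add_two_pi, sin_add_two_pi]

theorem Rf_zero {s1 θ1 s2 θ2 : ℝ} (h : ¬ 0 < Rf s1 θ1 s2 θ2) :
    s1 = s2 ∧ ∃ k : ℤ, θ1 = θ2 + k * (2 * π) := by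
  rw [Rf_eq] at h
  have h1 : 0 ≤ 2 * exp s1 * exp s2 * (1 - cos (θ1 - θ2)) :=
    mul_nonneg (by positivity) (by linarith [cos_le_one (θ1 - θ2)])
  have h2 := sq_nonneg (exp s1 - exp s2)
  have h3 : (exp s1 - exp s2) ^ 2 = 0 := by linarith
  have h4 : 2 * exp s1 * exp s2 * (1 - cos (θ1 - θ2)) = 0 := by linarith
  refine ⟨exp_injective (by linarith [pow_eq_zero_iff (two_ne_zero) |>.1 h3]), ?_⟩
  have h5 : 1 - cos (θ1 - θ2) = 0 := by
    rcases mul_eq_zero.1 h4 with h | h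
    · exact absurd h (by positivity)
    · exact h
  obtain ⟨k, hk⟩ := (cos_eq_one_iff _).1 (by linarith : cos (θ1 - θ2) = 1)
  exact ⟨k, by linarith⟩

theorem Phi_nonneg (k α κ s1 θ1 s2 θ2 : ℝ) : 0 ≤ Phi k α κ s1 θ1 s2 θ2 :=
  mul_nonneg (rpow_nonneg (Rf_nonneg _ _ _ _) _) (exp_pos _).le

theorem Phi_cont {k α κ : ℝ} (hα : 0 < α) :
    Continuous (fun p : (ℝ × ℝ) × (ℝ × ℝ) => Phi k α κ p.1.1 p.1.2 p.2.1 p.2.2) := by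
  unfold Phi Rf
  refine Continuous.mul ?_ ?_
  · refine Continuous.rpow_const (by fun_prop) (fun _ => Or.inr (by positivity))
  · refine continuous_exp.comp (Continuous.div continuous_const (by fun_prop) ?_)
    intro x
    exact (cosh_pos _).ne'

theorem psi_nonneg (sa ℓ s : ℝ) : 0 ≤ psi sa ℓ s := by unfold psi; positivity

theorem doubling {β C T : ℝ} {u f : ℝ → ℝ → ℝ → ℝ} (S : Sol β 2 C T u f)
    {k α κ c0 : ℝ} (HK : PhiKey (β + 1) C k α κ c0) (hα : 0 < α)
    {L sa sb r ε M tm Cψ : ℝ} (hr0 : 0 < r) (hsab : sa < sb) (hsb : sb < 0)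
    (hψ : Cψ = 6 / (sb - sa) ^ 2 * (exp (C - (β + 1) * sa) / (β + 1)) ^ 2) (hL : 0 ≤ L)
    (hLc : 2 * (2 * C) * Cψ + 2 * C + 2 * C / r < L * c0) (hε : 0 < ε) (hM : 2 * C ≤ ε * M)
    (htm : tm ∈ Icc r T) :
    ∀ s1 ∈ Icc (-M) sb, ∀ θ1 ∈ Icc 0 (2 * π), ∀ s2 ∈ Icc (-M) sb, ∀ θ2 ∈ Icc 0 (2 * π),
      FF u (β + 1) k α κ L (2 * C) sa (sb - sa) r ε tm s1 θ1 s2 θ2 tm ≤ 0 := by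
  have hb := S.hb
  have hC := S.hC
  have hℓ : 0 < sb - sa := by linarith
  have hr : ∀ s, s < 0 → 0 < exp ((β + 1) * s) ∧ exp ((β + 1) * s) < 1 := fun s hs =>
    ⟨exp_pos _, by rw [exp_lt_one_iff]; exact mul_neg_of_pos_of_neg hb hs⟩
  have mT : ∀ t, t ∈ Icc (tm - r) tm → t ∈ Icc 0 T := fun t ht =>
    ⟨by linarith [ht.1, htm.1], ht.2.trans htm.2⟩
  let K : Set ((ℝ × ℝ) × (ℝ × ℝ)) :=
    (Icc (-M) sb ×ˢ Icc 0 (2 * π)) ×ˢ (Icc (-M) sb ×ˢ Icc 0 (2 * π))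
  have hK : IsCompact K :=
    (isCompact_Icc.prod isCompact_Icc).prod (isCompact_Icc.prod isCompact_Icc)
  let F : (ℝ × ℝ) × (ℝ × ℝ) → ℝ → ℝ := fun x t =>
    FF u (β + 1) k α κ L (2 * C) sa (sb - sa) r ε tm x.1.1 x.1.2 x.2.1 x.2.2 t
  -- crude bound
  have crude : ∀ s1 θ1 s2 θ2 t, s1 < 0 → s2 < 0 → t ∈ Icc (tm - r) tm →
      FF u (β + 1) k α κ L (2 * C) sa (sb - sa) r ε tm s1 θ1 s2 θ2 t ≤ 2 * C -
        2 * C * (psi sa (sb - sa) s1 + psi sa (sb - sa) s2) - 2 * C / r * (tm - t) + ε * (s1 + s2) := by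
    intro s1 θ1 s2 θ2 t h1 h2 ht
    unfold FF
    have a1 := (abs_le.1 (S.ub _ θ1 t (hr s1 h1).1 (hr s1 h1).2 (mT t ht))).2
    have a2 := (abs_le.1 (S.ub _ θ2 t (hr s2 h2).1 (hr s2 h2).2 (mT t ht))).1
    have a3 := mul_nonneg hL (Phi_nonneg k α κ s1 θ1 s2 θ2)
    linarith
  have np : ∀ s, 0 ≤ 2 * C * psi sa (sb - sa) s := fun s => mul_nonneg (by linarith) (psi_nonneg _ _ _)
  have nt : ∀ t, t ∈ Icc (tm - r) tm → 0 ≤ 2 * C / r * (tm - t) := fun t ht =>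
    mul_nonneg (by positivity) (by linarith [ht.2])
  have psb : psi sa (sb - sa) sb = 1 := by
    unfold psi; rw [div_self hℓ.ne']; norm_num
  have ne : ∀ s, s < 0 → ε * s ≤ 0 := fun s hs => by
    exact mul_nonpos_of_nonneg_of_nonpos hε.le hs.le
  have main := time_lemma hK (t0 := tm - r) (t1 := tm) F ?_ ?_ ?_
  · intro s1 hs1 θ1 hθ1 s2 hs2 θ2 hθ2
    exact main ((s1, θ1), (s2, θ2)) ⟨⟨hs1, hθ1⟩, ⟨hs2, hθ2⟩⟩ tm ⟨by linarith, le_rfl⟩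
  · -- continuity
    rintro ⟨⟨s1, θ1⟩, ⟨s2, θ2⟩⟩ hx t ht
    have h1 : s1 < 0 := lt_of_le_of_lt hx.1.1.2 hsb
    have h2 : s2 < 0 := lt_of_le_of_lt hx.2.1.2 hsb
    have c1 := S.rc (θ0 := θ1) (hr s1 h1).1 (hr s1 h1).2 (mT t ht)
    have c2 := S.rc (θ0 := θ2) (hr s2 h2).1 (hr s2 h2).2 (mT t ht)
    have g1 : ContinuousWithinAt (fun p : ((ℝ × ℝ) × (ℝ × ℝ)) × ℝ =>
        (exp ((β + 1) * p.1.1.1), p.1.1.2, p.2)) (K ×ˢ Icc t tm) (((s1, θ1), (s2, θ2)), t) :=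
      Continuous.continuousWithinAt (by fun_prop)
    have g2 : ContinuousWithinAt (fun p : ((ℝ × ℝ) × (ℝ × ℝ)) × ℝ =>
        (exp ((β + 1) * p.1.2.1), p.1.2.2, p.2)) (K ×ˢ Icc t tm) (((s1, θ1), (s2, θ2)), t) :=
      Continuous.continuousWithinAt (by fun_prop)
    have k1 := ContinuousWithinAt.comp (f := fun p : ((ℝ × ℝ) × (ℝ × ℝ)) × ℝ =>
        (exp ((β + 1) * p.1.1.1), p.1.1.2, p.2)) (x := (((s1, θ1), (s2, θ2)), t)) c1 g1
        (fun p hp => ⟨hp.2.1, hp.2.2.trans htm.2⟩)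
    have k2 := ContinuousWithinAt.comp (f := fun p : ((ℝ × ℝ) × (ℝ × ℝ)) × ℝ =>
        (exp ((β + 1) * p.1.2.1), p.1.2.2, p.2)) (x := (((s1, θ1), (s2, θ2)), t)) c2 g2
        (fun p hp => ⟨hp.2.1, hp.2.2.trans htm.2⟩)
    have k3 : ContinuousWithinAt (fun p : ((ℝ × ℝ) × (ℝ × ℝ)) × ℝ =>
        L * Phi k α κ p.1.1.1 p.1.1.2 p.1.2.1 p.1.2.2) (K ×ˢ Icc t tm) (((s1, θ1), (s2, θ2)), t) :=
      (continuous_const.mul ((Phi_cont hα).comp continuous_fst)).continuousWithinAt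
    have k4 : ContinuousWithinAt (fun p : ((ℝ × ℝ) × (ℝ × ℝ)) × ℝ =>
        2 * C * (psi sa (sb - sa) p.1.1.1 + psi sa (sb - sa) p.1.2.1))
        (K ×ˢ Icc t tm) (((s1, θ1), (s2, θ2)), t) := by
      unfold psi
      exact Continuous.continuousWithinAt (by fun_prop)
    have k5 : ContinuousWithinAt (fun p : ((ℝ × ℝ) × (ℝ × ℝ)) × ℝ =>
        2 * C / r * (tm - p.2)) (K ×ˢ Icc t tm) (((s1, θ1), (s2, θ2)), t) :=
      Continuous.continuousWithinAt (by fun_prop)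
    have k6 : ContinuousWithinAt (fun p : ((ℝ × ℝ) × (ℝ × ℝ)) × ℝ =>
        ε * (p.1.1.1 + p.1.2.1)) (K ×ˢ Icc t tm) (((s1, θ1), (s2, θ2)), t) :=
      Continuous.continuousWithinAt (by fun_prop)
    exact ((((k1.sub k2).sub k3).sub k4).sub k5).add k6
  · -- initial time
    rintro ⟨⟨s1, θ1⟩, ⟨s2, θ2⟩⟩ hx
    have h1 : s1 < 0 := lt_of_le_of_lt hx.1.1.2 hsb
    have h2 : s2 < 0 := lt_of_le_of_lt hx.2.1.2 hsb
    have h3 := crude s1 θ1 s2 θ2 (tm - r) h1 h2 ⟨le_rfl, by linarith⟩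
    have h4 : 2 * C / r * (tm - (tm - r)) = 2 * C := by field_simp; ring
    have := np s1
    have := np s2
    have := ne s1 h1
    have := ne s2 h2
    simp only [F]
    linarith
  · -- maximum point
    rintro ⟨⟨s1, θ1⟩, ⟨s2, θ2⟩⟩ hx t ht hpos hmx
    simp only [F] at hpos hmx ⊢
    have htI : t ∈ Icc (tm - r) tm := ⟨ht.1.le, ht.2⟩
    have h1 : s1 < 0 := lt_of_le_of_lt hx.1.1.2 hsb
    have h2 : s2 < 0 := lt_of_le_of_lt hx.2.1.2 hsb
    have h3 := crude s1 θ1 s2 θ2 t h1 h2 htI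
    have n1 := np s1
    have n2 := np s2
    have n3 := ne s1 h1
    have n4 := ne s2 h2
    have n5 := nt t htI
    have u1 : s1 < sb := by
      refine lt_of_le_of_ne hx.1.1.2 (fun h => ?_)
      have e : psi sa (sb - sa) s1 = 1 := by rw [← psb]; exact congrArg _ h
      rw [e] at h3
      linarith
    have u2 : s2 < sb := by
      refine lt_of_le_of_ne hx.2.1.2 (fun h => ?_)
      have e : psi sa (sb - sa) s2 = 1 := by rw [← psb]; exact congrArg _ h
      rw [e] at h3
      linarith
    have l1 : -M < s1 := by
      refine lt_of_le_of_ne hx.1.1.1 (fun h => ?_)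
      have e : ε * s1 = -(ε * M) := by
        have h' : s1 = -M := h.symm
        rw [h']; ring
      linarith
    have l2 : -M < s2 := by
      refine lt_of_le_of_ne hx.2.1.1 (fun h => ?_)
      have e : ε * s2 = -(ε * M) := by
        have h' : s2 = -M := h.symm
        rw [h']; ring
      linarith
    have hR : 0 < Rf s1 θ1 s2 θ2 := by
      by_contra hcon
      obtain ⟨e1, j, e2⟩ := Rf_zero hcon
      have e3 : u (exp ((β + 1) * s1)) θ1 t = u (exp ((β + 1) * s2)) θ2 t := by
        rw [e1, e2]
        have P : Function.Periodic (fun θ => u (exp ((β + 1) * s2)) θ t) (2 * π) := fun θ => S.per _ _ _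
        exact P.int_mul j θ2
      have a3 := mul_nonneg hL (Phi_nonneg k α κ s1 θ1 s2 θ2)
      unfold FF at hpos
      linarith
    have glob : ∀ y1 η1 y2 η2 : ℝ, y1 ∈ Icc (-M) sb → y2 ∈ Icc (-M) sb →
        FF u (β + 1) k α κ L (2 * C) sa (sb - sa) r ε tm y1 η1 y2 η2 t ≤
        FF u (β + 1) k α κ L (2 * C) sa (sb - sa) r ε tm s1 θ1 s2 θ2 t := by
      intro y1 η1 y2 η2 hy1 hy2
      have P1 : Function.Periodic (fun η => FF u (β + 1) k α κ L (2 * C) sa (sb - sa) r ε tm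
          y1 η y2 η2 t) (2 * π) := fun η => by
        simp only [FF, Phi, S.per, Rf_per1]
      obtain ⟨z1, hz1, hz1'⟩ := P1.exists_mem_Ico₀ (by positivity) η1
      have P2 : Function.Periodic (fun η => FF u (β + 1) k α κ L (2 * C) sa (sb - sa) r ε tm
          y1 z1 y2 η t) (2 * π) := fun η => by
        simp only [FF, Phi, S.per, Rf_per2]
      obtain ⟨z2, hz2, hz2'⟩ := P2.exists_mem_Ico₀ (by positivity) η2
      have := hmx ((y1, z1), (y2, z2)) ⟨⟨hy1, ⟨hz1.1, hz1.2.le⟩⟩, ⟨hy2, ⟨hz2.1, hz2.2.le⟩⟩⟩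
      simp only at this hz1' hz2'
      rw [hz1', hz2']
      exact this
    have qb : ∀ s θ, s < sb → (6 * max ((s - sa) / (sb - sa)) 0 / (sb - sa) ^ 2)
        * (exp (-u (exp ((β + 1) * s)) θ t - (β + 1) * s) / (β + 1)) ^ 2 ≤ Cψ := by
      intro s θ hs
      have hs0 : s < 0 := by linarith
      rw [hψ]
      rcases le_or_gt s sa with h | h
      · rw [max_eq_right (div_nonpos_of_nonpos_of_nonneg (by linarith) hℓ.le)]
        simp only [mul_zero, zero_div, zero_mul]
        positivity
      · have a1 := (abs_le.1 (S.ub _ θ t (hr s hs0).1 (hr s hs0).2 (mT t htI))).1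
        have a2 : (β + 1) * sa ≤ (β + 1) * s := mul_le_mul_of_nonneg_left h.le hb.le
        have a3 : max ((s - sa) / (sb - sa)) 0 ≤ 1 := by
          refine max_le ?_ zero_le_one
          rw [div_le_one hℓ]; linarith
        gcongr
        · linarith
        · linarith
    have key := max_ineq S HK hL (by linarith : 0 ≤ 2 * C) (sa := sa) (ℓ := sb - sa) (r := r) (ε := ε)
      (tm := tm) h1 h2 (mT t htI) hR (qb s1 θ1 u1) (qb s2 θ2 u2) (by
        intro p1 m1 p2 m2
        have c1 : ContinuousAt (fun τ : ℝ => s1 + τ * p1) 0 := by fun_prop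
        have c2 : ContinuousAt (fun τ : ℝ => s2 + τ * p2) 0 := by fun_prop
        have b1 := c1.preimage_mem_nhds (t := Icc (-M) sb) (by
          simp only [zero_mul, add_zero]; exact Icc_mem_nhds l1 u1)
        have b2 := c2.preimage_mem_nhds (t := Icc (-M) sb) (by
          simp only [zero_mul, add_zero]; exact Icc_mem_nhds l2 u2)
        unfold IsLocalMax IsMaxFilter
        filter_upwards [b1, b2] with τ hτ1 hτ2
        simp only [zero_mul, add_zero]
        exact glob _ _ _ _ hτ1 hτ2)
    have d1 := S.dW (θ := θ1) (hr s1 h1).1 (hr s1 h1).2 (mT t htI)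
    have d2 := S.dW (θ := θ2) (hr s2 h2).1 (hr s2 h2).2 (mT t htI)
    have d3 : HasDerivWithinAt (fun s => 2 * C / r * (tm - s)) (2 * C / r * (-1)) (Icc 0 T) t :=
      (((hasDerivWithinAt_id t _).const_sub tm).const_mul _)
    have d4 := ((((d1.sub d2).sub_const (L * Phi k α κ s1 θ1 s2 θ2)).sub_const
      (2 * C * (psi sa (sb - sa) s1 + psi sa (sb - sa) s2))).sub d3).add_const (ε * (s1 + s2))
    exact back_step d4 (by linarith) (by linarith [htm.1]) ht.1 (ht.2.trans htm.2)

theorem Phi_le {k α κ : ℝ} (hα : 0 ≤ α) (hκ : 0 ≤ κ) (s1 θ1 s2 θ2 : ℝ) :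
    Phi k α κ s1 θ1 s2 θ2 ≤ (Rf s1 θ1 s2 θ2) ^ (α / 2) := by
  unfold Phi
  refine mul_le_of_le_one_right (rpow_nonneg (Rf_nonneg _ _ _ _) _) ?_
  rw [exp_le_one_iff]
  refine div_nonpos_of_nonpos_of_nonneg ?_ (cosh_pos _).le
  have : 0 ≤ α * κ / 2 := by positivity
  linarith

theorem psi_zero {sa ℓ s : ℝ} (hℓ : 0 < ℓ) (h : s ≤ sa) : psi sa ℓ s = 0 := by
  unfold psi
  rw [max_eq_right (div_nonpos_of_nonpos_of_nonneg (by linarith) hℓ.le)]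
  norm_num

theorem spatial (β C : ℝ) (hb : 0 < β + 1) (hC : 0 ≤ C) :
    ∃ α : ℝ, 0 < α ∧ α ≤ 1 ∧ ∀ σ ∈ Ioo (0:ℝ) 1, ∃ L : ℝ, 0 ≤ L ∧
      ∀ (T : ℝ) (u f : ℝ → ℝ → ℝ → ℝ), Sol β 2 C T u f →
        ∀ s1 θ1 s2 θ2 t : ℝ, s1 ≤ log (1 - σ) / (β + 1) → s2 ≤ log (1 - σ) / (β + 1) →
          t ∈ Icc σ T →
          u (exp ((β + 1) * s1)) θ1 t - u (exp ((β + 1) * s2)) θ2 t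
            ≤ L * (Rf s1 θ1 s2 θ2) ^ (α / 2) := by
  obtain ⟨k, α, κ, c0, hk, hα, hα1, hκ, hκ1, hc0, H⟩ := Phi_key (β + 1) C hb hC
  have HK : PhiKey (β + 1) C k α κ c0 := H
  refine ⟨α, hα, hα1, ?_⟩
  rintro σ ⟨hσ0, hσ1⟩
  obtain ⟨sa, hsa⟩ : ∃ x, x = log (1 - σ) / (β + 1) := ⟨_, rfl⟩
  obtain ⟨sb, hsb⟩ : ∃ x, x = log (1 - σ / 2) / (β + 1) := ⟨_, rfl⟩
  have hab : sa < sb := by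
    rw [hsa, hsb]
    exact div_lt_div_of_pos_right (log_lt_log (by linarith) (by linarith)) hb
  have hb0 : sb < 0 := by
    rw [hsb]
    exact div_neg_of_neg_of_pos (log_neg (by linarith) (by linarith)) hb
  obtain ⟨Cψ, hψ⟩ : ∃ x, x = 6 / (sb - sa) ^ 2 * (exp (C - (β + 1) * sa) / (β + 1)) ^ 2 := ⟨_, rfl⟩
  have hψ0 : 0 ≤ Cψ := by rw [hψ]; positivity
  have hnum : 0 ≤ 2 * (2 * C) * Cψ + 2 * C + 2 * C / σ := by positivity
  obtain ⟨L, hLd⟩ : ∃ x, x = (2 * (2 * C) * Cψ + 2 * C + 2 * C / σ + 1) / c0 := ⟨_, rfl⟩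
  have hL : 0 ≤ L := by rw [hLd]; positivity
  have hLc : 2 * (2 * C) * Cψ + 2 * C + 2 * C / σ < L * c0 := by
    rw [hLd, div_mul_cancel₀ _ hc0.ne']; linarith
  refine ⟨L, hL, ?_⟩
  intro T u f S s1 θ1 s2 θ2 t h1 h2 ht
  rw [← hsa] at h1 h2
  have core : ∀ η1 ∈ Icc 0 (2 * π), ∀ η2 ∈ Icc 0 (2 * π),
      u (exp ((β + 1) * s1)) η1 t - u (exp ((β + 1) * s2)) η2 t
        - L * (Rf s1 η1 s2 η2) ^ (α / 2) ≤ 0 := by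
    intro η1 hη1 η2 hη2
    refine le_of_forall_pos_le_add fun e he => ?_
    have hq : 0 < 1 - (s1 + s2) := by linarith
    obtain ⟨ε, hε⟩ : ∃ x, x = e / (1 - (s1 + s2)) := ⟨_, rfl⟩
    have hε0 : 0 < ε := by rw [hε]; positivity
    have hε1 : ε * (1 - (s1 + s2)) = e := by rw [hε, div_mul_cancel₀ _ hq.ne']
    obtain ⟨M, hM⟩ : ∃ x, x = max (2 * C / ε) (max (-s1) (-s2)) := ⟨_, rfl⟩
    have m1 : 2 * C / ε ≤ M := by rw [hM]; exact le_max_left _ _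
    have m2 : -s1 ≤ M := by rw [hM]; exact (le_max_left _ _).trans (le_max_right _ _)
    have m3 : -s2 ≤ M := by rw [hM]; exact (le_max_right _ _).trans (le_max_right _ _)
    rw [div_le_iff₀ hε0] at m1
    have key := doubling S HK hα hσ0 hab hb0 hψ hL hLc hε0 (M := M) (by linarith) ht s1
      ⟨by linarith, by linarith⟩ η1 hη1 s2 ⟨by linarith, by linarith⟩ η2 hη2
    unfold FF at key
    rw [psi_zero (by linarith) h1, psi_zero (by linarith) h2] at key
    have hP := mul_le_mul_of_nonneg_left (Phi_le (k := k) hα.le hκ.le s1 η1 s2 η2) hL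
    have : ε * (1 - (s1 + s2)) = ε - ε * (s1 + s2) := by ring
    have e3 : 2 * C / σ * (t - t) = 0 := by ring
    linarith
  have P1 : Function.Periodic (fun η => u (exp ((β + 1) * s1)) η t - u (exp ((β + 1) * s2)) θ2 t
        - L * (Rf s1 η s2 θ2) ^ (α / 2)) (2 * π) := fun η => by
    simp only [S.per, Rf_per1]
  obtain ⟨z1, hz1, hz1'⟩ := P1.exists_mem_Ico₀ (by positivity) θ1
  have P2 : Function.Periodic (fun η => u (exp ((β + 1) * s1)) z1 t - u (exp ((β + 1) * s2)) η t
        - L * (Rf s1 z1 s2 η) ^ (α / 2)) (2 * π) := fun η => by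
    simp only [S.per, Rf_per2]
  obtain ⟨z2, hz2, hz2'⟩ := P2.exists_mem_Ico₀ (by positivity) θ2
  have := core z1 ⟨hz1.1, hz1.2.le⟩ z2 ⟨hz2.1, hz2.2.le⟩
  rw [← hz2', ← hz1'] at this
  linarith

/-- squared Euclidean distance in polar coordinates -/
noncomputable def Dq (ρ1 θ1 ρ2 θ2 : ℝ) : ℝ :=
  (ρ1 * cos θ1 - ρ2 * cos θ2) ^ 2 + (ρ1 * sin θ1 - ρ2 * sin θ2) ^ 2

theorem Dq_nonneg (ρ1 θ1 ρ2 θ2 : ℝ) : 0 ≤ Dq ρ1 θ1 ρ2 θ2 := by unfold Dq; positivity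

theorem Dq_symm (ρ1 θ1 ρ2 θ2 : ℝ) : Dq ρ1 θ1 ρ2 θ2 = Dq ρ2 θ2 ρ1 θ1 := by unfold Dq; ring

theorem Dq_eq (ρ1 θ1 ρ2 θ2 : ℝ) :
    Dq ρ1 θ1 ρ2 θ2 = (ρ1 - ρ2) ^ 2 + 2 * ρ1 * ρ2 * (1 - cos (θ1 - θ2)) := by
  unfold Dq
  rw [cos_sub]
  have h1 := sin_sq_add_cos_sq θ1
  have h2 := sin_sq_add_cos_sq θ2
  linear_combination ρ1 ^ 2 * h1 + ρ2 ^ 2 * h2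

theorem rpow_sub_ge_one {γ x y : ℝ} (hγ : 1 ≤ γ) (hx : 0 < x) (hxy : x ≤ y) (hy : y ≤ 1) :
    y ^ γ - x ^ γ ≤ γ * (y - x) := by
  have hy0 : 0 < y := by linarith
  have hB := one_add_mul_self_le_rpow_one_add (s := x / y - 1) (by
    have : 0 ≤ x / y := by positivity
    linarith) hγ
  rw [add_sub_cancel, div_rpow hx.le hy0.le] at hB
  have hyγ : 0 < y ^ γ := rpow_pos_of_pos hy0 γ
  have h1 := mul_le_mul_of_nonneg_left hB hyγ.le
  rw [mul_div_cancel₀ _ hyγ.ne'] at h1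
  have h2 : y ^ γ * (1 + γ * (x / y - 1)) = y ^ γ - γ * ((y ^ γ / y) * (y - x)) := by
    field_simp
    ring
  have h3 : y ^ γ / y ≤ 1 := by
    rw [div_le_one hy0]
    calc y ^ γ ≤ y ^ (1:ℝ) := rpow_le_rpow_of_exponent_ge hy0 hy hγ
      _ = y := rpow_one y
  have h4 : (y ^ γ / y) * (y - x) ≤ 1 * (y - x) := mul_le_mul_of_nonneg_right h3 (by linarith)
  have h5 : γ * ((y ^ γ / y) * (y - x)) ≤ γ * (y - x) :=
    mul_le_mul_of_nonneg_left (by linarith) (by linarith)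
  linarith

theorem rpow_sub_le_one {γ x y : ℝ} (h0 : 0 < γ) (hγ : γ ≤ 1) (hx : 0 < x) (hxy : x ≤ y) :
    y ^ γ - x ^ γ ≤ (y - x) ^ γ := by
  have := rpow_add_le_add_rpow (p := γ) hx.le (sub_nonneg.2 hxy) h0.le hγ
  rw [add_sub_cancel] at this
  linarith

theorem convert_aux {γ ρ1 ρ2 c : ℝ} (hγ : 0 < γ) (h1 : 0 < ρ1) (h1' : ρ1 ≤ 1) (h2' : ρ2 ≤ 1)
    (h12 : ρ2 ≤ ρ1) (h2 : 0 < ρ2) (hc0 : 0 ≤ c) (hc2 : c ≤ 2) :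
    (ρ1 ^ γ - ρ2 ^ γ) ^ 2 + 2 * ρ1 ^ γ * ρ2 ^ γ * c ≤
      (5 + γ ^ 2) * ((ρ1 - ρ2) ^ 2 + 2 * ρ1 * ρ2 * c) ^ (min 1 γ) := by
  have hmon : 0 ≤ ρ1 ^ γ - ρ2 ^ γ := by
    have := rpow_le_rpow h2.le h12 hγ.le
    linarith
  have hpp : 0 < ρ1 * ρ2 := by positivity
  have hD1 : 0 ≤ 2 * ρ1 * ρ2 * c := by positivity
  have hprod : 2 * ρ1 ^ γ * ρ2 ^ γ * c = 2 * (ρ1 * ρ2) ^ γ * c := by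
    rw [mul_rpow h1.le h2.le]; ring
  rw [hprod]
  rcases le_total 1 γ with h | h
  · rw [min_eq_left h, rpow_one]
    have a1 := pow_le_pow_left₀ hmon (rpow_sub_ge_one h h2 h12 h1') 2
    have a2 : (ρ1 * ρ2) ^ γ ≤ ρ1 * ρ2 := by
      calc (ρ1 * ρ2) ^ γ ≤ (ρ1 * ρ2) ^ (1:ℝ) :=
            rpow_le_rpow_of_exponent_ge hpp (mul_le_one₀ h1' h2.le h2') h
        _ = _ := rpow_one _
    have a3 : 2 * (ρ1 * ρ2) ^ γ * c ≤ 2 * (ρ1 * ρ2) * c := by gcongr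
    nlinarith [sq_nonneg (ρ1 - ρ2), sq_nonneg γ, mul_nonneg (sq_nonneg γ) hD1]
  · rw [min_eq_right h]
    have a1 := pow_le_pow_left₀ hmon (rpow_sub_le_one hγ h h2 h12) 2
    have hs : 0 ≤ ρ1 - ρ2 := by linarith
    have a2 : ((ρ1 - ρ2) ^ γ) ^ 2 = ((ρ1 - ρ2) ^ 2) ^ γ := by
      rw [← rpow_natCast, ← rpow_natCast, ← rpow_mul hs, ← rpow_mul hs, mul_comm]
    have a3 : ((ρ1 - ρ2) ^ 2) ^ γ ≤ ((ρ1 - ρ2) ^ 2 + 2 * ρ1 * ρ2 * c) ^ γ :=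
      rpow_le_rpow (sq_nonneg _) (by linarith) hγ.le
    have a4 : c / 2 ≤ (c / 2) ^ γ := by
      rcases hc0.eq_or_lt with hh | hh
      · rw [← hh]; norm_num; rw [zero_rpow hγ.ne']
      · calc c / 2 = (c / 2) ^ (1:ℝ) := (rpow_one _).symm
          _ ≤ _ := rpow_le_rpow_of_exponent_ge (by linarith) (by linarith) h
    have a5 : (ρ1 * ρ2) ^ γ * (c / 2) ^ γ ≤ ((ρ1 - ρ2) ^ 2 + 2 * ρ1 * ρ2 * c) ^ γ := by
      rw [← mul_rpow hpp.le (by linarith)]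
      refine rpow_le_rpow (by positivity) ?_ hγ.le
      nlinarith [sq_nonneg (ρ1 - ρ2)]
    have a6 : 2 * (ρ1 * ρ2) ^ γ * c ≤ 4 * ((ρ1 * ρ2) ^ γ * (c / 2) ^ γ) := by
      have := mul_le_mul_of_nonneg_left a4 (rpow_nonneg hpp.le γ)
      linarith
    have a7 : 0 ≤ ((ρ1 - ρ2) ^ 2 + 2 * ρ1 * ρ2 * c) ^ γ := rpow_nonneg (by positivity) _
    have a8 : 0 ≤ γ ^ 2 * ((ρ1 - ρ2) ^ 2 + 2 * ρ1 * ρ2 * c) ^ γ := by positivity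
    linarith

theorem convert_Rf {b ρ1 θ1 ρ2 θ2 : ℝ} (hb : 0 < b) (h1 : 0 < ρ1) (h1' : ρ1 ≤ 1)
    (h2 : 0 < ρ2) (h2' : ρ2 ≤ 1) :
    Rf (log ρ1 / b) θ1 (log ρ2 / b) θ2 ≤ (5 + (b⁻¹) ^ 2) * (Dq ρ1 θ1 ρ2 θ2) ^ (min 1 b⁻¹) := by
  have e : ∀ ρ, 0 < ρ → exp (log ρ / b) = ρ ^ b⁻¹ := fun ρ h => by
    rw [rpow_def_of_pos h]; rfl
  rw [Rf_eq, Dq_eq, e _ h1, e _ h2]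
  have c0 : 0 ≤ 1 - cos (θ1 - θ2) := by linarith [cos_le_one (θ1 - θ2)]
  have c2 : 1 - cos (θ1 - θ2) ≤ 2 := by linarith [neg_one_le_cos (θ1 - θ2)]
  rcases le_total ρ2 ρ1 with h | h
  · exact convert_aux (inv_pos.2 hb) h1 h1' h2' h h2 c0 c2
  · have := convert_aux (inv_pos.2 hb) h2 h2' h1' h h1 c0 c2
    convert this using 1
    · ring
    · congr 2
      ring

theorem spatial2 (β C : ℝ) (hb : 0 < β + 1) (hC : 0 ≤ C) :
    ∃ α : ℝ, 0 < α ∧ α ≤ 1 ∧ ∀ σ ∈ Ioo (0:ℝ) 1, ∃ L : ℝ, 0 ≤ L ∧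
      ∀ (T : ℝ) (u f : ℝ → ℝ → ℝ → ℝ), Sol β 2 C T u f →
        ∀ ρ1 θ1 ρ2 θ2 t : ℝ, ρ1 ∈ Ioc 0 (1 - σ) → ρ2 ∈ Ioc 0 (1 - σ) → t ∈ Icc σ T →
          |u ρ1 θ1 t - u ρ2 θ2 t| ≤ L * (sqrt (Dq ρ1 θ1 ρ2 θ2)) ^ α := by
  obtain ⟨α, hα, hα1, H⟩ := spatial β C hb hC
  have hμ : 0 < min 1 (β + 1)⁻¹ := lt_min one_pos (inv_pos.2 hb)
  refine ⟨α * min 1 (β + 1)⁻¹, mul_pos hα hμ,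
    mul_le_one₀ hα1 hμ.le (min_le_left _ _), ?_⟩
  intro σ hσ
  obtain ⟨L, hL, H⟩ := H σ hσ
  refine ⟨L * (5 + ((β + 1)⁻¹) ^ 2) ^ (α / 2), by positivity, ?_⟩
  intro T u f S
  have half : ∀ ρ1 θ1 ρ2 θ2 t : ℝ, ρ1 ∈ Ioc 0 (1 - σ) → ρ2 ∈ Ioc 0 (1 - σ) → t ∈ Icc σ T →
          u ρ1 θ1 t - u ρ2 θ2 t ≤ L * (5 + ((β + 1)⁻¹) ^ 2) ^ (α / 2)
            * (sqrt (Dq ρ1 θ1 ρ2 θ2)) ^ (α * min 1 (β + 1)⁻¹) := by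
    intro ρ1 θ1 ρ2 θ2 t h1 h2 ht
    have hl : ∀ ρ, ρ ∈ Ioc 0 (1 - σ) → log ρ / (β + 1) ≤ log (1 - σ) / (β + 1) := fun ρ h =>
      div_le_div_of_nonneg_right (log_le_log h.1 h.2) hb.le
    have he : ∀ ρ, ρ ∈ Ioc 0 (1 - σ) → exp ((β + 1) * (log ρ / (β + 1))) = ρ := fun ρ h => by
      rw [mul_div_cancel₀ _ hb.ne', exp_log h.1]
    have key := H T u f S (log ρ1 / (β + 1)) θ1 (log ρ2 / (β + 1)) θ2 t (hl _ h1) (hl _ h2) ht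
    rw [he _ h1, he _ h2] at key
    refine key.trans ?_
    rw [mul_assoc]
    refine mul_le_mul_of_nonneg_left ?_ hL
    have hR := convert_Rf (θ1 := θ1) (θ2 := θ2) hb h1.1 (by linarith [h1.2, hσ.1]) h2.1
      (by linarith [h2.2, hσ.1])
    refine (rpow_le_rpow (Rf_nonneg _ _ _ _) hR (by positivity)).trans (le_of_eq ?_)
    have hD := Dq_nonneg ρ1 θ1 ρ2 θ2
    rw [mul_rpow (by positivity) (rpow_nonneg hD _), ← rpow_mul hD, sqrt_eq_rpow, ← rpow_mul hD]
    congr 2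
    ring
  intro ρ1 θ1 ρ2 θ2 t h1 h2 ht
  rw [abs_le]
  have a := half ρ1 θ1 ρ2 θ2 t h1 h2 ht
  have b := half ρ2 θ2 ρ1 θ1 t h2 h1 ht
  rw [Dq_symm] at b
  exact ⟨by linarith, a⟩

theorem time_core {β c C T : ℝ} {u f : ℝ → ℝ → ℝ → ℝ} (S : Sol β c C T u f)
    {h ρ0 θ0 t0 t1 L α σ : ℝ} (hh : 0 < h) (hh1 : h ≤ 1) (hα0 : 0 < α) (hα : α ≤ 1) (hL : 0 ≤ L)
    (hσ : 0 < σ) (hρ : h ≤ ρ0) (hρ1 : ρ0 + h / 2 ≤ 1 - σ) (ht0 : 0 ≤ t0) (ht1 : t1 ≤ T)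
    (h4 : t1 - t0 = h ^ 4)
    (Hsp : ∀ ρ θ, ρ ∈ Ioc 0 (1 - σ) → u ρ θ t0 - u ρ0 θ0 t0 ≤ L * (sqrt (Dq ρ θ ρ0 θ0)) ^ α) :
    u ρ0 θ0 t1 - u ρ0 θ0 t0 ≤
      (L + C + exp (|c| * C) * (32 * C + 96 * C * ((β + 1) ^ 2)⁻¹)) * h ^ α := by
  have hC := S.hC
  have hb := S.hb
  have hρ0 : 0 < ρ0 := by linarith
  have h44 : 0 < h ^ 4 := by positivity
  have u0 := abs_le.1 (S.ub ρ0 θ0 t0 hρ0 (by linarith) ⟨ht0, by linarith⟩)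
  have hhα : 0 < h ^ α := rpow_pos_of_pos hh α
  have hLh : 0 ≤ L * h ^ α := by positivity
  have key := barrier S (ρ0 := ρ0) (θ0 := θ0) (δ := h / 2) (m := u ρ0 θ0 t0 + L * h ^ α)
    (K1 := 8 * C / h ^ 2) (K2 := 24 * C * ρ0 ^ 2 / h ^ 2) (t0 := t0) (t1 := t1)
    (by linarith) (by linarith) (by linarith) (by positivity) (by positivity)
    (by
      have : 8 * C / h ^ 2 * (h / 2) ^ 2 = 2 * C := by field_simp; ring
      linarith) ht0 (by linarith) ht1 (by
      intro ρ hr θ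
      have hρp : 0 < ρ := by linarith [hr.1]
      have hc : 0 ≤ 1 - cos (θ - θ0) := by linarith [cos_le_one (θ - θ0)]
      have n1 : 0 ≤ 8 * C / h ^ 2 * (ρ - ρ0) ^ 2 := by positivity
      have n2 : 0 ≤ 24 * C * ρ0 ^ 2 / h ^ 2 * (1 - cos (θ - θ0)) :=
        mul_nonneg (by positivity) hc
      rcases le_or_gt (sqrt (Dq ρ θ ρ0 θ0)) h with hd | hd
      · have a1 := Hsp ρ θ ⟨hρp, by linarith [hr.2]⟩
        have a2 := mul_le_mul_of_nonneg_left (rpow_le_rpow (sqrt_nonneg _) hd hα0.le) hL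
        linarith
      · have a1 : h ^ 2 < Dq ρ θ ρ0 θ0 := (lt_sqrt hh.le).1 hd
        rw [Dq_eq] at a1
        have a2 : 2 * ρ * ρ0 * (1 - cos (θ - θ0)) ≤ 3 * ρ0 ^ 2 * (1 - cos (θ - θ0)) := by
          refine mul_le_mul_of_nonneg_right ?_ hc
          nlinarith [hr.2]
        have a3 : 8 * C / h ^ 2 * (ρ - ρ0) ^ 2 + 24 * C * ρ0 ^ 2 / h ^ 2 * (1 - cos (θ - θ0))
            = 8 * C / h ^ 2 * ((ρ - ρ0) ^ 2 + 3 * ρ0 ^ 2 * (1 - cos (θ - θ0))) := by ring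
        have a4 : 8 * C / h ^ 2 * h ^ 2 ≤
            8 * C / h ^ 2 * ((ρ - ρ0) ^ 2 + 3 * ρ0 ^ 2 * (1 - cos (θ - θ0))) :=
          mul_le_mul_of_nonneg_left (by linarith) (by positivity)
        rw [div_mul_cancel₀ _ (by positivity)] at a4
        have u1 := abs_le.1 (S.ub ρ θ t0 hρp (by linarith [hr.2]) ⟨ht0, by linarith⟩)
        linarith) ρ0 ⟨by linarith, by linarith⟩ θ0
  rw [sub_self, sub_self, cos_zero, h4] at key
  have b1 : ((ρ0 - h / 2) ^ 2)⁻¹ ≤ 4 * (ρ0 ^ 2)⁻¹ := by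
    have : (ρ0 / 2) ^ 2 ≤ (ρ0 - h / 2) ^ 2 := by
      apply pow_le_pow_left₀ (by linarith); linarith
    calc ((ρ0 - h / 2) ^ 2)⁻¹ ≤ ((ρ0 / 2) ^ 2)⁻¹ := inv_anti₀ (by positivity) this
      _ = 4 * (ρ0 ^ 2)⁻¹ := by field_simp; norm_num
  have b2 : 4 * (8 * C / h ^ 2) + 24 * C * ρ0 ^ 2 / h ^ 2 * (((β + 1) ^ 2)⁻¹ * ((ρ0 - h / 2) ^ 2)⁻¹)
      ≤ (32 * C + 96 * C * ((β + 1) ^ 2)⁻¹) / h ^ 2 := by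
    calc _ ≤ 4 * (8 * C / h ^ 2) + 24 * C * ρ0 ^ 2 / h ^ 2 * (((β + 1) ^ 2)⁻¹ * (4 * (ρ0 ^ 2)⁻¹)) := by
          gcongr
      _ = _ := by field_simp; ring
  have b3 : (C + exp (|c| * C) * (4 * (8 * C / h ^ 2) + 24 * C * ρ0 ^ 2 / h ^ 2 *
      (((β + 1) ^ 2)⁻¹ * ((ρ0 - h / 2) ^ 2)⁻¹))) * h ^ 4 ≤
      C * h ^ 4 + exp (|c| * C) * (32 * C + 96 * C * ((β + 1) ^ 2)⁻¹) * h ^ 2 := by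
    calc _ ≤ (C + exp (|c| * C) * ((32 * C + 96 * C * ((β + 1) ^ 2)⁻¹) / h ^ 2)) * h ^ 4 := by
          gcongr
      _ = _ := by field_simp
  have b4 : h ^ 2 ≤ h ^ α := by
    rw [← rpow_natCast]
    exact rpow_le_rpow_of_exponent_ge hh hh1 (by push_cast; linarith)
  have b5 : h ^ 4 ≤ h ^ α := by
    rw [← rpow_natCast]
    exact rpow_le_rpow_of_exponent_ge hh hh1 (by push_cast; linarith)
  have b6 : C * h ^ 4 ≤ C * h ^ α := by gcongr
  have b7 : exp (|c| * C) * (32 * C + 96 * C * ((β + 1) ^ 2)⁻¹) * h ^ 2 ≤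
      exp (|c| * C) * (32 * C + 96 * C * ((β + 1) ^ 2)⁻¹) * h ^ α := by gcongr
  have b8 : (L + C + exp (|c| * C) * (32 * C + 96 * C * ((β + 1) ^ 2)⁻¹)) * h ^ α =
    L * h ^ α + C * h ^ α + exp (|c| * C) * (32 * C + 96 * C * ((β + 1) ^ 2)⁻¹) * h ^ α := by ring
  rw [b8]
  norm_num at key
  linarith

theorem time_abs {β C T : ℝ} {u f : ℝ → ℝ → ℝ → ℝ} (S : Sol β 2 C T u f)
    {h ρ0 θ0 t0 t1 L α σ : ℝ} (hh : 0 < h) (hh1 : h ≤ 1) (hα0 : 0 < α) (hα : α ≤ 1) (hL : 0 ≤ L)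
    (hσ : 0 < σ) (hρ : h ≤ ρ0) (hρ1 : ρ0 + h / 2 ≤ 1 - σ) (ht0 : 0 ≤ t0) (ht1 : t1 ≤ T)
    (h4 : t1 - t0 = h ^ 4)
    (Hsp : ∀ ρ θ, ρ ∈ Ioc 0 (1 - σ) → |u ρ θ t0 - u ρ0 θ0 t0| ≤ L * (sqrt (Dq ρ θ ρ0 θ0)) ^ α) :
    |u ρ0 θ0 t1 - u ρ0 θ0 t0| ≤
      (L + C + exp (2 * C) * (32 * C + 96 * C * ((β + 1) ^ 2)⁻¹)) * h ^ α := by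
  have a := time_core S hh hh1 hα0 hα hL hσ hρ hρ1 ht0 ht1 h4
    (fun ρ θ h => (le_abs_self _).trans (Hsp ρ θ h))
  have b := time_core S.neg (θ0 := θ0) hh hh1 hα0 hα hL hσ hρ hρ1 ht0 ht1 h4
    (fun ρ θ h => by
      have := (neg_abs_le _).trans' (neg_le_neg (Hsp ρ θ h))
      linarith)
  rw [abs_neg] at b
  rw [abs_two] at a b
  rw [abs_le]
  exact ⟨by linarith, a⟩

theorem time_holder {β C T : ℝ} {u f : ℝ → ℝ → ℝ → ℝ} (S : Sol β 2 C T u f)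
    {ρ0 θ0 t0 t1 L α σ : ℝ} (hα0 : 0 < α) (hα : α ≤ 1) (hL : 0 ≤ L)
    (hσ : σ ∈ Ioo (0:ℝ) 1)
    (Hsp : ∀ ρ1 θ1 ρ2 θ2 t : ℝ, ρ1 ∈ Ioc 0 (1 - σ / 2) → ρ2 ∈ Ioc 0 (1 - σ / 2) →
      t ∈ Icc (σ / 2) T → |u ρ1 θ1 t - u ρ2 θ2 t| ≤ L * (sqrt (Dq ρ1 θ1 ρ2 θ2)) ^ α)
    (hρ : ρ0 ∈ Ioc 0 (1 - σ)) (ht0 : t0 ∈ Icc σ T) (ht1 : t1 ∈ Icc σ T) (h01 : t0 < t1) :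
    |u ρ0 θ0 t1 - u ρ0 θ0 t0| ≤
      (3 * L + C + exp (2 * C) * (32 * C + 96 * C * ((β + 1) ^ 2)⁻¹) + 2 * C * (4 / σ) ^ α)
        * (sqrt (t1 - t0)) ^ (α / 2) := by
  have hσ0 := hσ.1
  have hσ1 := hσ.2
  have hC := S.hC
  obtain ⟨h, hhd⟩ : ∃ h, h = sqrt (sqrt (t1 - t0)) := ⟨_, rfl⟩
  have hd : 0 < t1 - t0 := by linarith
  have hh : 0 < h := by rw [hhd]; exact sqrt_pos.2 (sqrt_pos.2 hd)
  have hs : h ^ 2 = sqrt (t1 - t0) := by rw [hhd, sq_sqrt (sqrt_nonneg _)]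
  have h4 : t1 - t0 = h ^ 4 := by
    have : h ^ 4 = (h ^ 2) ^ 2 := by ring
    rw [this, hs, sq_sqrt hd.le]
  have hp : (sqrt (t1 - t0)) ^ (α / 2) = h ^ α := by
    rw [← hs, ← rpow_natCast, ← rpow_mul hh.le]
    congr 1
    push_cast; ring
  rw [hp]
  have hhα : 0 < h ^ α := rpow_pos_of_pos hh α
  have hb := S.hb
  have hE : 0 ≤ exp (2 * C) * (32 * C + 96 * C * ((β + 1) ^ 2)⁻¹) := by positivity
  have hB : 0 ≤ 2 * C * (4 / σ) ^ α := by positivity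
  obtain ⟨E, hEd⟩ : ∃ x, x = exp (2 * C) * (32 * C + 96 * C * ((β + 1) ^ 2)⁻¹) := ⟨_, rfl⟩
  rw [← hEd] at hE ⊢
  have hex : (3 * L + C + E + 2 * C * (4 / σ) ^ α) * h ^ α
      = 3 * (L * h ^ α) + C * h ^ α + E * h ^ α + 2 * C * (4 / σ) ^ α * h ^ α := by ring
  have n1 : 0 ≤ L * h ^ α := by positivity
  have n2 : 0 ≤ C * h ^ α := by positivity
  have n3 : 0 ≤ E * h ^ α := by positivity
  have n4 : 0 ≤ 2 * C * (4 / σ) ^ α * h ^ α := by positivity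
  rw [hex]
  rcases le_or_gt h (σ / 4) with hc | hc
  · have base : ∀ ρ, h ≤ ρ → ρ + h / 2 ≤ 1 - σ / 2 →
        |u ρ θ0 t1 - u ρ θ0 t0| ≤ L * h ^ α + C * h ^ α + E * h ^ α := by
      intro ρ h1 h2
      have := time_abs S (θ0 := θ0) hh (by linarith) hα0 hα hL (half_pos hσ0) h1 h2
        (by linarith [ht0.1]) ht1.2 h4
        (fun ρ' θ' h' => Hsp ρ' θ' ρ θ0 t0 h' ⟨by linarith, by linarith⟩
          ⟨by linarith [ht0.1], ht0.2⟩)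
      rw [← hEd] at this
      linarith
    rcases le_or_gt h ρ0 with hr | hr
    · have := base ρ0 hr (by linarith [hρ.2])
      linarith
    · have b := base h le_rfl (by linarith)
      have near : ∀ t ∈ Icc σ T, |u ρ0 θ0 t - u h θ0 t| ≤ L * h ^ α := by
        intro t ht
        refine (Hsp ρ0 θ0 h θ0 t ⟨hρ.1, by linarith [hρ.2]⟩ ⟨hh, by linarith⟩
          ⟨by linarith [ht.1], ht.2⟩).trans ?_
        refine mul_le_mul_of_nonneg_left (rpow_le_rpow (sqrt_nonneg _) ?_ hα0.le) hL
        rw [sqrt_le_left hh.le, Dq_eq, sub_self, cos_zero]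
        nlinarith [hρ.1]
      have m1 := abs_le.1 (near t0 ht0)
      have m2 := abs_le.1 (near t1 ht1)
      have m3 := abs_le.1 b
      rw [abs_le]
      exact ⟨by linarith, by linarith⟩
  · have a1 := abs_le.1 (S.ub ρ0 θ0 t0 hρ.1 (by linarith [hρ.2]) ⟨by linarith [ht0.1], ht0.2⟩)
    have a2 := abs_le.1 (S.ub ρ0 θ0 t1 hρ.1 (by linarith [hρ.2]) ⟨by linarith [ht1.1], ht1.2⟩)
    have a3 : 1 ≤ (4 / σ) ^ α * h ^ α := by
      rw [← mul_rpow (by positivity) hh.le]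
      refine one_le_rpow ?_ hα0.le
      rw [div_mul_eq_mul_div, le_div_iff₀ hσ0]
      linarith
    have a4 : 2 * C * 1 ≤ 2 * C * ((4 / σ) ^ α * h ^ α) := mul_le_mul_of_nonneg_left a3 (by linarith)
    have a5 : 2 * C * ((4 / σ) ^ α * h ^ α) = 2 * C * (4 / σ) ^ α * h ^ α := by ring
    rw [abs_le]
    exact ⟨by linarith, by linarith⟩

/-- interior parabolic Hölder continuity for bounded weak solutions of
the quasilinear equation `∂_t u = e^{-2u} △̃u + f` on the punctured cone ball; `α'`
depends only on `β, C₁`, and `C₂` only on `β, C₁, σ`. -/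
theorem stmt10 (β C₁ : ℝ) (hβ : -1 < β) (hC₁ : 0 < C₁) :
    ∃ α' : ℝ, 0 < α' ∧
      ∀ σ : ℝ, σ ∈ Set.Ioo (0:ℝ) 1 →
        ∃ C₂ : ℝ,
          ∀ T : ℝ, 0 < T →
            ∀ u f : ℝ → ℝ → ℝ → ℝ,
              -- 2π-periodicity in θ
              (∀ ρ θ t : ℝ, u ρ (θ + 2 * π) t = u ρ θ t ∧ f ρ (θ + 2 * π) t = f ρ θ t) →
              -- sup |u| + sup |f| ≤ C₁
              (∀ ρ θ t ρ' θ' t' : ℝ, 0 < ρ → ρ < 1 → t ∈ Icc 0 T →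
                0 < ρ' → ρ' < 1 → t' ∈ Icc 0 T →
                |u ρ θ t| + |f ρ' θ' t'| ≤ C₁) →
              -- regularity: C² in (ρ,θ), C¹ in t
              (∀ t ∈ Icc (0:ℝ) T, ContDiffOn ℝ 2 (fun p : ℝ × ℝ => u p.1 p.2 t)
                {p : ℝ × ℝ | 0 < p.1 ∧ p.1 < 1}) →
              (∀ ρ θ : ℝ, 0 < ρ → ρ < 1 →
                ContDiffOn ℝ 1 (fun t => u ρ θ t) (Icc 0 T)) →
              -- the equation ∂_t u = e^{-2u} △̃u + f, pointwise
              (∀ ρ θ t : ℝ, 0 < ρ → ρ < 1 → t ∈ Icc 0 T →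
                dtime T (fun s => u ρ θ s) t
                  = Real.exp (-2 * u ρ θ t) * coneLapT β u ρ θ t + f ρ θ t) →
              -- finiteness of sup_t ∫ |∇̃u|² dṼ
              (∃ E : ℝ≥0∞, E ≠ ⊤ ∧ ∀ t ∈ Icc (0:ℝ) T,
                (∫⁻ θ in Icc (0:ℝ) (2 * π), ∫⁻ ρ in Ioo (0:ℝ) 1,
                  ENNReal.ofReal (gradSq β u ρ θ t * ((β + 1) * ρ))) ≤ E) →
              -- finiteness of ∫₀^T ∫ |∂_t u|² dṼ dt
              ((∫⁻ t in Icc (0:ℝ) T, ∫⁻ θ in Icc (0:ℝ) (2 * π), ∫⁻ ρ in Ioo (0:ℝ) 1,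
                  ENNReal.ofReal ((dtime T (fun s => u ρ θ s) t) ^ 2 * ((β + 1) * ρ))) ≠ ⊤) →
              -- interior parabolic Hölder continuity
              ∀ ρ₁ θ₁ ρ₂ θ₂ t s : ℝ,
                ρ₁ ∈ Ioc (0:ℝ) (1 - σ) → ρ₂ ∈ Ioc (0:ℝ) (1 - σ) →
                t ∈ Icc σ T → s ∈ Icc σ T →
                  |u ρ₁ θ₁ t - u ρ₂ θ₂ s| ≤
                    C₂ * (Real.sqrt ((ρ₁ * Real.cos θ₁ - ρ₂ * Real.cos θ₂) ^ 2
                            + (ρ₁ * Real.sin θ₁ - ρ₂ * Real.sin θ₂) ^ 2)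
                          + Real.sqrt |t - s|) ^ α' := by
  have hb : 0 < β + 1 := by linarith
  obtain ⟨α, hα0, hα1, H⟩ := spatial2 β C₁ hb hC₁.le
  refine ⟨α / 2, by positivity, ?_⟩
  intro σ hσ
  have hσ0 := hσ.1
  have hσ1 := hσ.2
  obtain ⟨L, hL, H⟩ := H (σ / 2) ⟨by linarith, by linarith⟩
  obtain ⟨A, hA⟩ : ∃ x, x = 3 * L + C₁ + exp (2 * C₁) * (32 * C₁ + 96 * C₁ * ((β + 1) ^ 2)⁻¹)
    + 2 * C₁ * (4 / σ) ^ α := ⟨_, rfl⟩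
  have hA0 : 0 ≤ A := by rw [hA]; positivity
  refine ⟨2 * L + A, ?_⟩
  intro T hT u f hper hbd hcx hct hpde _ hen ρ₁ θ₁ ρ₂ θ₂ t s h1 h2 ht hs
  have S : Sol β 2 C₁ T u f :=
    { hb := hb
      hT := hT
      hC := hC₁.le
      per := fun ρ θ t => (hper ρ θ t).1
      ub := fun ρ θ t a b c => by
        have := hbd ρ θ t ρ θ t a b c a b c
        linarith [abs_nonneg (f ρ θ t)]
      fb := fun ρ θ t a b c => by
        have := hbd ρ θ t ρ θ t a b c a b c
        linarith [abs_nonneg (u ρ θ t)]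
      cx := hcx
      ct := hct
      pde := hpde
      en := hen }
  have Hsp := H T u f S
  have sp := Hsp ρ₁ θ₁ ρ₂ θ₂ t ⟨h1.1, by linarith [h1.2]⟩ ⟨h2.1, by linarith [h2.2]⟩
    ⟨by linarith [ht.1], ht.2⟩
  have tm : |u ρ₂ θ₂ t - u ρ₂ θ₂ s| ≤ A * (sqrt |t - s|) ^ (α / 2) := by
    rcases lt_trichotomy s t with h | h | h
    · rw [abs_of_pos (sub_pos.2 h), hA]
      exact time_holder S hα0 hα1 hL hσ Hsp h2 hs ht h
    · rw [h, sub_self, abs_zero]; positivity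
    · rw [abs_sub_comm, abs_sub_comm t s, abs_of_pos (sub_pos.2 h), hA]
      exact time_holder S hα0 hα1 hL hσ Hsp h2 ht hs h
  change _ ≤ (2 * L + A) * (sqrt (Dq ρ₁ θ₁ ρ₂ θ₂) + sqrt |t - s|) ^ (α / 2)
  obtain ⟨d, hd⟩ : ∃ x, x = sqrt (Dq ρ₁ θ₁ ρ₂ θ₂) := ⟨_, rfl⟩
  obtain ⟨q, hq⟩ : ∃ x, x = sqrt |t - s| := ⟨_, rfl⟩
  have hd0 : 0 ≤ d := by rw [hd]; positivity
  have hq0 : 0 ≤ q := by rw [hq]; positivity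
  have hd2 : d ≤ 2 := by
    rw [hd, sqrt_le_left (by norm_num), Dq_eq]
    have a1 : 1 - cos (θ₁ - θ₂) ≤ 2 := by linarith [neg_one_le_cos (θ₁ - θ₂)]
    have a2 : 0 ≤ 2 * ρ₁ * ρ₂ := by
      have := h1.1
      have := h2.1
      positivity
    have a3 := mul_le_mul_of_nonneg_left a1 a2
    nlinarith [h1.1, h1.2, h2.1, h2.2]
  rw [← hd, ← hq]
  rw [← hd] at sp
  rw [← hq] at tm
  have e1 : d ^ α ≤ 2 * (d + q) ^ (α / 2) := by
    have : d ^ α = d ^ (α / 2) * d ^ (α / 2) := by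
      rw [← rpow_add_of_nonneg hd0 (by positivity) (by positivity)]
      congr 1; ring
    rw [this]
    refine mul_le_mul ?_ (rpow_le_rpow hd0 (by linarith) (by positivity))
      (rpow_nonneg hd0 _) (by norm_num)
    calc d ^ (α / 2) ≤ 2 ^ (α / 2) := rpow_le_rpow hd0 hd2 (by positivity)
      _ ≤ 2 ^ (1:ℝ) := rpow_le_rpow_of_exponent_le (by norm_num) (by linarith)
      _ = 2 := rpow_one 2
  have e2 : q ^ (α / 2) ≤ (d + q) ^ (α / 2) := rpow_le_rpow hq0 (by linarith) (by positivity)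
  have e3 := mul_le_mul_of_nonneg_left e1 hL
  have e4 := mul_le_mul_of_nonneg_left e2 hA0
  have e5 := abs_sub_le (u ρ₁ θ₁ t) (u ρ₂ θ₂ t) (u ρ₂ θ₂ s)
  have e6 : (2 * L + A) * (d + q) ^ (α / 2) =
    L * (2 * (d + q) ^ (α / 2)) + A * (d + q) ^ (α / 2) := by ring
  linarith
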